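/- arXiv:2404.19005 — 8 statements merged into one kernel-verified Lean document; each statement's English description precedes it below -/
import Mathlib

section
/- Let n ≥ 1. The second-moment operator of uniformly random degree-2 IQP circuits satisfies E_f[ (U_f|+ⁿ⟩⟨+ⁿ|U_f†) ⊗ (U_f|+ⁿ⟩⟨+ⁿ|U_f†) ] = 2^(−2n) · ( Id + 𝕊 + ℙ − 2·𝕏 ), where, with x,y ranging over 𝔽₂ⁿ, Id = Σ_{x,y}|x,y⟩⟨x,y| is the identity on ℂ^(2^n)⊗ℂ^(2^n), 𝕊 = Σ_{x,y}|x,y⟩⟨y,x| is the swap of the two copies, ℙ = Σ_{x,y}|x,x⟩⟨y,y|, and 𝕏 = Σ_x |x,x⟩⟨x,x|. -/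
open scoped BigOperators
open Matrix

namespace Stmt1

/-- Computational basis labels for `n` qubits: `𝔽₂ⁿ`. -/
abbrev QState (n : ℕ) := Fin n → ZMod 2

/-- Index pairs `i < j` of qubits. -/
abbrev PairIdx (n : ℕ) := {p : Fin n × Fin n // p.1 < p.2}

/-- `(-1)^a` as a complex number. -/
def sgn (a : ZMod 2) : ℂ := (-1 : ℂ) ^ a.val

/-- Parameters of a uniformly random degree-2 IQP circuit. -/
abbrev Param (n : ℕ) := QState n × (PairIdx n → ZMod 2)

/-- The degree-2 polynomial `f(z) = Σ_{i<j} b_{ij} z_i z_j + Σ_i a_i z_i` over `𝔽₂`. -/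
def deg2 {n : ℕ} (θ : Param n) (z : QState n) : ZMod 2 :=
  (∑ p : PairIdx n, θ.2 p * z p.1.1 * z p.1.2) + ∑ i, θ.1 i * z i

/-- The diagonal IQP unitary `U_f|x⟩ = (−1)^{f(x)}|x⟩`. -/
noncomputable def Uf {n : ℕ} (f : QState n → ZMod 2) : Matrix (QState n) (QState n) ℂ :=
  Matrix.diagonal fun x => sgn (f x)

/-- The uniform superposition `|+ⁿ⟩ = 2^{−n/2} Σ_x |x⟩`. -/
noncomputable def plusV (n : ℕ) : QState n → ℂ := fun _ => (((Real.sqrt 2)⁻¹ : ℝ) ^ n : ℝ)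

/-- The pure state `U_f |+ⁿ⟩⟨+ⁿ| U_f†`. -/
noncomputable def rho {n : ℕ} (θ : Param n) : Matrix (QState n) (QState n) ℂ :=
  Uf (deg2 θ) * Matrix.vecMulVec (plusV n) (star (plusV n)) * (Uf (deg2 θ))ᴴ

/-- The two-fold tensor copy `ρ ⊗ ρ` on `ℂ^(2^n) ⊗ ℂ^(2^n)`. -/
noncomputable def twoCopy {n : ℕ} (ρ : Matrix (QState n) (QState n) ℂ) :
    Matrix (QState n × QState n) (QState n × QState n) ℂ :=
  Matrix.of fun p r => ρ p.1 r.1 * ρ p.2 r.2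

/-- The second-moment operator of uniformly random degree-2 IQP circuits. -/
noncomputable def M2 (n : ℕ) : Matrix (QState n × QState n) (QState n × QState n) ℂ :=
  ((Fintype.card (Param n) : ℂ))⁻¹ • ∑ θ : Param n, twoCopy (rho θ)

/-- The swap of the two copies: `𝕊 = Σ_{x,y} |x,y⟩⟨y,x|`. -/
def SwapM (n : ℕ) : Matrix (QState n × QState n) (QState n × QState n) ℂ :=
  Matrix.of fun p r => if p.1 = r.2 ∧ p.2 = r.1 then 1 else 0

/-- `ℙ = Σ_{x,y} |x,x⟩⟨y,y|`. -/
def PM (n : ℕ) : Matrix (QState n × QState n) (QState n × QState n) ℂ :=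
  Matrix.of fun p r => if p.1 = p.2 ∧ r.1 = r.2 then 1 else 0

/-- `𝕏 = Σ_x |x,x⟩⟨x,x|`. -/
def XM (n : ℕ) : Matrix (QState n × QState n) (QState n × QState n) ℂ :=
  Matrix.of fun p r => if p.1 = p.2 ∧ r.1 = r.2 ∧ p.1 = r.1 then 1 else 0

/-- `sgn` is the nontrivial character of `ZMod 2`. -/
lemma sgn_add (a b : ZMod 2) : sgn (a + b) = sgn a * sgn b := by
  rw [sgn, sgn, sgn, ZMod.val_add, ← neg_one_pow_eq_pow_mod_two, pow_add]

lemma star_sgn (a : ZMod 2) : star (sgn a) = sgn a := by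
  simp [sgn]

lemma sum_sgn_addMonoidHom {A : Type*} [AddCommGroup A] [Fintype A] (L : A →+ ZMod 2)
    [Decidable (∀ a, L a = 0)] :
    ∑ a, sgn (L a) = if ∀ a, L a = 0 then (Fintype.card A : ℂ) else 0 := by
  split_ifs with h
  · simp [h, sgn]
  · push Not at h
    obtain ⟨a₀, h₀⟩ := h
    have h₁ : L a₀ = 1 := by
      generalize L a₀ = t at h₀
      revert t
      decide
    have key : ∑ a, sgn (L a) = -∑ a, sgn (L a) := by
      rw [← Finset.sum_neg_distrib]
      refine Fintype.sum_equiv (Equiv.addLeft a₀) _ _ fun a => ?_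
      have hone : sgn 1 = -1 := by simp [sgn, ZMod.val_one]
      simp [map_add, sgn_add, h₁, hone]
    linear_combination key / 2

lemma rho_apply {n : ℕ} (θ : Param n) (x z : QState n) :
    rho θ x z = ((2 : ℂ) ^ n)⁻¹ * sgn (deg2 θ x + deg2 θ z) := by
  have hplus : plusV n x * star (plusV n z) = ((2 : ℂ) ^ n)⁻¹ := by
    have h : ((Real.sqrt 2)⁻¹ : ℝ) ^ n * (Real.sqrt 2)⁻¹ ^ n = (2 ^ n)⁻¹ := by
      rw [← mul_pow, ← mul_inv, Real.mul_self_sqrt zero_le_two, inv_pow]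
    simp only [plusV, RCLike.star_def, Complex.conj_ofReal]
    rw [← Complex.ofReal_mul, h]
    push_cast
    rfl
  simp only [rho, Uf, Matrix.diagonal_conjTranspose, Matrix.mul_diagonal, Matrix.diagonal_mul,
    Matrix.vecMulVec_apply, Pi.star_apply, star_sgn, sgn_add]
  rw [hplus]
  ring

/-- For fixed basis labels, the phase of a matrix entry of `ρ ⊗ ρ`, additive in the parameters. -/
def phaseHom {n : ℕ} (x y z w : QState n) : Param n →+ ZMod 2 :=
  AddMonoidHom.mk' (fun θ => deg2 θ x + deg2 θ z + (deg2 θ y + deg2 θ w)) fun θ η => by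
    simp only [deg2, Prod.fst_add, Prod.snd_add, Pi.add_apply, add_mul, Finset.sum_add_distrib]
    ring

lemma eq_pairs_of_moments {n : ℕ} {x y z w : QState n}
    (h₁ : ∀ i, x i + z i + (y i + w i) = 0)
    (h₂ : ∀ i j, i < j → x i * x j + z i * z j + (y i * y j + w i * w j) = 0) :
    (x = z ∧ y = w) ∨ (x = w ∧ y = z) ∨ (x = y ∧ z = w) := by
  have cross : ∀ x y z w x' y' z' w' : ZMod 2, x + z + (y + w) = 0 → x' + z' + (y' + w') = 0 →
      x * x' + z * z' + (y * y' + w * w') = 0 → (x + z) * (y' + z') = (y + z) * (x' + z') := by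
    decide
  have hcross : ∀ i j, (x i + z i) * (y j + z j) = (y i + z i) * (x j + z j) := by
    intro i j
    rcases lt_trichotomy i j with h | rfl | h
    · exact cross _ _ _ _ _ _ _ _ (h₁ i) (h₁ j) (h₂ i j h)
    · ring
    · have := cross _ _ _ _ _ _ _ _ (h₁ j) (h₁ i) (h₂ j i h)
      linear_combination -this
  by_cases hxz : x = z
  · subst hxz
    refine Or.inl ⟨rfl, funext fun i => ?_⟩
    have := h₁ i
    generalize x i = a, y i = b, w i = c at this
    revert a b c
    decide
  · obtain ⟨i, hi⟩ := Function.ne_iff.mp hxz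
    have hdich : ∀ x y z x' y' z' w' : ZMod 2, x ≠ z → x' + z' + (y' + w') = 0 →
        (x + z) * (y' + z') = (y + z) * (x' + z') →
        (y = z → x' = w' ∧ y' = z') ∧ (y ≠ z → x' = y' ∧ z' = w') := by
      decide
    have hj := fun j => hdich _ _ _ _ _ _ _ hi (h₁ j) (hcross i j)
    by_cases hyz : y i = z i
    · exact Or.inr (Or.inl ⟨funext fun j => ((hj j).1 hyz).1, funext fun j => ((hj j).1 hyz).2⟩)
    · exact Or.inr (Or.inr ⟨funext fun j => ((hj j).2 hyz).1, funext fun j => ((hj j).2 hyz).2⟩)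

lemma phaseHom_eq_zero_iff {n : ℕ} (x y z w : QState n) :
    (∀ θ, phaseHom x y z w θ = 0) ↔
      (x = z ∧ y = w) ∨ (x = w ∧ y = z) ∨ (x = y ∧ z = w) := by
  constructor
  · intro h
    refine eq_pairs_of_moments (fun i => ?_) fun i j hij => ?_
    · simpa [phaseHom, deg2, Pi.single_apply] using h (Pi.single i 1, 0)
    · simpa [phaseHom, deg2, Pi.single_apply] using h (0, Pi.single ⟨(i, j), hij⟩ 1)
  · have h₁ : ∀ a b : ZMod 2, a + a + (b + b) = 0 := by decide
    have h₂ : ∀ a b : ZMod 2, a + b + (b + a) = 0 := by decide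
    have h₃ : ∀ a b : ZMod 2, a + b + (a + b) = 0 := by decide
    rintro (⟨rfl, rfl⟩ | ⟨rfl, rfl⟩ | ⟨rfl, rfl⟩) θ
    · exact h₁ _ _
    · exact h₂ _ _
    · exact h₃ _ _

lemma M2_apply {n : ℕ} (x y z w : QState n) :
    M2 n (x, y) (z, w) = ((2 : ℂ) ^ (2 * n))⁻¹ *
      if (x = z ∧ y = w) ∨ (x = w ∧ y = z) ∨ (x = y ∧ z = w) then 1 else 0 := by
  classical
  have hterm : ∀ θ : Param n, twoCopy (rho θ) (x, y) (z, w) =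
      ((2 : ℂ) ^ (2 * n))⁻¹ * sgn (phaseHom x y z w θ) := by
    intro θ
    have hphase : phaseHom x y z w θ = deg2 θ x + deg2 θ z + (deg2 θ y + deg2 θ w) := rfl
    rw [hphase, sgn_add, two_mul, pow_add, mul_inv]
    simp only [twoCopy, Matrix.of_apply, rho_apply]
    ring
  have hcard : (Fintype.card (Param n) : ℂ) ≠ 0 := Nat.cast_ne_zero.mpr Fintype.card_ne_zero
  simp only [M2, Matrix.smul_apply, Matrix.sum_apply, hterm, ← Finset.mul_sum,
    sum_sgn_addMonoidHom, phaseHom_eq_zero_iff, smul_eq_mul]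
  split_ifs
  · field_simp
  · simp

/-- `E_f[(U_f|+ⁿ⟩⟨+ⁿ|U_f†)^{⊗2}] = 2^{−2n}(Id + 𝕊 + ℙ − 2𝕏)`. -/
theorem second_moment_of_plus {n : ℕ} (hn : 1 ≤ n) :
    M2 n = ((2 : ℂ) ^ (2 * n))⁻¹ •
      ((1 : Matrix (QState n × QState n) (QState n × QState n) ℂ) + SwapM n + PM n
        - (2 : ℂ) • XM n) := by
  ext ⟨x, y⟩ ⟨z, w⟩
  rw [M2_apply]
  simp only [Matrix.smul_apply, Matrix.sub_apply, Matrix.add_apply, Matrix.one_apply, SwapM, PM,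
    XM, Matrix.of_apply, smul_eq_mul, Prod.mk.injEq]
  congr 1
  by_cases hxz : x = z <;> by_cases hyw : y = w <;> by_cases hxw : x = w <;>
    by_cases hyz : y = z <;> by_cases hxy : x = y <;> by_cases hzw : z = w <;>
    grind

end Stmt1
end

section
/- Let n ≥ 1. The average collision probability of uniformly random degree-2 IQP circuits equals Σ_{x∈𝔽₂ⁿ} E_f[ p_f(x)² ] = 3·2^(−n) − 2^(1−2n). Equivalently, the ideal linear cross-entropy score χ̄ := 2ⁿ Σ_{x∈𝔽₂ⁿ} E_f[p_f(x)²] − 1 equals 2 − 2^(1−n). -/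
open scoped BigOperators

namespace Stmt2

/-- Computational basis labels for `n` qubits: `𝔽₂ⁿ`. -/
abbrev QState (n : ℕ) := Fin n → ZMod 2

/-- Index pairs `i < j` of qubits. -/
abbrev PairIdx (n : ℕ) := {p : Fin n × Fin n // p.1 < p.2}

/-- `(-1)^a` as a real number. -/
def sgnR (a : ZMod 2) : ℝ := (-1 : ℝ) ^ a.val

/-- Parameters of a uniformly random degree-2 IQP circuit. -/
abbrev Param (n : ℕ) := QState n × (PairIdx n → ZMod 2)

/-- The degree-2 polynomial `f(z) = Σ_{i<j} b_{ij} z_i z_j + Σ_i a_i z_i` over `𝔽₂`. -/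
def deg2 {n : ℕ} (θ : Param n) (z : QState n) : ZMod 2 :=
  (∑ p : PairIdx n, θ.2 p * z p.1.1 * z p.1.2) + ∑ i, θ.1 i * z i

/-- The X-basis output probability
`p_f(x) = (2^{−n} Σ_z (−1)^{f(z)+x·z})²` of the IQP circuit `U_f`. -/
noncomputable def pOut {n : ℕ} (f : QState n → ZMod 2) (x : QState n) : ℝ :=
  (((2 : ℝ) ^ n)⁻¹ * ∑ z : QState n, sgnR (f z + ∑ i, x i * z i)) ^ 2

theorem sgnR_zero : sgnR 0 = 1 := by simp [sgnR]

theorem sgnR_one : sgnR 1 = -1 := by simp [sgnR, ZMod.val_one]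

theorem eq_zero_or_eq_one (a : ZMod 2) : a = 0 ∨ a = 1 := by
  revert a
  decide

theorem sgnR_add (a b : ZMod 2) : sgnR (a + b) = sgnR a * sgnR b := by
  rcases eq_zero_or_eq_one a with rfl | rfl <;> rcases eq_zero_or_eq_one b with rfl | rfl <;>
    simp [sgnR_zero, sgnR_one, CharTwo.add_self_eq_zero]

theorem sgnR_sum {ι : Type*} (s : Finset ι) (g : ι → ZMod 2) :
    sgnR (∑ i ∈ s, g i) = ∏ i ∈ s, sgnR (g i) := by
  classical
  induction s using Finset.induction_on with
  | empty => simp [sgnR_zero]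
  | insert i s hi ih => rw [Finset.sum_insert hi, Finset.prod_insert hi, sgnR_add, ih]

theorem sum_sgnR_mul (c : ZMod 2) : ∑ t : ZMod 2, sgnR (t * c) = if c = 0 then 2 else 0 := by
  have h : ∀ f : ZMod 2 → ℝ, ∑ t, f t = f 0 + f 1 := fun f => Fin.sum_univ_two f
  rw [h]
  rcases eq_zero_or_eq_one c with rfl | rfl
  · norm_num [sgnR_zero]
  · norm_num [sgnR_zero, sgnR_one]

/-- Orthogonality of the characters of `𝔽₂^ι`. -/
theorem sum_sgnR_linear {ι : Type*} [Fintype ι] [DecidableEq ι] (c : ι → ZMod 2) :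
    ∑ t : ι → ZMod 2, sgnR (∑ i, t i * c i) =
      if c = 0 then (Fintype.card (ι → ZMod 2) : ℝ) else 0 := by
  simp_rw [sgnR_sum]
  rw [← Fintype.prod_sum (fun i (t : ZMod 2) => sgnR (t * c i))]
  simp_rw [sum_sgnR_mul]
  split_ifs with h
  · simp [h, ZMod.card]
  · obtain ⟨i, hi⟩ := Function.ne_iff.mp h
    exact Finset.prod_eq_zero (Finset.mem_univ i) (if_neg hi)

theorem deg2_add_linear {n : ℕ} (θ : Param n) (x z : QState n) :
    deg2 θ z + ∑ i, x i * z i = deg2 (θ + (x, 0)) z := by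
  simp [deg2, add_mul, Finset.sum_add_distrib, add_assoc]

theorem sum_pOut_sq_eq {n : ℕ} (x : QState n) :
    ∑ θ : Param n, (pOut (deg2 θ) x) ^ 2 =
      (((2 : ℝ) ^ n)⁻¹) ^ 4 * ∑ θ : Param n, (∑ z, sgnR (deg2 θ z)) ^ 4 := by
  rw [← Equiv.sum_comp (Equiv.addRight ((x, 0) : Param n)) fun θ => (∑ z, sgnR (deg2 θ z)) ^ 4,
    Finset.mul_sum]
  refine Finset.sum_congr rfl fun θ _ => ?_
  simp only [pOut, deg2_add_linear, Equiv.coe_addRight]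
  ring

theorem sum_pow_four_eq {n : ℕ} (g : QState n → ℝ) :
    (∑ z, g z) ^ 4 = ∑ w, ∑ u, ∑ v, ∑ t, g w * g (w + u) * g (w + v) * g (w + u + v + t) := by
  have h : ∀ c : QState n, ∑ u, g (c + u) = ∑ z, g z := fun c => Equiv.sum_comp (Equiv.addLeft c) g
  simp_rw [← Finset.mul_sum, h, ← Finset.sum_mul, ← Finset.mul_sum, h, ← Finset.sum_mul,
    ← Finset.mul_sum, h, ← Finset.sum_mul]
  ring

/-- Over `𝔽₂`, the vectors `u` and `v` are linearly dependent iff all their `2 × 2` minors vanish. -/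
theorem minors_eq_zero_iff {n : ℕ} (u v : QState n) :
    (∀ p : PairIdx n, u p.1.1 * v p.1.2 + u p.1.2 * v p.1.1 = 0) ↔ u = 0 ∨ v = 0 ∨ u = v := by
  constructor
  · intro h
    have sym : ∀ i j, u i * v j = u j * v i := by
      intro i j
      rcases lt_trichotomy i j with hij | rfl | hij
      · exact CharTwo.add_eq_zero.mp (h ⟨(i, j), hij⟩)
      · rfl
      · exact (CharTwo.add_eq_zero.mp (h ⟨(j, i), hij⟩)).symm
    by_contra! hne
    obtain ⟨i, hi⟩ := Function.ne_iff.mp hne.1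
    obtain ⟨j, hj⟩ := Function.ne_iff.mp hne.2.1
    have hi1 := (eq_zero_or_eq_one (u i)).resolve_left hi
    have hj1 := (eq_zero_or_eq_one (v j)).resolve_left hj
    have hvi : v i = 1 := by
      have := sym i j
      rw [hi1, hj1, one_mul] at this
      exact (eq_zero_or_eq_one (v i)).resolve_left fun h0 => by simp [h0] at this
    refine hne.2.2 (funext fun k => ?_)
    have := sym i k
    rw [hi1, hvi, one_mul, mul_one] at this
    exact this.symm
  · rintro (rfl | rfl | rfl) p
    · simp
    · simp
    · rw [mul_comm, CharTwo.add_self_eq_zero]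

theorem deg2_four_sum {n : ℕ} (θ : Param n) (w u v t : QState n) :
    deg2 θ w + deg2 θ (w + u) + deg2 θ (w + v) + deg2 θ (w + u + v + t) =
      (∑ i, θ.1 i * t i) + ∑ p : PairIdx n, θ.2 p *
        (u p.1.1 * v p.1.2 + u p.1.2 * v p.1.1 + t p.1.1 * (w + u + v) p.1.2 +
          t p.1.2 * (w + u + v) p.1.1 + t p.1.1 * t p.1.2) := by
  simp only [deg2]
  rw [show ∀ a b c d e f g h : ZMod 2, a + b + (c + d) + (e + f) + (g + h) =
    (b + d + f + h) + (a + c + e + g) by intros; ring]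
  simp only [← Finset.sum_add_distrib, Pi.add_apply]
  congr 1 <;> refine Finset.sum_congr rfl fun i _ => ?_
  · linear_combination (2 * w i + u i + v i) * θ.1 i * CharTwo.two_eq_zero (R := ZMod 2)
  · ring_nf
    reduce_mod_char

theorem sum_param_sgnR {n : ℕ} (w u v t : QState n) :
    ∑ θ : Param n, sgnR (deg2 θ w) * sgnR (deg2 θ (w + u)) * sgnR (deg2 θ (w + v)) *
        sgnR (deg2 θ (w + u + v + t)) =
      if t = 0 then (if u = 0 ∨ v = 0 ∨ u = v then (Fintype.card (Param n) : ℝ) else 0) else 0 := by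
  simp_rw [← sgnR_add, deg2_four_sum, sgnR_add]
  rw [Fintype.sum_prod_type]
  simp only
  rw [← Finset.sum_mul_sum, sum_sgnR_linear, sum_sgnR_linear]
  split_ifs with ht hc h h
  · rw [Fintype.card_prod, Nat.cast_mul]
  · exact absurd ((minors_eq_zero_iff u v).mp fun p => by simpa [ht] using congrFun hc p) h
  · refine absurd (funext fun p => ?_) hc
    simpa [ht] using (minors_eq_zero_iff u v).mpr h p
  all_goals simp

theorem sum_dependent_pairs {n : ℕ} (C : ℝ) :
    ∑ u : QState n, ∑ v : QState n, (if u = 0 ∨ v = 0 ∨ u = v then C else 0) =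
      (3 * 2 ^ n - 2) * C := by
  have h : ∀ u v : QState n, (if u = 0 ∨ v = 0 ∨ u = v then C else 0) =
      (if u = 0 then C else 0) + (if v = 0 then C else 0) + (if u = v then C else 0) -
        (if u = 0 then (if v = 0 then 2 * C else 0) else 0) := by
    intro u v
    by_cases hu : u = 0
    · by_cases hv : v = 0
      · simp [hu, hv]; ring
      · simp [hu, hv, Ne.symm hv]
    · by_cases hv : v = 0
      · simp [hu, hv]
      · simp [hu, hv]
  simp only [h, Finset.sum_sub_distrib, Finset.sum_add_distrib]
  simp [ZMod.card, Finset.sum_ite_irrel]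
  ring

/-- The fourth moment of the Walsh sum of a random degree-2 polynomial. -/
theorem sum_walsh_pow_four (n : ℕ) :
    ∑ θ : Param n, (∑ z, sgnR (deg2 θ z)) ^ 4 =
      2 ^ n * ((3 * 2 ^ n - 2) * (Fintype.card (Param n) : ℝ)) := by
  simp_rw [sum_pow_four_eq]
  rw [Finset.sum_comm]
  simp_rw [Finset.sum_comm (s := (Finset.univ : Finset (Param n))), sum_param_sgnR,
    Finset.sum_ite_eq', Finset.mem_univ, if_true, sum_dependent_pairs]
  simp [ZMod.card]

/-- The average collision probability of uniformly random degree-2 IQP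
circuits equals `3·2^{−n} − 2^{1−2n}`; equivalently, the ideal linear XEB score
`χ̄ = 2ⁿ Σ_x E_f[p_f(x)²] − 1` equals `2 − 2^{1−n}`. -/
theorem collision_probability {n : ℕ} (hn : 1 ≤ n) :
    ((∑ x : QState n, (∑ θ : Param n, (pOut (deg2 θ) x) ^ 2) / (Fintype.card (Param n))) =
      3 * ((2 : ℝ) ^ n)⁻¹ - 2 * ((2 : ℝ) ^ (2 * n))⁻¹) ∧
    ((2 : ℝ) ^ n *
        (∑ x : QState n, (∑ θ : Param n, (pOut (deg2 θ) x) ^ 2) / (Fintype.card (Param n))) - 1 =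
      2 - 2 * ((2 : ℝ) ^ n)⁻¹) := by
  have hcard : (Fintype.card (Param n) : ℝ) ≠ 0 := Nat.cast_ne_zero.mpr Fintype.card_ne_zero
  have hmain :
      (∑ x : QState n, (∑ θ : Param n, (pOut (deg2 θ) x) ^ 2) / (Fintype.card (Param n))) =
        3 * ((2 : ℝ) ^ n)⁻¹ - 2 * ((2 : ℝ) ^ (2 * n))⁻¹ := by
    simp_rw [sum_pOut_sq_eq, sum_walsh_pow_four]
    rw [Finset.sum_const, Finset.card_univ, Fintype.card_fun, ZMod.card, Fintype.card_fin,
      nsmul_eq_mul, pow_mul']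
    push_cast
    field_simp
  refine ⟨hmain, ?_⟩
  rw [hmain, pow_mul']
  field_simp
  ring

end Stmt2
end

section
/- For the sparse degree-2 IQP ensemble with ℓ gates on n ≥ 2 qubits, the ideal XEB score obeys the exact formula χ̄(ℓ) + 1 = 2^(−n) · Σ_{(k,l,m): k,l,m ≥ 0, k+l+m ≤ n} [ n! / ( k!·l!·m!·(n−k−l−m)! ) ] · ( 1 − (k·l + k·m + l·m) / C(n,2) )^ℓ, where C(n,2) = n(n−1)/2. -/
open scoped BigOperators

namespace Stmt3

/-- Computational basis labels for `n` qubits: `𝔽₂ⁿ`. -/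
abbrev QState (n : ℕ) := Fin n → ZMod 2

/-- Unordered pairs of qubits, represented by `i < j`. -/
abbrev PairIdx (n : ℕ) := {p : Fin n × Fin n // p.1 < p.2}

/-- `(-1)^a` as a real number. -/
def sgnR (a : ZMod 2) : ℝ := (-1 : ℝ) ^ a.val

/-- Parameters of the sparse degree-2 IQP ensemble: `ℓ` uniformly random pairs,
`ℓ` uniform bits, and a uniform linear part `a ∈ 𝔽₂ⁿ`. -/
abbrev SparseParam (n ℓ : ℕ) := (Fin ℓ → PairIdx n) × (Fin ℓ → ZMod 2) × QState n

/-- The phase polynomial `f(z) = Σ_k w_k z_{i_k} z_{j_k} + a·z` of a sparse instance. -/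
def sparseF {n ℓ : ℕ} (θ : SparseParam n ℓ) (z : QState n) : ZMod 2 :=
  (∑ k : Fin ℓ, θ.2.1 k * z (θ.1 k).1.1 * z (θ.1 k).1.2) + ∑ i, θ.2.2 i * z i

/-- The X-basis output probability `p_f(x) = (2^{−n} Σ_z (−1)^{f(z)+x·z})²`. -/
noncomputable def pOut {n : ℕ} (f : QState n → ZMod 2) (x : QState n) : ℝ :=
  (((2 : ℝ) ^ n)⁻¹ * ∑ z : QState n, sgnR (f z + ∑ i, x i * z i)) ^ 2

/-- The ideal XEB score `χ̄(ℓ) = 2ⁿ Σ_x E[p_f(x)²] − 1` of the sparse ensemble. -/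
noncomputable def xeb (n ℓ : ℕ) : ℝ :=
  (2 : ℝ) ^ n *
    (∑ x : QState n, (∑ θ : SparseParam n ℓ, (pOut (sparseF θ) x) ^ 2) /
      (Fintype.card (SparseParam n ℓ))) - 1

theorem sgnR_zero : sgnR 0 = 1 := by simp [sgnR]

theorem sgnR_one : sgnR 1 = -1 := by simp [sgnR, ZMod.val_one]

theorem eq_zero_or_one (a : ZMod 2) : a = 0 ∨ a = 1 := by
  revert a
  decide

theorem sgnR_add (a b : ZMod 2) : sgnR (a + b) = sgnR a * sgnR b := by
  rcases eq_zero_or_one a with rfl | rfl <;> rcases eq_zero_or_one b with rfl | rfl <;>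
    simp [sgnR_zero, sgnR_one, CharTwo.add_self_eq_zero]

theorem sgnR_sum {ι : Type*} (s : Finset ι) (f : ι → ZMod 2) :
    sgnR (∑ i ∈ s, f i) = ∏ i ∈ s, sgnR (f i) := by
  classical
  induction s using Finset.induction_on with
  | empty => simp [sgnR_zero]
  | insert i s hi ih => rw [Finset.sum_insert hi, Finset.prod_insert hi, sgnR_add, ih]

theorem sum_sgnR_mul (y : ZMod 2) : ∑ b, sgnR (b * y) = if y = 0 then 2 else 0 := by
  have h : ∀ g : ZMod 2 → ℝ, ∑ b, g b = g 0 + g 1 := fun g => Fin.sum_univ_two g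
  rw [h]
  rcases eq_zero_or_one y with rfl | rfl <;> norm_num [sgnR_zero, sgnR_one]

theorem sum_sgnR_dot {ι : Type*} [Fintype ι] [DecidableEq ι] (y : ι → ZMod 2) :
    ∑ a : ι → ZMod 2, sgnR (∑ i, a i * y i) = ∏ i, if y i = 0 then (2 : ℝ) else 0 := by
  simp_rw [sgnR_sum, ← sum_sgnR_mul]
  rw [Finset.prod_univ_sum, Fintype.piFinset_univ]

theorem sum_sgnR_dot_eq_ite {n : ℕ} (y : QState n) :
    ∑ a : QState n, sgnR (∑ i, a i * y i) = if y = 0 then (2 : ℝ) ^ n else 0 := by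
  rw [sum_sgnR_dot]
  split_ifs with h
  · simp [h]
  · obtain ⟨i, hi⟩ := Function.ne_iff.mp h
    exact Finset.prod_eq_zero (Finset.mem_univ i) (if_neg hi)

/-- Reindexing the fourth power of a sum over a group by parallelograms with a defect `t`. -/
theorem sum_pow_four {G : Type*} [AddCommGroup G] [Fintype G] (g : G → ℝ) :
    (∑ z, g z) ^ 4 =
      ∑ z, ∑ u, ∑ v, ∑ t, g z * g (z + u) * g (z + v) * g (z + u + v + t) := by
  have shift : ∀ y, ∑ t, g (y + t) = ∑ t, g t := fun y =>
    Fintype.sum_equiv (Equiv.addLeft y) _ _ fun _ => rfl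
  simp_rw [← Finset.mul_sum, shift, ← Finset.sum_mul, ← Finset.mul_sum, shift, ← Finset.sum_mul,
    ← Finset.mul_sum, shift, ← Finset.sum_mul]
  ring

/-- Averaging the fourth moment over the linear part leaves the second derivatives of `q`. -/
theorem sum_linear_fourth_moment {n : ℕ} (q : QState n → ZMod 2) (x : QState n) :
    ∑ a : QState n, (∑ z, sgnR (q z + ∑ i, a i * z i + ∑ i, x i * z i)) ^ 4 =
      2 ^ n * ∑ z, ∑ u, ∑ v, sgnR (q z + q (z + u) + q (z + v) + q (z + u + v)) := by
  have key : ∀ a z u v t : QState n,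
      sgnR (q z + ∑ i, a i * z i + ∑ i, x i * z i) *
        sgnR (q (z + u) + ∑ i, a i * (z + u) i + ∑ i, x i * (z + u) i) *
        sgnR (q (z + v) + ∑ i, a i * (z + v) i + ∑ i, x i * (z + v) i) *
        sgnR (q (z + u + v + t) + ∑ i, a i * (z + u + v + t) i + ∑ i, x i * (z + u + v + t) i) =
      sgnR (q z + q (z + u) + q (z + v) + q (z + u + v + t) + ∑ i, x i * t i) *
        sgnR (∑ i, a i * t i) := by
    intro a z u v t
    simp_rw [← sgnR_add]
    congr 1
    simp only [Pi.add_apply, mul_add, Finset.sum_add_distrib]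
    have h2 : (2 : ZMod 2) = 0 := rfl
    linear_combination (2 * ∑ i, a i * z i + 2 * ∑ i, x i * z i + ∑ i, a i * u i +
      ∑ i, x i * u i + ∑ i, a i * v i + ∑ i, x i * v i) * h2
  simp_rw [sum_pow_four, key]
  rw [Finset.sum_comm, Finset.mul_sum]
  refine Finset.sum_congr rfl fun z _ => ?_
  rw [Finset.sum_comm, Finset.mul_sum]
  refine Finset.sum_congr rfl fun u _ => ?_
  rw [Finset.sum_comm, Finset.mul_sum]
  refine Finset.sum_congr rfl fun v _ => ?_
  rw [Finset.sum_comm]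
  simp_rw [← Finset.mul_sum, sum_sgnR_dot_eq_ite]
  simp [mul_comm]

/-- The alternating form evaluated on the columns `(u i, v i)` and `(u j, v j)`. -/
def crossTerm {n : ℕ} (u v : QState n) (i j : Fin n) : ZMod 2 := u i * v j + v i * u j

theorem quadratic_second_derivative {n ℓ : ℕ} (p : Fin ℓ → PairIdx n) (w : Fin ℓ → ZMod 2)
    (z u v : QState n) :
    (∑ k, w k * z (p k).1.1 * z (p k).1.2) +
        (∑ k, w k * (z + u) (p k).1.1 * (z + u) (p k).1.2) +
        (∑ k, w k * (z + v) (p k).1.1 * (z + v) (p k).1.2) +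
        (∑ k, w k * (z + u + v) (p k).1.1 * (z + u + v) (p k).1.2) =
      ∑ k, w k * crossTerm u v (p k).1.1 (p k).1.2 := by
  simp_rw [← Finset.sum_add_distrib]
  refine Finset.sum_congr rfl fun k _ => ?_
  simp only [Pi.add_apply, crossTerm]
  generalize z (p k).1.1 = a, z (p k).1.2 = b, u (p k).1.1 = c, u (p k).1.2 = d,
    v (p k).1.1 = e, v (p k).1.2 = f, w k = g
  have h2 : (2 : ZMod 2) = 0 := rfl
  linear_combination g * (2 * a * b + a * d + c * b + c * d + a * f + e * b + e * f) * h2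

theorem sum_pOut_sq {n ℓ : ℕ} (x : QState n) :
    ∑ θ : SparseParam n ℓ, (pOut (sparseF θ) x) ^ 2 =
      (((2 : ℝ) ^ n)⁻¹) ^ 4 * (2 ^ n * 2 ^ n * 2 ^ ℓ) *
        ∑ u : QState n, ∑ v : QState n,
          (∑ p : PairIdx n, if crossTerm u v p.1.1 p.1.2 = 0 then (1 : ℝ) else 0) ^ ℓ := by
  have bits : ∀ (p : Fin ℓ → PairIdx n) (u v : QState n),
      ∑ w : Fin ℓ → ZMod 2, sgnR (∑ k, w k * crossTerm u v (p k).1.1 (p k).1.2) =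
        2 ^ ℓ * ∏ k, if crossTerm u v (p k).1.1 (p k).1.2 = 0 then (1 : ℝ) else 0 := by
    intro p u v
    rw [sum_sgnR_dot]
    have : (2 : ℝ) ^ ℓ = ∏ _k : Fin ℓ, (2 : ℝ) := by simp
    rw [this, ← Finset.prod_mul_distrib]
    simp
  have expand : ∀ (p : Fin ℓ → PairIdx n) (w : Fin ℓ → ZMod 2),
      ∑ a : QState n, (pOut (sparseF (p, w, a)) x) ^ 2 =
        (((2 : ℝ) ^ n)⁻¹) ^ 4 * (2 ^ n * 2 ^ n) *
          ∑ u, ∑ v, sgnR (∑ k, w k * crossTerm u v (p k).1.1 (p k).1.2) := by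
    intro p w
    have := sum_linear_fourth_moment (fun z => ∑ k, w k * z (p k).1.1 * z (p k).1.2) x
    simp_rw [quadratic_second_derivative] at this
    simp_rw [pOut, sparseF, ← pow_mul, mul_pow, ← Finset.mul_sum]
    rw [this]
    simp
    ring
  have swap : ∑ p : Fin ℓ → PairIdx n, ∑ w : Fin ℓ → ZMod 2, ∑ u : QState n, ∑ v : QState n,
      sgnR (∑ k, w k * crossTerm u v (p k).1.1 (p k).1.2) =
        2 ^ ℓ * ∑ u : QState n, ∑ v : QState n,
          (∑ p : PairIdx n, if crossTerm u v p.1.1 p.1.2 = 0 then (1 : ℝ) else 0) ^ ℓ := by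
    simp_rw [Fintype.sum_pow, Finset.mul_sum, ← bits]
    rw [Finset.sum_congr rfl fun p _ => Finset.sum_comm, Finset.sum_comm]
    refine Finset.sum_congr rfl fun u _ => ?_
    rw [Finset.sum_congr rfl fun p _ => Finset.sum_comm, Finset.sum_comm]
  simp_rw [Fintype.sum_prod_type, expand, ← Finset.mul_sum]
  rw [swap]
  ring

/-- The number of indices `i` whose column `(u i, v i)` equals `c`. -/
def columnCount {n : ℕ} (u v : QState n) (c : ZMod 2 × ZMod 2) : ℕ :=
  (Finset.univ.filter fun i => (u i, v i) = c).card

theorem sum_pairIdx {n : ℕ} (G : Fin n → Fin n → ℝ) (symm : ∀ i j, G i j = G j i) :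
    2 * ∑ p : PairIdx n, G p.1.1 p.1.2 = ∑ i, ∑ j, G i j - ∑ i, G i i := by
  have h1 : ∑ p : PairIdx n, G p.1.1 p.1.2 = ∑ i, ∑ j, if i < j then G i j else 0 := by
    rw [← Fintype.sum_prod_type' (f := fun i j => if i < j then G i j else 0),
      ← Finset.sum_filter]
    exact (Finset.sum_subtype _ (by simp) fun p : Fin n × Fin n => G p.1 p.2).symm
  have h2 : ∑ p : PairIdx n, G p.1.1 p.1.2 = ∑ i, ∑ j, if j < i then G i j else 0 := by
    rw [h1, Finset.sum_comm]
    simp_rw [symm]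
  have h3 : ∑ i, G i i = ∑ i, ∑ j, if i = j then G i j else 0 := by simp
  rw [two_mul]
  nth_rewrite 1 [h1]
  rw [h2, h3, eq_sub_iff_add_eq]
  simp_rw [← Finset.sum_add_distrib]
  refine Finset.sum_congr rfl fun i _ => Finset.sum_congr rfl fun j _ => ?_
  rcases lt_trichotomy i j with h | h | h
  · simp [h, h.ne, h.not_gt]
  · simp [h]
  · simp [h, h.ne', h.not_gt]

theorem card_pairIdx (n : ℕ) : (Fintype.card (PairIdx n) : ℝ) = (n : ℝ) * ((n : ℝ) - 1) / 2 := by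
  have h := sum_pairIdx (n := n) (fun _ _ => 1) fun _ _ => rfl
  simp only [Finset.sum_const, Finset.card_univ, Fintype.card_fin, nsmul_eq_mul, mul_one] at h
  linarith

theorem sum_crossTerm_eq_zero {n : ℕ} (u v : QState n) :
    (∑ p : PairIdx n, if crossTerm u v p.1.1 p.1.2 = 0 then (1 : ℝ) else 0) =
      (n : ℝ) * ((n : ℝ) - 1) / 2 -
        ((columnCount u v (1, 0) * columnCount u v (0, 1) +
          columnCount u v (1, 0) * columnCount u v (1, 1) +
          columnCount u v (0, 1) * columnCount u v (1, 1) : ℕ) : ℝ) := by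
  let e (c : ZMod 2 × ZMod 2) (i : Fin n) : ℝ := if (u i, v i) = c then 1 else 0
  have he : ∀ c, (columnCount u v c : ℝ) = ∑ i, e c i := by
    intro c
    simp [columnCount, e]
  have hG : ∀ i j, (if crossTerm u v i j = 0 then (1 : ℝ) else 0) =
      1 - (e (1, 0) i * e (0, 1) j + e (0, 1) i * e (1, 0) j + (e (1, 0) i * e (1, 1) j +
        e (1, 1) i * e (1, 0) j) + (e (0, 1) i * e (1, 1) j + e (1, 1) i * e (0, 1) j)) := by
    intro i j
    simp only [e]
    rcases eq_zero_or_one (u i) with a | a <;> rcases eq_zero_or_one (u j) with b | b <;>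
      rcases eq_zero_or_one (v i) with c | c <;> rcases eq_zero_or_one (v j) with d | d <;>
        simp [crossTerm, a, b, c, d, CharTwo.add_self_eq_zero]
  have h := sum_pairIdx (fun i j => if crossTerm u v i j = 0 then (1 : ℝ) else 0) (by
    intro i j
    have : crossTerm u v i j = crossTerm u v j i := by
      simp only [crossTerm]
      ring
    simp_rw [this])
  have hd : ∑ i, (if crossTerm u v i i = 0 then (1 : ℝ) else 0) = n := by
    have : ∀ i, crossTerm u v i i = 0 := fun i => by
      simp only [crossTerm]
      rw [mul_comm (v i)]
      exact CharTwo.add_self_eq_zero _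
    simp [this]
  rw [hd] at h
  have hsum : ∑ i, ∑ j, (if crossTerm u v i j = 0 then (1 : ℝ) else 0) = (n : ℝ) * n -
      2 * (columnCount u v (1, 0) * columnCount u v (0, 1) +
        columnCount u v (1, 0) * columnCount u v (1, 1) +
        columnCount u v (0, 1) * columnCount u v (1, 1)) := by
    simp_rw [hG, Finset.sum_sub_distrib, Finset.sum_add_distrib, ← Finset.mul_sum,
      ← Finset.sum_mul, ← he]
    simp only [Finset.sum_const, Finset.card_univ, Fintype.card_fin, nsmul_eq_mul, mul_one]
    ring
  rw [hsum] at h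
  push_cast
  linarith

theorem sum_columns_eq_sum_disjoint {n : ℕ} (F : ℕ → ℕ → ℕ → ℝ) :
    ∑ u : QState n, ∑ v : QState n,
        F (columnCount u v (1, 0)) (columnCount u v (0, 1)) (columnCount u v (1, 1)) =
      ∑ A ∈ (Finset.univ : Finset (Fin n)).powerset, ∑ B ∈ (Finset.univ \ A).powerset,
        ∑ C ∈ ((Finset.univ \ A) \ B).powerset, F A.card B.card C.card := by
  rw [← Fintype.sum_prod_type']
  simp_rw [Finset.sum_sigma']
  refine Finset.sum_bij'
    (fun c _ => ⟨Finset.univ.filter fun i => (c.1 i, c.2 i) = (1, 0),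
      Finset.univ.filter fun i => (c.1 i, c.2 i) = (0, 1),
      Finset.univ.filter fun i => (c.1 i, c.2 i) = (1, 1)⟩)
    (fun S _ => (fun i => if i ∈ S.1 ∨ i ∈ S.2.2 then 1 else 0,
      fun i => if i ∈ S.2.1 ∨ i ∈ S.2.2 then 1 else 0)) ?_ ?_ ?_ ?_ ?_
  · rintro ⟨u, v⟩ _
    simp only [Finset.mem_sigma, Finset.mem_powerset, Finset.subset_iff, Finset.mem_sdiff,
      Finset.mem_filter, Finset.mem_univ, true_and, Prod.mk.injEq]
    grind
  · intros; simp
  · rintro ⟨u, v⟩ _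
    ext i
    all_goals
      rcases eq_zero_or_one (u i) with hu | hu <;>
        rcases eq_zero_or_one (v i) with hv | hv <;> simp [hu, hv]
  · rintro ⟨A, B, C⟩ hS
    simp only [Finset.mem_sigma, Finset.mem_powerset, Finset.subset_iff, Finset.mem_sdiff,
      Finset.mem_univ, true_and] at hS
    congr 1
    · ext i; simp; grind
    · congr 1
      · ext i; simp; grind
      · ext i; simp; grind
  · intros; rfl

theorem choose_mul_choose_mul_choose {n k l m : ℕ} (h : k + l + m ≤ n) :
    ((n.choose k : ℝ) * ((n - k).choose l * (n - k - l).choose m)) =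
      (n.factorial : ℝ) / ((k.factorial : ℝ) * (l.factorial : ℝ) * (m.factorial : ℝ) *
        ((n - k - l - m).factorial : ℝ)) := by
  rw [Nat.cast_choose ℝ (by omega : k ≤ n), Nat.cast_choose ℝ (by omega : l ≤ n - k),
    Nat.cast_choose ℝ (by omega : m ≤ n - k - l)]
  field_simp

theorem sum_range_choose_extend {N n : ℕ} (h : N ≤ n) (f : ℕ → ℝ) :
    ∑ k ∈ Finset.range (N + 1), (N.choose k : ℝ) * f k =
      ∑ k ∈ Finset.range (n + 1), (N.choose k : ℝ) * f k := by
  refine Finset.sum_subset (Finset.range_mono (by omega)) fun k _ hk => ?_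
  rw [Nat.choose_eq_zero_of_lt (by simpa using hk)]
  simp

theorem sum_columns_eq_multinomial {n : ℕ} (F : ℕ → ℕ → ℕ → ℝ) :
    ∑ u : QState n, ∑ v : QState n,
        F (columnCount u v (1, 0)) (columnCount u v (0, 1)) (columnCount u v (1, 1)) =
      ∑ k ∈ Finset.range (n + 1), ∑ l ∈ Finset.range (n + 1), ∑ m ∈ Finset.range (n + 1),
        if k + l + m ≤ n then
          (n.factorial : ℝ) / ((k.factorial : ℝ) * (l.factorial : ℝ) * (m.factorial : ℝ) *
            ((n - k - l - m).factorial : ℝ)) * F k l m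
        else 0 := by
  have powersum : ∀ (s : Finset (Fin n)) (N : ℕ), s.card = N → ∀ f : ℕ → ℝ,
      ∑ A ∈ s.powerset, f A.card = ∑ k ∈ Finset.range (n + 1), (N.choose k : ℝ) * f k := by
    rintro s N rfl f
    rw [Finset.sum_powerset_apply_card, ← sum_range_choose_extend (by simpa using s.card_le_univ)]
    simp
  have inner : ∀ A : Finset (Fin n),
      ∑ B ∈ (Finset.univ \ A).powerset, ∑ C ∈ ((Finset.univ \ A) \ B).powerset,
          F A.card B.card C.card =
        ∑ l ∈ Finset.range (n + 1), ((n - A.card).choose l : ℝ) *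
          ∑ m ∈ Finset.range (n + 1), ((n - A.card - l).choose m : ℝ) * F A.card l m := by
    intro A
    have hA : (Finset.univ \ A).card = n - A.card := by
      simp [Finset.card_sdiff_of_subset (Finset.subset_univ A)]
    rw [← powersum _ _ hA fun l => ∑ m ∈ Finset.range (n + 1),
      ((n - A.card - l).choose m : ℝ) * F A.card l m]
    refine Finset.sum_congr rfl fun B hB => powersum _ _ ?_ fun m => F A.card B.card m
    rw [Finset.card_sdiff_of_subset (Finset.mem_powerset.mp hB), hA]
  rw [sum_columns_eq_sum_disjoint, Finset.sum_congr rfl fun A _ => inner A,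
    powersum _ n (by simp) fun k => ∑ l ∈ Finset.range (n + 1), ((n - k).choose l : ℝ) *
      ∑ m ∈ Finset.range (n + 1), ((n - k - l).choose m : ℝ) * F k l m]
  simp_rw [Finset.mul_sum]
  refine Finset.sum_congr rfl fun k hk => Finset.sum_congr rfl fun l _ =>
    Finset.sum_congr rfl fun m _ => ?_
  split_ifs with h
  · rw [← choose_mul_choose_mul_choose h]
    ring
  · rw [Finset.mem_range] at hk
    by_cases hl : n - k < l
    · simp [Nat.choose_eq_zero_of_lt hl]
    · simp [Nat.choose_eq_zero_of_lt (by omega : n - k - l < m)]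

/-- Exact formula for the ideal XEB score of sparse degree-2 IQP circuits:
`χ̄(ℓ) + 1 = 2^{−n} Σ_{k+l+m ≤ n} n!/(k! l! m! (n−k−l−m)!) · (1 − (kl+km+lm)/C(n,2))^ℓ`. -/
theorem sparse_xeb_formula {n : ℕ} (hn : 2 ≤ n) (ℓ : ℕ) :
    xeb n ℓ + 1 =
      ((2 : ℝ) ^ n)⁻¹ *
        ∑ k ∈ Finset.range (n + 1), ∑ l ∈ Finset.range (n + 1), ∑ m ∈ Finset.range (n + 1),
          if k + l + m ≤ n then
            (n.factorial : ℝ) /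
                ((k.factorial : ℝ) * (l.factorial : ℝ) * (m.factorial : ℝ) *
                  ((n - k - l - m).factorial : ℝ)) *
              (1 - ((k * l + k * m + l * m : ℕ) : ℝ) / ((n : ℝ) * ((n : ℝ) - 1) / 2)) ^ ℓ
          else 0 := by
  have hN : (n : ℝ) * ((n : ℝ) - 1) / 2 ≠ 0 := by
    have : (2 : ℝ) ≤ n := by exact_mod_cast hn
    have : 0 < (n : ℝ) * ((n : ℝ) - 1) / 2 := by
      apply div_pos (mul_pos _ _) <;> linarith
    exact this.ne'
  have hcard : (Fintype.card (SparseParam n ℓ) : ℝ) =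
      ((n : ℝ) * ((n : ℝ) - 1) / 2) ^ ℓ * (2 ^ ℓ * 2 ^ n) := by
    rw [← card_pairIdx]
    simp [Fintype.card_prod, ZMod.card]
  rw [← sum_columns_eq_multinomial fun k l m =>
    (1 - ((k * l + k * m + l * m : ℕ) : ℝ) / ((n : ℝ) * ((n : ℝ) - 1) / 2)) ^ ℓ]
  simp_rw [xeb, sum_pOut_sq, sum_crossTerm_eq_zero, hcard, one_sub_div hN, div_pow,
    ← Finset.sum_div]
  simp only [Finset.sum_const, Finset.card_univ, Fintype.card_pi, ZMod.card, Finset.prod_const,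
    Fintype.card_fin, nsmul_eq_mul, sub_add_cancel, Nat.cast_pow, Nat.cast_ofNat]
  generalize (∑ u : QState n, ∑ v : QState n, _ : ℝ) = S
  generalize (n : ℝ) * ((n : ℝ) - 1) / 2 = N at hN
  field_simp

end Stmt3
end

section
/- (Anticoncentration of sparse IQP circuits.) There is a constant C > 0 such that for every n ≥ 2 and every ℓ ≥ (11/4)·n·log₂ n, the ideal XEB score of the sparse degree-2 IQP ensemble satisfies 0 ≤ χ̄(ℓ) − ( 2 − 2^(1−n) ) ≤ C/n. In particular, sparse degree-2 IQP circuits with (11/4)·n·log₂ n gates anticoncentrate: χ̄(ℓ) = 2 − 2^(1−n) + 2^(−Ω(log n)). -/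
open scoped BigOperators

namespace Stmt4

/-- Computational basis labels for `n` qubits: `𝔽₂ⁿ`. -/
abbrev QState (n : ℕ) := Fin n → ZMod 2

/-- Unordered pairs of qubits, represented by `i < j`. -/
abbrev PairIdx (n : ℕ) := {p : Fin n × Fin n // p.1 < p.2}

/-- `(-1)^a` as a real number. -/
def sgnR (a : ZMod 2) : ℝ := (-1 : ℝ) ^ a.val

/-- Parameters of the sparse degree-2 IQP ensemble: `ℓ` uniformly random pairs,
`ℓ` uniform bits, and a uniform linear part `a ∈ 𝔽₂ⁿ`. -/
abbrev SparseParam (n ℓ : ℕ) := (Fin ℓ → PairIdx n) × (Fin ℓ → ZMod 2) × QState n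

/-- The phase polynomial `f(z) = Σ_k w_k z_{i_k} z_{j_k} + a·z` of a sparse instance. -/
def sparseF {n ℓ : ℕ} (θ : SparseParam n ℓ) (z : QState n) : ZMod 2 :=
  (∑ k : Fin ℓ, θ.2.1 k * z (θ.1 k).1.1 * z (θ.1 k).1.2) + ∑ i, θ.2.2 i * z i

/-- The X-basis output probability `p_f(x) = (2^{−n} Σ_z (−1)^{f(z)+x·z})²`. -/
noncomputable def pOut {n : ℕ} (f : QState n → ZMod 2) (x : QState n) : ℝ :=
  (((2 : ℝ) ^ n)⁻¹ * ∑ z : QState n, sgnR (f z + ∑ i, x i * z i)) ^ 2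

/-- The ideal XEB score `χ̄(ℓ) = 2ⁿ Σ_x E[p_f(x)²] − 1` of the sparse ensemble. -/
noncomputable def xeb (n ℓ : ℕ) : ℝ :=
  (2 : ℝ) ^ n *
    (∑ x : QState n, (∑ θ : SparseParam n ℓ, (pOut (sparseF θ) x) ^ 2) /
      (Fintype.card (SparseParam n ℓ))) - 1

lemma sgnR_zero : sgnR 0 = 1 := by simp [sgnR]

lemma sgnR_one : sgnR 1 = -1 := by simp [sgnR, ZMod.val_one]

lemma zmod_two_cases : ∀ a : ZMod 2, a = 0 ∨ a = 1 := by decide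

lemma sgnR_add (a b : ZMod 2) : sgnR (a + b) = sgnR a * sgnR b := by
  have h2 : (1 + 1 : ZMod 2) = 0 := rfl
  rcases zmod_two_cases a with rfl | rfl <;> rcases zmod_two_cases b with rfl | rfl <;>
    simp [sgnR_zero, sgnR_one, h2]

lemma sgnR_sum {ι : Type*} (s : Finset ι) (f : ι → ZMod 2) :
    sgnR (∑ i ∈ s, f i) = ∏ i ∈ s, sgnR (f i) := by
  classical
  induction s using Finset.induction_on with
  | empty => simp [sgnR_zero]
  | insert a s ha ih => rw [Finset.sum_insert ha, Finset.prod_insert ha, sgnR_add, ih]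

lemma sum_sgnR_mul (c : ZMod 2) : ∑ b : ZMod 2, sgnR (b * c) = if c = 0 then 2 else 0 := by
  have h : ∀ f : ZMod 2 → ℝ, ∑ b : ZMod 2, f b = f 0 + f 1 := fun f => Fin.sum_univ_two f
  rw [h]
  rcases zmod_two_cases c with rfl | rfl
  · norm_num [sgnR_zero]
  · norm_num [sgnR_zero, sgnR_one]

lemma sum_sgnR_dot {n : ℕ} (z : QState n) :
    ∑ a : QState n, sgnR (∑ i, a i * z i) = if z = 0 then (2 : ℝ) ^ n else 0 := by
  simp_rw [sgnR_sum]
  have h := Finset.prod_univ_sum (fun _ : Fin n => (Finset.univ : Finset (ZMod 2)))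
    (fun i b => sgnR (b * z i))
  rw [Fintype.piFinset_univ] at h
  rw [← h]
  simp_rw [sum_sgnR_mul]
  split_ifs with hz
  · simp [hz]
  · obtain ⟨i, hi⟩ := Function.ne_iff.mp hz
    exact Finset.prod_eq_zero (Finset.mem_univ i) (by simpa using hi)

/-- The Walsh–Hadamard transform on `𝔽₂ⁿ`. -/
noncomputable def walsh {n : ℕ} (A : QState n → ℝ) (a : QState n) : ℝ :=
  ∑ z, A z * sgnR (∑ i, a i * z i)

lemma state_add_self {n : ℕ} (u : QState n) : u + u = 0 :=
  funext fun i => CharTwo.add_self_eq_zero (u i)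

lemma state_add_eq_zero_iff {n : ℕ} (u v : QState n) : u + v = 0 ↔ v = u := by
  rw [add_eq_zero_iff_eq_neg', neg_eq_of_add_eq_zero_left (state_add_self u)]

lemma walsh_mul_walsh {n : ℕ} (A B : QState n → ℝ) (a : QState n) :
    walsh A a * walsh B a = ∑ u, ∑ v, A u * B v * sgnR (∑ i, a i * (u + v) i) := by
  unfold walsh
  rw [Finset.sum_mul_sum]
  refine Finset.sum_congr rfl fun u _ => Finset.sum_congr rfl fun v _ => ?_
  simp only [Pi.add_apply, mul_add, Finset.sum_add_distrib, sgnR_add]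
  ring

lemma sum_walsh_sq {n : ℕ} (A : QState n → ℝ) :
    ∑ a, walsh A a ^ 2 = 2 ^ n * ∑ u, A u ^ 2 := by
  simp_rw [sq, walsh_mul_walsh]
  rw [Finset.sum_comm, Finset.mul_sum]
  refine Finset.sum_congr rfl fun u _ => ?_
  rw [Finset.sum_comm]
  simp_rw [← Finset.mul_sum, sum_sgnR_dot, state_add_eq_zero_iff]
  simp
  ring

lemma sum_comp_add {n : ℕ} (x : QState n) (F : QState n → ℝ) : ∑ u, F (x + u) = ∑ u, F u :=
  Equiv.sum_comp (Equiv.addLeft x) F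

lemma walsh_sq {n : ℕ} (A : QState n → ℝ) (a : QState n) :
    walsh A a ^ 2 = walsh (fun u => ∑ x, A x * A (x + u)) a := by
  rw [sq, walsh_mul_walsh]
  unfold walsh
  simp_rw [Finset.sum_mul]
  conv_rhs => rw [Finset.sum_comm]
  refine Finset.sum_congr rfl fun x _ => ?_
  rw [← sum_comp_add x]
  simp_rw [← add_assoc, state_add_self, zero_add]

lemma sum_walsh_pow_four {n : ℕ} (A : QState n → ℝ) :
    ∑ a, walsh A a ^ 4 =
      2 ^ n * ∑ u, ∑ v, ∑ x, A x * A (x + u) * (A (x + v) * A (x + v + u)) := by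
  have h : ∀ a, walsh A a ^ 4 = walsh (fun u => ∑ x, A x * A (x + u)) a ^ 2 := fun a => by
    rw [← walsh_sq, ← pow_mul]
  simp_rw [h]
  rw [sum_walsh_sq]
  congr 1
  refine Finset.sum_congr rfl fun u _ => ?_
  rw [sq, Finset.sum_mul_sum]
  conv_rhs => rw [Finset.sum_comm]
  refine Finset.sum_congr rfl fun x _ => ?_
  rw [← sum_comp_add x]

/-- The pairs `i < j` on which the columns `(u_i, v_i)` and `(u_j, v_j)` are dependent. -/
def depPairs {n : ℕ} (u v : QState n) : Finset (PairIdx n) :=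
  {p | u p.1.1 * v p.1.2 + u p.1.2 * v p.1.1 = 0}

/-- The quadratic part of a sparse phase polynomial. -/
def quadPart {n ℓ : ℕ} (p : Fin ℓ → PairIdx n) (w : Fin ℓ → ZMod 2) (z : QState n) : ZMod 2 :=
  ∑ k, w k * z (p k).1.1 * z (p k).1.2

lemma sgnR_quadPart_second_difference {n ℓ : ℕ} (p : Fin ℓ → PairIdx n) (w : Fin ℓ → ZMod 2)
    (u v x : QState n) :
    sgnR (quadPart p w x) * sgnR (quadPart p w (x + u)) *
      (sgnR (quadPart p w (x + v)) * sgnR (quadPart p w (x + v + u))) =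
    ∏ k, sgnR (w k * (u (p k).1.1 * v (p k).1.2 + u (p k).1.2 * v (p k).1.1)) := by
  simp only [← sgnR_add, ← sgnR_sum, quadPart, ← Finset.sum_add_distrib]
  congr 1
  refine Finset.sum_congr rfl fun k _ => ?_
  simp only [Pi.add_apply]
  generalize w k = w
  generalize u (p k).1.1 = a
  generalize u (p k).1.2 = b
  generalize v (p k).1.1 = c
  generalize v (p k).1.2 = d
  generalize x (p k).1.1 = e
  generalize x (p k).1.2 = f
  have h2 : (2 : ZMod 2) = 0 := rfl
  linear_combination (2 * w * e * f + w * a * f + w * e * b + w * e * d + w * c * f + w * a * b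
    + w * c * d) * h2

lemma sum_prod_sgnR {n : ℕ} (ℓ : ℕ) (u v : QState n) :
    ∑ p : Fin ℓ → PairIdx n, ∑ w : Fin ℓ → ZMod 2,
      ∏ k, sgnR (w k * (u (p k).1.1 * v (p k).1.2 + u (p k).1.2 * v (p k).1.1)) =
    (2 * (depPairs u v).card : ℝ) ^ ℓ := by
  have h : ∀ p : Fin ℓ → PairIdx n, ∑ w : Fin ℓ → ZMod 2,
      ∏ k, sgnR (w k * (u (p k).1.1 * v (p k).1.2 + u (p k).1.2 * v (p k).1.1)) =
      ∏ k, if p k ∈ depPairs u v then (2 : ℝ) else 0 := by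
    intro p
    have h := Finset.prod_univ_sum (fun _ : Fin ℓ => (Finset.univ : Finset (ZMod 2)))
      (fun k b => sgnR (b * (u (p k).1.1 * v (p k).1.2 + u (p k).1.2 * v (p k).1.1)))
    rw [Fintype.piFinset_univ] at h
    rw [← h]
    simp_rw [sum_sgnR_mul]
    simp [depPairs]
  simp_rw [h]
  rw [← Fintype.sum_pow (fun q : PairIdx n => if q ∈ depPairs u v then (2 : ℝ) else 0)]
  congr 1
  rw [← Finset.sum_filter]
  simp [mul_comm]

lemma sum_sum_comm_sum_sum {α β γ δ : Type*} [Fintype α] [Fintype β] [Fintype γ] [Fintype δ]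
    (F : α → β → γ → δ → ℝ) :
    ∑ a, ∑ b, ∑ c, ∑ d, F a b c d = ∑ c, ∑ d, ∑ a, ∑ b, F a b c d := by
  have h := Finset.sum_comm (s := (Finset.univ : Finset (α × β)))
    (t := (Finset.univ : Finset (γ × δ))) (f := fun x y => F x.1 x.2 y.1 y.2)
  simpa only [Fintype.sum_prod_type] using h

lemma sum_walsh_quadPart {n : ℕ} (ℓ : ℕ) :
    ∑ p : Fin ℓ → PairIdx n, ∑ w : Fin ℓ → ZMod 2,
      ∑ a, walsh (fun z => sgnR (quadPart p w z)) a ^ 4 =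
    2 ^ n * (2 ^ n * ∑ u : QState n, ∑ v : QState n, (2 * (depPairs u v).card : ℝ) ^ ℓ) := by
  simp_rw [sum_walsh_pow_four, sgnR_quadPart_second_difference, ← Finset.mul_sum]
  simp only [Finset.sum_const, Finset.card_univ, nsmul_eq_mul, ← Finset.mul_sum]
  congr 1
  simp only [Fintype.card_pi, ZMod.card, Finset.prod_const, Finset.card_univ, Fintype.card_fin,
    Nat.cast_pow, Nat.cast_ofNat]
  congr 1
  simp_rw [← sum_prod_sgnR]
  exact sum_sum_comm_sum_sum _

lemma pOut_sparseF {n ℓ : ℕ} (p : Fin ℓ → PairIdx n) (w : Fin ℓ → ZMod 2) (a x : QState n) :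
    pOut (sparseF (p, w, a)) x =
      (((2 : ℝ) ^ n)⁻¹ * walsh (fun z => sgnR (quadPart p w z)) (x + a)) ^ 2 := by
  unfold pOut walsh
  congr 2
  refine Finset.sum_congr rfl fun z _ => ?_
  rw [← sgnR_add]
  congr 1
  simp only [sparseF, quadPart, Pi.add_apply, add_mul, Finset.sum_add_distrib]
  ring

/-- The ideal XEB score as a moment of the fraction of dependent pairs. -/
theorem xeb_eq (n ℓ : ℕ) :
    xeb n ℓ = ((2 : ℝ) ^ n)⁻¹ * (∑ u : QState n, ∑ v : QState n,
      ((depPairs u v).card / Fintype.card (PairIdx n) : ℝ) ^ ℓ) - 1 := by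
  have hx : ∀ x : QState n, ∑ θ : SparseParam n ℓ, (pOut (sparseF θ) x) ^ 2 =
      (((2 : ℝ) ^ n)⁻¹) ^ 4 * (2 ^ n * (2 ^ n *
        ∑ u : QState n, ∑ v : QState n, (2 * (depPairs u v).card : ℝ) ^ ℓ)) := by
    intro x
    rw [← sum_walsh_quadPart, Fintype.sum_prod_type, Finset.mul_sum]
    refine Finset.sum_congr rfl fun p _ => ?_
    rw [Fintype.sum_prod_type, Finset.mul_sum]
    refine Finset.sum_congr rfl fun w _ => ?_
    simp_rw [pOut_sparseF]
    rw [sum_comp_add x (fun a => ((((2 : ℝ) ^ n)⁻¹ *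
      walsh (fun z => sgnR (quadPart p w z)) a) ^ 2) ^ 2), Finset.mul_sum]
    exact Finset.sum_congr rfl fun a _ => by ring
  unfold xeb
  simp_rw [hx]
  have hc : (Fintype.card (SparseParam n ℓ) : ℝ) =
      (Fintype.card (PairIdx n) : ℝ) ^ ℓ * (2 ^ ℓ * 2 ^ n) := by
    simp [Fintype.card_prod]
  rw [hc]
  simp_rw [div_pow, mul_pow, ← Finset.mul_sum, ← Finset.sum_div]
  generalize ∑ u : QState n, ∑ v : QState n, ((depPairs u v).card : ℝ) ^ ℓ = S
  simp only [Finset.sum_const, Finset.card_univ, nsmul_eq_mul, Fintype.card_pi, ZMod.card,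
    Finset.prod_const, Fintype.card_fin, Nat.cast_pow, Nat.cast_ofNat]
  congr 1
  rcases eq_or_ne ((Fintype.card (PairIdx n) : ℝ) ^ ℓ) 0 with h0 | h0
  · simp [h0]
  · field_simp

/-- The number of coordinates `i` with `(u_i, v_i) = c`. -/
def typeCount {n : ℕ} (c : ZMod 2 × ZMod 2) (u v : QState n) : ℕ :=
  (Finset.univ.filter fun i => (u i, v i) = c).card

/-- The number of coordinates `i` with `(u_i, v_i) ∉ {0, c}`. -/
def offCount {n : ℕ} (c : ZMod 2 × ZMod 2) (u v : QState n) : ℕ :=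
  (Finset.univ.filter fun i => (u i, v i) ≠ 0 ∧ (u i, v i) ≠ c).card

lemma two_mul_card_pairIdx_le (n : ℕ) : 2 * Fintype.card (PairIdx n) ≤ n ^ 2 := by
  have h := Fintype.card_le_of_injective
    (Sum.elim (fun p : PairIdx n => (p.1.1, p.1.2)) (fun p : PairIdx n => (p.1.2, p.1.1)))
    (by
      rintro (⟨⟨a, b⟩, h⟩ | ⟨⟨a, b⟩, h⟩) (⟨⟨c, d⟩, h'⟩ | ⟨⟨c, d⟩, h'⟩) he <;>
        simp only [Sum.elim_inl, Sum.elim_inr, Prod.mk.injEq] at he h h' <;>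
        obtain ⟨rfl, rfl⟩ := he
      · rfl
      · exact absurd h (lt_asymm h')
      · exact absurd h (lt_asymm h')
      · rfl)
  simp only [Fintype.card_sum, Fintype.card_prod, Fintype.card_fin] at h
  nlinarith

lemma det_ne_zero_of_types : ∀ a b c d : ZMod 2, (a, b) ≠ 0 → (c, d) ≠ 0 → (c, d) ≠ (a, b) →
    a * d + c * b ≠ 0 := by decide

lemma card_depPairs_add_le {n : ℕ} {c : ZMod 2 × ZMod 2} (hc : c ≠ 0) (u v : QState n) :
    (depPairs u v).card + typeCount c u v * offCount c u v ≤ Fintype.card (PairIdx n) := by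
  rw [← Finset.card_add_card_compl (depPairs u v)]
  refine Nat.add_le_add_left ?_ _
  unfold typeCount offCount
  rw [← Finset.card_product]
  refine Finset.card_le_card_of_surjOn
    (fun p => if (u p.1.1, v p.1.1) = c then (p.1.1, p.1.2) else (p.1.2, p.1.1)) ?_
  rintro ⟨i, j⟩ hij
  simp only [Finset.coe_product, Set.mem_prod, Finset.mem_coe, Finset.mem_filter,
    Finset.mem_univ, true_and] at hij
  obtain ⟨hi, hj0, hj⟩ := hij
  have hd : u i * v j + u j * v i ≠ 0 :=
    det_ne_zero_of_types _ _ _ _ (hi ▸ hc) hj0 (hi ▸ hj)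
  rcases lt_trichotomy i j with h | rfl | h
  · exact ⟨⟨(i, j), h⟩, by simpa [depPairs] using hd, by simp [hi]⟩
  · exact absurd hi hj
  · exact ⟨⟨(j, i), h⟩, by simpa [depPairs, add_comm] using hd, by simp [hj]⟩

lemma depPairs_eq_univ {n : ℕ} {u v : QState n} (h : u = 0 ∨ v = 0 ∨ u = v) :
    depPairs u v = Finset.univ := by
  refine Finset.filter_true_of_mem fun p _ => ?_
  rcases h with rfl | rfl | rfl
  · simp
  · simp
  · rw [mul_comm]
    exact CharTwo.add_self_eq_zero _

lemma offCount_eq_add {n : ℕ} {c d e : ZMod 2 × ZMod 2} (hd : d ≠ e)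
    (h : ∀ x, (x ≠ 0 ∧ x ≠ c) ↔ (x = d ∨ x = e)) (u v : QState n) :
    offCount c u v = typeCount d u v + typeCount e u v := by
  unfold offCount typeCount
  rw [← Finset.card_union_of_disjoint, ← Finset.filter_or]
  · simp_rw [h]
  · rw [Finset.disjoint_filter]
    rintro i _ h1 h2
    exact hd (h1.symm.trans h2)

lemma mem_zero_of_offCount_eq_zero {n : ℕ} {c : ZMod 2 × ZMod 2} {u v : QState n}
    (h : offCount c u v = 0) (i : Fin n) : (u i, v i) = 0 ∨ (u i, v i) = c := by
  rw [offCount, Finset.card_eq_zero, Finset.filter_eq_empty_iff] at h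
  have := h (Finset.mem_univ i)
  tauto

lemma exists_dominant_type {n : ℕ} {u v : QState n} (h : ¬(u = 0 ∨ v = 0 ∨ u = v)) :
    ∃ c : ZMod 2 × ZMod 2, c ≠ 0 ∧ 1 ≤ offCount c u v ∧ offCount c u v ≤ 2 * typeCount c u v := by
  have e1 := offCount_eq_add (c := (0, 1)) (d := (1, 0)) (e := (1, 1)) (by decide) (by decide) u v
  have e2 := offCount_eq_add (c := (1, 0)) (d := (0, 1)) (e := (1, 1)) (by decide) (by decide) u v
  have e3 := offCount_eq_add (c := (1, 1)) (d := (0, 1)) (e := (1, 0)) (by decide) (by decide) u v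
  have p1 : 1 ≤ offCount (0, 1) u v := by
    by_contra! hlt
    refine h (Or.inl (funext fun i => ?_))
    rcases mem_zero_of_offCount_eq_zero (Nat.lt_one_iff.mp hlt) i with hi | hi
    · exact congrArg Prod.fst hi
    · exact congrArg Prod.fst hi
  have p2 : 1 ≤ offCount (1, 0) u v := by
    by_contra! hlt
    refine h (Or.inr (Or.inl (funext fun i => ?_)))
    rcases mem_zero_of_offCount_eq_zero (Nat.lt_one_iff.mp hlt) i with hi | hi
    · exact congrArg Prod.snd hi
    · exact congrArg Prod.snd hi
  have p3 : 1 ≤ offCount (1, 1) u v := by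
    by_contra! hlt
    refine h (Or.inr (Or.inr (funext fun i => ?_)))
    rcases mem_zero_of_offCount_eq_zero (Nat.lt_one_iff.mp hlt) i with hi | hi
    · exact (congrArg Prod.fst hi).trans (congrArg Prod.snd hi).symm
    · exact (congrArg Prod.fst hi).trans (congrArg Prod.snd hi).symm
  by_cases h1 : offCount (0, 1) u v ≤ 2 * typeCount (0, 1) u v
  · exact ⟨(0, 1), by decide, p1, h1⟩
  by_cases h2 : offCount (1, 0) u v ≤ 2 * typeCount (1, 0) u v
  · exact ⟨(1, 0), by decide, p2, h2⟩
  exact ⟨(1, 1), by decide, p3, by omega⟩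

lemma sum_dependent (n : ℕ) :
    ∑ u : QState n, ∑ v : QState n, (if u = 0 ∨ v = 0 ∨ u = v then (1 : ℝ) else 0) =
      3 * 2 ^ n - 2 := by
  have h : ∀ u v : QState n, (if u = 0 ∨ v = 0 ∨ u = v then (1 : ℝ) else 0) =
      (if u = 0 then 1 else 0) + (if v = 0 then 1 else 0) + (if u = v then 1 else 0)
        - 2 * ((if u = 0 then 1 else 0) * (if v = 0 then 1 else 0)) := by
    intro u v
    by_cases hu : u = 0
    · subst hu
      by_cases hv : v = 0
      · subst hv; norm_num
      · simp [hv, Ne.symm hv]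
    · by_cases hv : v = 0
      · subst hv; simp [hu]
      · simp [hu, hv]
  simp_rw [h, Finset.sum_sub_distrib, Finset.sum_add_distrib, ← Finset.mul_sum]
  simp
  ring

lemma sum_pow_typeCount_mul_pow_offCount {n : ℕ} {c : ZMod 2 × ZMod 2} (hc : c ≠ 0) (X Y : ℝ) :
    ∑ u : QState n, ∑ v : QState n, X ^ typeCount c u v * Y ^ offCount c u v =
      (1 + X + 2 * Y) ^ n := by
  let w : ZMod 2 × ZMod 2 → ℝ := fun x =>
    (if x = c then X else 1) * (if x ≠ 0 ∧ x ≠ c then Y else 1)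
  have hw : ∑ x, w x = 1 + X + 2 * Y := by
    have h4 : ∀ f : ZMod 2 × ZMod 2 → ℝ, ∑ x, f x =
        f (0, 0) + f (0, 1) + (f (1, 0) + f (1, 1)) := by
      intro f
      rw [Fintype.sum_prod_type]
      have h2 : ∀ g : ZMod 2 → ℝ, ∑ b : ZMod 2, g b = g 0 + g 1 := fun g => Fin.sum_univ_two g
      simp only [h2]
    have h3 : ∀ x : ZMod 2 × ZMod 2, x ≠ 0 → x = (0, 1) ∨ x = (1, 0) ∨ x = (1, 1) := by decide
    rw [h4]
    rcases h3 c hc with rfl | rfl | rfl <;> simp [w] <;> ring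
  rw [← hw, Fintype.sum_pow]
  rw [← Equiv.sum_comp
    (Equiv.arrowProdEquivProdArrow (Fin n) (fun _ => ZMod 2) (fun _ => ZMod 2)).symm,
    Fintype.sum_prod_type]
  refine Finset.sum_congr rfl fun u _ => Finset.sum_congr rfl fun v _ => ?_
  simp only [w, Finset.prod_mul_distrib, Finset.prod_ite, Finset.prod_const, one_pow, mul_one]
  rfl

/-- The decay rate `n^{-(11/2) k / (n ln 2)}` of a type with `k` off-type coordinates. -/
noncomputable def decay (n k : ℕ) : ℝ := Real.exp (-(11 / 2 * Real.logb 2 n * k / n))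

lemma decay_nonneg (n k : ℕ) : 0 ≤ decay n k := (Real.exp_pos _).le

lemma decay_pow (n k a : ℕ) :
    decay n k ^ a = Real.exp (-(11 / 2 * Real.logb 2 n * k / n * a)) := by
  rw [decay, ← Real.exp_nat_mul]
  congr 1
  ring

lemma depFraction_pow_le {n ℓ : ℕ} (hn : 1 ≤ n) (hℓ : (11 / 4 : ℝ) * n * Real.logb 2 n ≤ ℓ)
    {c : ZMod 2 × ZMod 2} (hc : c ≠ 0) {u v : QState n}
    (hs : 1 ≤ offCount c u v) (hsa : offCount c u v ≤ 2 * typeCount c u v) :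
    ((depPairs u v).card / Fintype.card (PairIdx n) : ℝ) ^ ℓ ≤
      decay n (offCount c u v) ^ typeCount c u v := by
  have h1 := card_depPairs_add_le hc u v
  have h2 := two_mul_card_pairIdx_le n
  rw [decay_pow]
  generalize offCount c u v = s at *
  generalize typeCount c u v = a at *
  generalize (depPairs u v).card = D at *
  generalize Fintype.card (PairIdx n) = N at *
  have ha : 1 ≤ a := by omega
  have hN : 1 ≤ N := le_trans (Nat.mul_pos ha hs) (by omega)
  have hnR : (0 : ℝ) < n := by exact_mod_cast hn
  have hNR : (0 : ℝ) < N := by exact_mod_cast hN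
  have h1R : (D : ℝ) + a * s ≤ N := by exact_mod_cast h1
  have h2R : 2 * (N : ℝ) ≤ n ^ 2 := by exact_mod_cast h2
  have has : (0 : ℝ) ≤ a * s := by positivity
  have hq : (D / N : ℝ) ≤ Real.exp (-(2 * (a * s) / n ^ 2)) := by
    have h3 : (D / N : ℝ) ≤ 1 - a * s / N := by
      rw [div_le_iff₀ hNR, sub_mul, div_mul_cancel₀ _ hNR.ne']
      linarith
    have h4 : 2 * (a * s) / (n : ℝ) ^ 2 ≤ a * s / N := by
      rw [div_le_div_iff₀ (by positivity) hNR]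
      nlinarith
    have h5 := Real.add_one_le_exp (-(2 * (a * s) / (n : ℝ) ^ 2))
    linarith
  calc (D / N : ℝ) ^ ℓ ≤ Real.exp (-(2 * (a * s) / n ^ 2)) ^ ℓ :=
        pow_le_pow_left₀ (by positivity) hq _
    _ = Real.exp (-(2 * (a * s) / n ^ 2 * ℓ)) := by
        rw [← Real.exp_nat_mul]; congr 1; ring
    _ ≤ _ := by
        rw [Real.exp_le_exp, neg_le_neg_iff]
        calc 11 / 2 * Real.logb 2 n * s / n * a
            = 2 * (a * s) / n ^ 2 * (11 / 4 * n * Real.logb 2 n) := by field_simp; ring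
          _ ≤ _ := mul_le_mul_of_nonneg_left hℓ (by positivity)

lemma decay_pow_le_of_le {n s a : ℕ} (hn : 1 ≤ n) (hL : 600 ≤ Real.logb 2 n)
    (hs : n ≤ 32 * s) (hsa : s ≤ 2 * a) : decay n s ^ a ≤ ((4 : ℝ) ^ n)⁻¹ := by
  have hnR : (0 : ℝ) < n := by exact_mod_cast hn
  have hsR : (n : ℝ) ≤ 32 * s := by exact_mod_cast hs
  have haR : (s : ℝ) ≤ 2 * a := by exact_mod_cast hsa
  have h4 : Real.log 4 = 2 * Real.log 2 := by
    rw [show (4 : ℝ) = 2 ^ 2 by norm_num, Real.log_pow]; norm_num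
  have h4' : ((4 : ℝ) ^ n)⁻¹ = Real.exp (-(n * Real.log 4)) := by
    rw [Real.exp_neg, Real.exp_nat_mul, Real.exp_log (by norm_num)]
  rw [decay_pow, h4', Real.exp_le_exp, neg_le_neg_iff, h4]
  have hl := Real.log_two_lt_d9
  have hsa' : (n : ℝ) * n / 2048 ≤ s * a := by nlinarith
  have h5 : (n : ℝ) / 2048 ≤ s * a / n := by
    rw [le_div_iff₀ hnR]; linarith
  calc (n : ℝ) * (2 * Real.log 2) ≤ n * 1.4 := by nlinarith
    _ ≤ 11 / 2 * 600 * (n / 2048) := by nlinarith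
    _ ≤ 11 / 2 * Real.logb 2 n * (s * a / n) := by gcongr
    _ = _ := by ring

/-- The Chernoff weight attached to an off-type coordinate. -/
noncomputable def tilt (n k : ℕ) : ℝ :=
  if 11 / 2 * Real.logb 2 n * k / n ≤ 1 / 2 then 1 / n else 1 / 10

lemma tilt_pos {n : ℕ} (hn : 1 ≤ n) (k : ℕ) : 0 < tilt n k := by
  have hnR : (0 : ℝ) < n := by exact_mod_cast hn
  unfold tilt
  split_ifs <;> positivity

lemma one_add_exp_neg_half_le {y : ℝ} (h0 : 0 ≤ y) (h1 : y ≤ 1 / 2) :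
    (1 + Real.exp (-y)) / 2 ≤ Real.exp (-(7 / 16 * y)) := by
  have h := Real.cosh_le_exp_half_sq (y / 2)
  rw [Real.cosh_eq] at h
  have e1 : (1 + Real.exp (-y)) / 2 =
      Real.exp (-(y / 2)) * ((Real.exp (y / 2) + Real.exp (-(y / 2))) / 2) := by
    have a1 : Real.exp (-(y / 2)) * Real.exp (y / 2) = 1 := by
      rw [← Real.exp_add]; simp
    have a2 : Real.exp (-(y / 2)) * Real.exp (-(y / 2)) = Real.exp (-y) := by
      rw [← Real.exp_add]; congr 1; ring
    linear_combination (-1 / 2) * a1 - (1 / 2) * a2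
  rw [e1]
  calc _ ≤ Real.exp (-(y / 2)) * Real.exp ((y / 2) ^ 2 / 2) := by gcongr
    _ = Real.exp (-(y / 2) + (y / 2) ^ 2 / 2) := (Real.exp_add _ _).symm
    _ ≤ _ := by
      rw [Real.exp_le_exp]
      nlinarith

lemma tilted_sum_le_of_small {n k : ℕ} (hn : 1 ≤ n) (hk : 1 ≤ k)
    (hy : 11 / 2 * Real.logb 2 n * k / n ≤ 1 / 2) :
    (n : ℝ) ^ k * ((1 + decay n k) / 2 + 1 / n) ^ n ≤ 9 / n ^ 2 := by
  have hnR : (0 : ℝ) < n := by exact_mod_cast hn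
  have hkR : (1 : ℝ) ≤ k := by exact_mod_cast hk
  have hL : 0 ≤ Real.logb 2 n := Real.logb_nonneg (by norm_num) (by exact_mod_cast hn)
  set y := 11 / 2 * Real.logb 2 n * k / n with hy_def
  have hy0 : 0 ≤ y := by positivity
  have h1 := one_add_exp_neg_half_le hy0 hy
  have hln : Real.log n = Real.logb 2 n * Real.log 2 := by
    rw [Real.logb, div_mul_cancel₀]
    exact (Real.log_pos (by norm_num)).ne'
  have hA : (1 + decay n k) / 2 + 1 / n ≤ Real.exp (-(7 / 16 * y) + 2 / n) := by
    have h2 : (1 / 2 : ℝ) ≤ Real.exp (-(7 / 16 * y)) := by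
      have := Real.add_one_le_exp (-(7 / 16 * y))
      linarith
    have h3 := Real.add_one_le_exp (2 / (n : ℝ))
    rw [Real.exp_add]
    have h4 : Real.exp (-(7 / 16 * y)) * (2 / n + 1) ≤
        Real.exp (-(7 / 16 * y)) * Real.exp (2 / n) := by gcongr
    have h5 : 1 / 2 * (2 / (n : ℝ)) ≤ Real.exp (-(7 / 16 * y)) * (2 / n) := by gcongr
    have h6 : 1 / 2 * (2 / (n : ℝ)) = 1 / n := by ring
    change (1 + Real.exp (-y)) / 2 + 1 / n ≤ _
    linarith
  have hlog2 := Real.log_two_lt_d9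
  have hnk : (n : ℝ) ^ k = Real.exp (k * Real.log n) := by
    rw [Real.exp_nat_mul, Real.exp_log hnR]
  have hn2 : 1 / (n : ℝ) ^ 2 = Real.exp (-(2 * Real.log n)) := by
    rw [Real.exp_neg, show (2 : ℝ) * Real.log n = (2 : ℕ) * Real.log n by norm_num,
      Real.exp_nat_mul, Real.exp_log hnR, one_div]
  have he2 : Real.exp 2 ≤ 9 := by
    have := Real.exp_one_lt_d9
    have h : Real.exp 2 = Real.exp 1 * Real.exp 1 := by rw [← Real.exp_add]; norm_num
    nlinarith [Real.exp_pos 1]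
  calc (n : ℝ) ^ k * ((1 + decay n k) / 2 + 1 / n) ^ n
      ≤ (n : ℝ) ^ k * Real.exp (-(7 / 16 * y) + 2 / n) ^ n := by
        have := decay_nonneg n k
        gcongr
    _ = Real.exp (k * Real.log n + (n * (-(7 / 16 * y) + 2 / n))) := by
        rw [hnk, ← Real.exp_nat_mul, ← Real.exp_add]
    _ ≤ Real.exp (2 + -(2 * Real.log n)) := by
        rw [Real.exp_le_exp]
        have e : (n : ℝ) * (-(7 / 16 * y) + 2 / n) = 2 - 77 / 32 * Real.logb 2 n * k := by
          rw [hy_def]; field_simp; ring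
        rw [e, hln]
        have hLk : Real.logb 2 n ≤ Real.logb 2 n * k := by nlinarith
        have hb : (k : ℝ) * (Real.logb 2 n * Real.log 2) ≤ Real.logb 2 n * k * 0.6932 := by
          have : 0 ≤ Real.logb 2 n * k := by positivity
          nlinarith
        nlinarith
    _ = Real.exp 2 * (1 / n ^ 2) := by rw [Real.exp_add, hn2]
    _ ≤ 9 * (1 / n ^ 2) := by gcongr
    _ = _ := by ring

lemma tilted_sum_le_of_large {n k : ℕ} (hk : 32 * k ≤ n)
    (hy : 1 / 2 ≤ 11 / 2 * Real.logb 2 n * k / n) :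
    (10 : ℝ) ^ k * ((1 + decay n k) / 2 + 1 / 10) ^ n ≤ (983 / 1000) ^ n := by
  have hd : decay n k ≤ 31 / 50 := by
    have h1 : decay n k ≤ Real.exp (-(1 / 2)) := by
      unfold decay
      rw [Real.exp_le_exp]
      linarith
    have h2 : Real.exp (-(1 / 2)) * Real.exp (-(1 / 2)) = Real.exp (-1) := by
      rw [← Real.exp_add]; norm_num
    have h3 := Real.exp_neg_one_lt_d9
    by_contra! h
    nlinarith
  have h10 : (10 : ℝ) ^ k ≤ (27 / 25) ^ n :=
    calc (10 : ℝ) ^ k ≤ ((27 / 25) ^ 32) ^ k := by gcongr; norm_num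
      _ = (27 / 25) ^ (32 * k) := (pow_mul _ _ _).symm
      _ ≤ _ := pow_le_pow_right₀ (by norm_num) hk
  have hd0 := decay_nonneg n k
  calc (10 : ℝ) ^ k * ((1 + decay n k) / 2 + 1 / 10) ^ n ≤ (27 / 25) ^ n * (91 / 100) ^ n := by
        gcongr
        linarith
    _ = (27 / 25 * (91 / 100)) ^ n := (mul_pow _ _ _).symm
    _ ≤ _ := by gcongr; norm_num

lemma tilted_sum_le {n k : ℕ} (hn : 1 ≤ n) (hk : 1 ≤ k) (hkn : 32 * k ≤ n)
    (hexp : (983 / 1000 : ℝ) ^ n ≤ 9 / n ^ 2) :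
    (tilt n k ^ k)⁻¹ * (1 + decay n k + 2 * tilt n k) ^ n ≤ 2 ^ n * (9 / n ^ 2) := by
  have e : (tilt n k ^ k)⁻¹ * (1 + decay n k + 2 * tilt n k) ^ n =
      2 ^ n * ((tilt n k)⁻¹ ^ k * ((1 + decay n k) / 2 + tilt n k) ^ n) := by
    rw [mul_left_comm, ← mul_pow, inv_pow]
    congr 2
    ring
  rw [e]
  gcongr
  unfold tilt
  split_ifs with hy
  · simpa using tilted_sum_le_of_small hn hk hy
  · refine le_trans ?_ hexp
    simpa using tilted_sum_le_of_large hkn (le_of_not_ge hy)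

/-- The small off-type counts, for which the Chernoff bound is used. -/
def smallCounts (n : ℕ) : Finset ℕ := (Finset.Icc 1 n).filter fun k => 32 * k ≤ n

lemma depFraction_pow_le_sum {n ℓ : ℕ} (hn : 1 ≤ n) (hL : 600 ≤ Real.logb 2 n)
    (hℓ : (11 / 4 : ℝ) * n * Real.logb 2 n ≤ ℓ) (u v : QState n) :
    ((depPairs u v).card / Fintype.card (PairIdx n) : ℝ) ^ ℓ ≤
      (if u = 0 ∨ v = 0 ∨ u = v then 1 else 0) +
      ∑ c ∈ Finset.univ.erase (0 : ZMod 2 × ZMod 2), (((4 : ℝ) ^ n)⁻¹ +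
        ∑ k ∈ smallCounts n, (tilt n k ^ k)⁻¹ *
          (decay n k ^ typeCount c u v * tilt n k ^ offCount c u v)) := by
  have hterm : ∀ c k, 0 ≤ (tilt n k ^ k)⁻¹ *
      (decay n k ^ typeCount c u v * tilt n k ^ offCount c u v) := by
    intro c k
    have := tilt_pos hn k
    have := decay_nonneg n k
    positivity
  have hc0 : ∀ c, 0 ≤ ((4 : ℝ) ^ n)⁻¹ + ∑ k ∈ smallCounts n, (tilt n k ^ k)⁻¹ *
          (decay n k ^ typeCount c u v * tilt n k ^ offCount c u v) := fun c =>
    add_nonneg (by positivity) (Finset.sum_nonneg fun k _ => hterm c k)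
  split_ifs with h
  · refine le_trans ?_ (le_add_of_nonneg_right (Finset.sum_nonneg fun c _ => hc0 c))
    refine pow_le_one₀ (by positivity) (div_le_one_of_le₀ ?_ (by positivity))
    exact_mod_cast Finset.card_le_univ _
  · obtain ⟨c, hc, hs, hsa⟩ := exists_dominant_type h
    rw [zero_add]
    refine le_trans ?_ (Finset.single_le_sum (fun c _ => hc0 c)
      (Finset.mem_erase.mpr ⟨hc, Finset.mem_univ c⟩))
    refine (depFraction_pow_le hn hℓ hc hs hsa).trans ?_
    by_cases hsn : 32 * offCount c u v ≤ n
    · refine le_trans ?_ (le_add_of_nonneg_left (by positivity))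
      refine le_trans (le_of_eq ?_) (Finset.single_le_sum (fun k _ => hterm c k)
        (show offCount c u v ∈ smallCounts n by
          simp only [smallCounts, Finset.mem_filter, Finset.mem_Icc]
          omega))
      have := (pow_pos (tilt_pos hn (offCount c u v)) (offCount c u v)).ne'
      field_simp
    · exact (decay_pow_le_of_le hn hL (by omega) hsa).trans
        (le_add_of_nonneg_right (Finset.sum_nonneg fun k _ => hterm c k))

lemma sum_chernoff_le {n : ℕ} (hn : 1 ≤ n) (hexp : (983 / 1000 : ℝ) ^ n ≤ 9 / n ^ 2)
    {c : ZMod 2 × ZMod 2} (hc : c ≠ 0) :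
    ∑ u : QState n, ∑ v : QState n, (((4 : ℝ) ^ n)⁻¹ + ∑ k ∈ smallCounts n, (tilt n k ^ k)⁻¹ *
      (decay n k ^ typeCount c u v * tilt n k ^ offCount c u v)) ≤ 1 + 2 ^ n * (9 / n) := by
  have hnR : (0 : ℝ) < n := by exact_mod_cast hn
  simp_rw [Finset.sum_add_distrib]
  refine add_le_add (le_of_eq ?_) ?_
  · simp only [Finset.sum_const, Finset.card_univ, Fintype.card_pi, ZMod.card, Finset.prod_const,
      Fintype.card_fin, nsmul_eq_mul, Nat.cast_pow, Nat.cast_ofNat]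
    rw [← mul_assoc, ← mul_pow, show (2 : ℝ) * 2 = 4 by norm_num]
    exact mul_inv_cancel₀ (by positivity)
  · simp_rw [Finset.sum_comm (t := smallCounts n), ← Finset.mul_sum,
      sum_pow_typeCount_mul_pow_offCount hc]
    have hcard : ((smallCounts n).card : ℝ) ≤ n := by
      exact_mod_cast (Finset.card_filter_le _ _).trans (by simp)
    calc _ ≤ (smallCounts n).card • (2 ^ n * (9 / n ^ 2) : ℝ) := by
          refine Finset.sum_le_card_nsmul _ _ _ fun k hk => ?_
          simp only [smallCounts, Finset.mem_filter, Finset.mem_Icc] at hk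
          exact tilted_sum_le hn hk.1.1 hk.2 hexp
      _ ≤ n * (2 ^ n * (9 / n ^ 2)) := by rw [nsmul_eq_mul]; gcongr
      _ = _ := by field_simp

lemma sum_depFraction_pow_le {n ℓ : ℕ} (hn : 1 ≤ n) (hL : 600 ≤ Real.logb 2 n)
    (hexp : (983 / 1000 : ℝ) ^ n ≤ 9 / n ^ 2) (hℓ : (11 / 4 : ℝ) * n * Real.logb 2 n ≤ ℓ) :
    ∑ u : QState n, ∑ v : QState n, ((depPairs u v).card / Fintype.card (PairIdx n) : ℝ) ^ ℓ ≤
      3 * 2 ^ n - 2 + 3 * (1 + 2 ^ n * (9 / n)) := by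
  refine (Finset.sum_le_sum fun u _ => Finset.sum_le_sum fun v _ =>
    depFraction_pow_le_sum hn hL hℓ u v).trans ?_
  simp_rw [Finset.sum_add_distrib
    (f := fun v : QState n => if _ ∨ v = 0 ∨ _ = v then (1 : ℝ) else 0)]
  rw [Finset.sum_add_distrib, sum_dependent]
  refine add_le_add_right ?_ _
  simp_rw [Finset.sum_comm (t := Finset.univ.erase (0 : ZMod 2 × ZMod 2))]
  refine (Finset.sum_le_card_nsmul _ _ (1 + 2 ^ n * (9 / n) : ℝ) fun c hc =>
    sum_chernoff_le hn hexp (Finset.ne_of_mem_erase hc)).trans (le_of_eq ?_)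
  rw [Finset.card_erase_of_mem (Finset.mem_univ _), Finset.card_univ]
  simp
  ring

lemma dependent_le_sum_depFraction_pow {n : ℕ} (hn : 2 ≤ n) (ℓ : ℕ) :
    (3 : ℝ) * 2 ^ n - 2 ≤ ∑ u : QState n, ∑ v : QState n,
      ((depPairs u v).card / Fintype.card (PairIdx n) : ℝ) ^ ℓ := by
  rw [← sum_dependent]
  refine Finset.sum_le_sum fun u _ => Finset.sum_le_sum fun v _ => ?_
  split_ifs with h
  · have : Nonempty (PairIdx n) := ⟨⟨(⟨0, by omega⟩, ⟨1, by omega⟩), by simp⟩⟩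
    rw [depPairs_eq_univ h, Finset.card_univ, div_self (by simp), one_pow]
  · positivity

lemma sum_depFraction_pow_le_four_pow (n ℓ : ℕ) :
    ∑ u : QState n, ∑ v : QState n, ((depPairs u v).card / Fintype.card (PairIdx n) : ℝ) ^ ℓ ≤
      2 ^ n * 2 ^ n := by
  have h : ∀ u v : QState n, ((depPairs u v).card / Fintype.card (PairIdx n) : ℝ) ^ ℓ ≤ 1 := by
    intro u v
    refine pow_le_one₀ (by positivity) (div_le_one_of_le₀ ?_ (by positivity))
    exact_mod_cast Finset.card_le_univ _
  refine (Finset.sum_le_sum fun u _ => Finset.sum_le_sum fun v _ => h u v).trans ?_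
  simp

lemma exists_threshold : ∃ N : ℕ, ∀ n : ℕ, N ≤ n →
    600 ≤ Real.logb 2 n ∧ (983 / 1000 : ℝ) ^ n ≤ 9 / n ^ 2 := by
  have h1 : ∀ᶠ n : ℕ in Filter.atTop, 600 ≤ Real.logb 2 n :=
    ((Real.tendsto_logb_atTop (by norm_num)).comp
      tendsto_natCast_atTop_atTop).eventually_ge_atTop 600
  have h2 : ∀ᶠ n : ℕ in Filter.atTop, (n : ℝ) ^ 2 * (983 / 1000 : ℝ) ^ n < 1 :=
    (tendsto_pow_const_mul_const_pow_of_lt_one 2 (by norm_num) (by norm_num)).eventually_lt_const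
      (by norm_num)
  obtain ⟨N, hN⟩ := Filter.eventually_atTop.mp (h1.and h2)
  refine ⟨N + 1, fun n hn => ⟨(hN n (by omega)).1, ?_⟩⟩
  have hnR : (0 : ℝ) < n := by exact_mod_cast (by omega : 0 < n)
  have := (hN n (by omega)).2
  rw [le_div_iff₀ (by positivity)]
  linarith

/-- (Anticoncentration of sparse IQP circuits.) There is a constant
`C > 0` such that for every `n ≥ 2` and every `ℓ ≥ (11/4)·n·log₂ n`, the ideal XEB
score satisfies `0 ≤ χ̄(ℓ) − (2 − 2^{1−n}) ≤ C/n`. -/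
theorem sparse_iqp_anticoncentration :
    ∃ C : ℝ, 0 < C ∧ ∀ n : ℕ, 2 ≤ n → ∀ ℓ : ℕ,
      (11 / 4 : ℝ) * n * Real.logb 2 n ≤ ℓ →
        0 ≤ xeb n ℓ - (2 - 2 * ((2 : ℝ) ^ n)⁻¹) ∧
        xeb n ℓ - (2 - 2 * ((2 : ℝ) ^ n)⁻¹) ≤ C / n := by
  obtain ⟨N, hN⟩ := exists_threshold
  refine ⟨30 + 2 ^ N * N, by positivity, fun n hn ℓ hℓ => ?_⟩
  have hn0 : (0 : ℝ) < n := by exact_mod_cast (by omega : 0 < n)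
  have hp : (0 : ℝ) < 2 ^ n := by positivity
  have hlow := dependent_le_sum_depFraction_pow hn ℓ
  rw [xeb_eq]
  have key : ∀ S : ℝ, ((2 : ℝ) ^ n)⁻¹ * S - 1 - (2 - 2 * ((2 : ℝ) ^ n)⁻¹) =
      ((2 : ℝ) ^ n)⁻¹ * (S - (3 * 2 ^ n - 2)) := by
    intro S
    field_simp
    ring
  rw [key]
  refine ⟨mul_nonneg (by positivity) (sub_nonneg.mpr hlow), ?_⟩
  rw [inv_mul_le_iff₀ hp]
  rcases le_or_gt N n with hNn | hNn
  · obtain ⟨hL, hexp⟩ := hN n hNn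
    have hup := sum_depFraction_pow_le (by omega) hL hexp hℓ
    have h2n : (n : ℝ) ≤ 2 ^ n := by exact_mod_cast n.lt_two_pow_self.le
    have h1 : (1 : ℝ) ≤ 2 ^ n * (1 / n) := by
      rw [mul_one_div, le_div_iff₀ hn0, one_mul]
      exact h2n
    calc _ ≤ 3 * (1 + 2 ^ n * (9 / n) : ℝ) := by linarith
      _ ≤ 3 * (2 ^ n * (1 / n) + 2 ^ n * (9 / n) : ℝ) := by linarith
      _ = 2 ^ n * (30 / n) := by ring
      _ ≤ _ := by
        gcongr
        exact le_add_of_nonneg_right (by positivity)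
  · have hup := sum_depFraction_pow_le_four_pow n ℓ
    have h2 : (2 : ℝ) ≤ 2 ^ n := by
      calc (2 : ℝ) = 2 ^ 1 := (pow_one _).symm
        _ ≤ 2 ^ n := pow_le_pow_right₀ (by norm_num) (by omega)
    have hNR : (n : ℝ) ≤ N := by exact_mod_cast hNn.le
    calc _ ≤ (2 : ℝ) ^ n * 2 ^ n := by linarith
      _ ≤ _ := by
        gcongr
        rw [le_div_iff₀ hn0]
        calc (2 : ℝ) ^ n * n ≤ 2 ^ N * N := by
              gcongr
              norm_num
          _ ≤ _ := by linarith

end Stmt4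
end

section
/- (No anticoncentration at linearly many gates.) For every constant C > 0 there exist c > 0 and n₀ such that for all n ≥ n₀ and every 0 ≤ ℓ ≤ C·n, the ideal XEB score of the sparse degree-2 IQP ensemble satisfies χ̄(ℓ) ≥ 2^(c·n); i.e., for ℓ = O(n) the XEB score diverges exponentially in n. -/
open scoped BigOperators

namespace Stmt5

/-- Computational basis labels for `n` qubits: `𝔽₂ⁿ`. -/
abbrev QState (n : ℕ) := Fin n → ZMod 2

/-- Unordered pairs of qubits, represented by `i < j`. -/
abbrev PairIdx (n : ℕ) := {p : Fin n × Fin n // p.1 < p.2}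

/-- `(-1)^a` as a real number. -/
def sgnR (a : ZMod 2) : ℝ := (-1 : ℝ) ^ a.val

/-- Parameters of the sparse degree-2 IQP ensemble: `ℓ` uniformly random pairs,
`ℓ` uniform bits, and a uniform linear part `a ∈ 𝔽₂ⁿ`. -/
abbrev SparseParam (n ℓ : ℕ) := (Fin ℓ → PairIdx n) × (Fin ℓ → ZMod 2) × QState n

/-- The phase polynomial `f(z) = Σ_k w_k z_{i_k} z_{j_k} + a·z` of a sparse instance. -/
def sparseF {n ℓ : ℕ} (θ : SparseParam n ℓ) (z : QState n) : ZMod 2 :=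
  (∑ k : Fin ℓ, θ.2.1 k * z (θ.1 k).1.1 * z (θ.1 k).1.2) + ∑ i, θ.2.2 i * z i

/-- The X-basis output probability `p_f(x) = (2^{−n} Σ_z (−1)^{f(z)+x·z})²`. -/
noncomputable def pOut {n : ℕ} (f : QState n → ZMod 2) (x : QState n) : ℝ :=
  (((2 : ℝ) ^ n)⁻¹ * ∑ z : QState n, sgnR (f z + ∑ i, x i * z i)) ^ 2

/-- The ideal XEB score `χ̄(ℓ) = 2ⁿ Σ_x E[p_f(x)²] − 1` of the sparse ensemble. -/
noncomputable def xeb (n ℓ : ℕ) : ℝ :=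
  (2 : ℝ) ^ n *
    (∑ x : QState n, (∑ θ : SparseParam n ℓ, (pOut (sparseF θ) x) ^ 2) /
      (Fintype.card (SparseParam n ℓ))) - 1

theorem sgnR_add (a b : ZMod 2) : sgnR (a + b) = sgnR a * sgnR b := by
  unfold sgnR
  rw [← pow_add, ZMod.val_add, ← neg_one_pow_eq_pow_mod_two]

theorem sgnR_mul_self (a : ZMod 2) : sgnR a * sgnR a = 1 := by
  unfold sgnR
  rw [← mul_pow]
  norm_num

theorem sgnR_one : sgnR 1 = -1 := by
  norm_num [sgnR, ZMod.val_one]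

theorem sum_sgnR_eq_zero {n : ℕ} (g : QState n → ZMod 2) (i : Fin n)
    (h : ∀ z, g (z + Pi.single i 1) = g z + 1) : ∑ z, sgnR (g z) = 0 := by
  have key : ∑ z, sgnR (g (z + Pi.single i 1)) = ∑ z, sgnR (g z) :=
    Fintype.sum_equiv (Equiv.addRight (Pi.single i 1 : QState n)) _ _ fun z => by simp
  simp only [h, sgnR_add, sgnR_one, mul_neg_one, Finset.sum_neg_distrib] at key
  linarith

theorem sum_mul_add_single {n : ℕ} (a z : QState n) (i : Fin n) :
    ∑ j, a j * (z + Pi.single i 1 : QState n) j = ∑ j, a j * z j + a i := by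
  simp [mul_add, Finset.sum_add_distrib, Pi.single_apply]

theorem sum_sgnR_dot {n : ℕ} (y : QState n) :
    ∑ x : QState n, sgnR (∑ i, x i * y i) = if y = 0 then (2 : ℝ) ^ n else 0 := by
  split_ifs with hy
  · simp [hy, sgnR]
  · obtain ⟨i, hi⟩ := Function.ne_iff.1 hy
    have hi1 : y i = 1 := (by decide : ∀ u : ZMod 2, u ≠ 0 → u = 1) _ hi
    refine sum_sgnR_eq_zero _ i fun z => ?_
    simp only [mul_comm _ (y _)]
    rw [sum_mul_add_single, hi1]

theorem sum_pOut {n : ℕ} (f : QState n → ZMod 2) : ∑ x, pOut f x = 1 := by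
  have expand (x : QState n) : (∑ z, sgnR (f z + ∑ i, x i * z i)) ^ 2 =
      ∑ z, ∑ w, sgnR (f z) * sgnR (f w) * sgnR (∑ i, x i * (z + w) i) := by
    rw [sq, Finset.sum_mul_sum]
    refine Finset.sum_congr rfl fun z _ => Finset.sum_congr rfl fun w _ => ?_
    simp only [Pi.add_apply, mul_add, Finset.sum_add_distrib, sgnR_add]
    ring
  have diag (z w : QState n) : z + w = 0 ↔ z = w := by
    rw [add_eq_zero_iff_eq_neg, show -w = w from funext fun i => ZMod.neg_eq_self_mod_two (w i)]
  have total : ∑ x : QState n, (∑ z, sgnR (f z + ∑ i, x i * z i)) ^ 2 = (2 ^ n) ^ 2 := by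
    simp only [expand]
    rw [Finset.sum_comm]
    simp_rw [Finset.sum_comm (s := (Finset.univ : Finset (QState n))) (t := Finset.univ)
      (f := fun x w => sgnR (f _) * sgnR (f w) * sgnR (∑ i, x i * (_ + w) i)),
      ← Finset.mul_sum, sum_sgnR_dot, diag]
    simp [sgnR_mul_self, sq]
  simp only [pOut, mul_pow]
  rw [← Finset.mul_sum, total]
  field_simp

/-- The qubits touched by none of the pairs. -/
def isolated {n ℓ : ℕ} (P : Fin ℓ → PairIdx n) : Finset (Fin n) :=
  {i | ∀ k, (P k).1.1 ≠ i ∧ (P k).1.2 ≠ i}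

theorem mem_isolated {n ℓ : ℕ} {P : Fin ℓ → PairIdx n} {i : Fin n} :
    i ∈ isolated P ↔ ∀ k, (P k).1.1 ≠ i ∧ (P k).1.2 ≠ i := by
  simp [isolated]

theorem pOut_sparseF_eq_zero {n ℓ : ℕ} (θ : SparseParam n ℓ) (x : QState n) {i : Fin n}
    (hi : i ∈ isolated θ.1) (hx : x i ≠ θ.2.2 i) : pOut (sparseF θ) x = 0 := by
  rw [mem_isolated] at hi
  have flip : θ.2.2 i + x i = 1 :=
    (by decide : ∀ u v : ZMod 2, u ≠ v → v + u = 1) _ _ hx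
  unfold pOut
  rw [sum_sgnR_eq_zero _ i]
  · simp
  · intro z
    have quad : ∑ k, θ.2.1 k * (z + Pi.single i 1 : QState n) (θ.1 k).1.1 *
        (z + Pi.single i 1 : QState n) (θ.1 k).1.2 =
        ∑ k, θ.2.1 k * z (θ.1 k).1.1 * z (θ.1 k).1.2 := by
      refine Finset.sum_congr rfl fun k _ => ?_
      simp [hi k]
    unfold sparseF
    rw [quad, sum_mul_add_single, sum_mul_add_single, ← flip]
    ring

theorem card_agree_on {n : ℕ} (S : Finset (Fin n)) (a : QState n) :
    (Fintype.piFinset fun i => if i ∈ S then {a i} else Finset.univ).card * 2 ^ S.card = 2 ^ n := by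
  have h (i : Fin n) : (if i ∈ S then {a i} else (Finset.univ : Finset (ZMod 2))).card =
      if i ∈ S then 1 else 2 := by
    split_ifs <;> simp
  rw [Fintype.card_piFinset, Finset.prod_congr rfl fun i _ => h i, Finset.prod_ite]
  simp only [Finset.prod_const, one_pow, one_mul, ← pow_add]
  congr 1
  have := Finset.card_filter_add_card_filter_not (s := (Finset.univ : Finset (Fin n))) (· ∈ S)
  simp at this ⊢
  omega

theorem two_pow_card_isolated_le {n ℓ : ℕ} (θ : SparseParam n ℓ) :
    (2 : ℝ) ^ (isolated θ.1).card ≤ 2 ^ n * ∑ x, pOut (sparseF θ) x ^ 2 := by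
  set T : Finset (QState n) :=
    Fintype.piFinset fun i => if i ∈ isolated θ.1 then {θ.2.2 i} else Finset.univ
  have off (x : QState n) (hx : x ∉ T) : pOut (sparseF θ) x = 0 := by
    simp only [T, Fintype.mem_piFinset, not_forall] at hx
    obtain ⟨i, hi⟩ := hx
    split_ifs at hi with hiso
    · exact pOut_sparseF_eq_zero θ x hiso (by simpa using hi)
    · simp at hi
  have hsum : ∑ x ∈ T, pOut (sparseF θ) x = 1 := by
    rw [← sum_pOut (sparseF θ)]
    exact Finset.sum_subset (Finset.subset_univ _) fun x _ hx => off x hx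
  have hsq : ∑ x ∈ T, pOut (sparseF θ) x ^ 2 = ∑ x, pOut (sparseF θ) x ^ 2 :=
    Finset.sum_subset (Finset.subset_univ _) fun x _ hx => by simp [off x hx]
  have cs := sq_sum_le_card_mul_sum_sq (s := T) (f := pOut (sparseF θ))
  rw [hsum, hsq, one_pow] at cs
  have hcard : (T.card : ℝ) * 2 ^ (isolated θ.1).card = 2 ^ n := by
    exact_mod_cast card_agree_on (isolated θ.1) θ.2.2
  rw [← hcard]
  nlinarith [pow_pos (two_pos : (0 : ℝ) < 2) (isolated θ.1).card]

theorem xeb_eq {n ℓ : ℕ} : xeb n ℓ =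
    (∑ θ : SparseParam n ℓ, 2 ^ n * ∑ x, pOut (sparseF θ) x ^ 2) /
      Fintype.card (SparseParam n ℓ) - 1 := by
  unfold xeb
  rw [← Finset.sum_div, Finset.sum_comm, ← Finset.mul_sum, mul_div_assoc]

theorem sum_card_avoiding (n : ℕ) :
    ∑ i : Fin n, (({p : PairIdx n | p.1.1 ≠ i ∧ p.1.2 ≠ i} : Finset (PairIdx n)).card : ℝ) =
      Fintype.card (PairIdx n) * ((n : ℝ) - 2) := by
  have h (p : PairIdx n) :
      (({i : Fin n | p.1.1 ≠ i ∧ p.1.2 ≠ i} : Finset (Fin n)).card : ℝ) = n - 2 := by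
    have hset : ({i : Fin n | p.1.1 ≠ i ∧ p.1.2 ≠ i} : Finset (Fin n)) = {p.1.1, p.1.2}ᶜ := by
      ext i
      simp [eq_comm]
    have hc := Finset.card_add_card_compl ({p.1.1, p.1.2} : Finset (Fin n))
    rw [← hset, Finset.card_pair p.2.ne, Fintype.card_fin] at hc
    exact eq_sub_of_add_eq' (mod_cast hc)
  have dc := Finset.sum_card_bipartiteAbove_eq_sum_card_bipartiteBelow
    (s := (Finset.univ : Finset (Fin n))) (t := (Finset.univ : Finset (PairIdx n)))
    (fun i p => p.1.1 ≠ i ∧ p.1.2 ≠ i)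
  simp only [Finset.bipartiteAbove, Finset.bipartiteBelow] at dc
  rw [← Nat.cast_sum, dc, Nat.cast_sum, Finset.sum_congr rfl fun p _ => h p]
  simp only [Finset.sum_const, Finset.card_univ, nsmul_eq_mul]

theorem sum_card_isolated (n ℓ : ℕ) :
    ∑ P : Fin ℓ → PairIdx n, ((isolated P).card : ℝ) =
      ∑ i : Fin n,
        (({p : PairIdx n | p.1.1 ≠ i ∧ p.1.2 ≠ i} : Finset (PairIdx n)).card : ℝ) ^ ℓ := by
  have dc := Finset.sum_card_bipartiteAbove_eq_sum_card_bipartiteBelow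
    (s := (Finset.univ : Finset (Fin ℓ → PairIdx n))) (t := (Finset.univ : Finset (Fin n)))
    (fun P i => ∀ k, (P k).1.1 ≠ i ∧ (P k).1.2 ≠ i)
  simp only [Finset.bipartiteAbove, Finset.bipartiteBelow] at dc
  have h (i : Fin n) :
      ({P : Fin ℓ → PairIdx n | ∀ k, (P k).1.1 ≠ i ∧ (P k).1.2 ≠ i} : Finset _).card =
      ({p : PairIdx n | p.1.1 ≠ i ∧ p.1.2 ≠ i} : Finset (PairIdx n)).card ^ ℓ := by
    have hset : ({P : Fin ℓ → PairIdx n | ∀ k, (P k).1.1 ≠ i ∧ (P k).1.2 ≠ i} : Finset _) =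
        Fintype.piFinset fun _ => ({p : PairIdx n | p.1.1 ≠ i ∧ p.1.2 ≠ i} : Finset _) := by
      ext P
      simp
    rw [hset, Fintype.card_piFinset_const]
  unfold isolated
  rw [← Nat.cast_sum, dc, Nat.cast_sum]
  exact Finset.sum_congr rfl fun i _ => by rw [h, Nat.cast_pow]

/-- The expected number of isolated qubits is at least `n (1 - 2/n)^ℓ`. -/
theorem le_sum_card_isolated {n : ℕ} (hn : 2 ≤ n) (ℓ : ℕ) :
    n * (1 - 2 / (n : ℝ)) ^ ℓ * Fintype.card (SparseParam n ℓ) ≤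
      ∑ θ : SparseParam n ℓ, ((isolated θ.1).card : ℝ) := by
  have hn0 : (0 : ℝ) < n := by positivity
  have hJ := Real.pow_arith_mean_le_arith_mean_pow (Finset.univ : Finset (Fin n))
    (fun _ => (n : ℝ)⁻¹)
    (fun i => (({p : PairIdx n | p.1.1 ≠ i ∧ p.1.2 ≠ i} : Finset (PairIdx n)).card : ℝ))
    (fun _ _ => by positivity) (by simp [hn0.ne']) (fun _ _ => by positivity) ℓ
  rw [← Finset.mul_sum, ← Finset.mul_sum, sum_card_avoiding, ← sum_card_isolated] at hJ
  have hbase : (n : ℝ)⁻¹ * (Fintype.card (PairIdx n) * ((n : ℝ) - 2)) =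
      Fintype.card (PairIdx n) * (1 - 2 / n) := by
    field_simp
  rw [hbase, mul_pow, inv_mul_eq_div, le_div_iff₀ hn0] at hJ
  have hcard : (Fintype.card (SparseParam n ℓ) : ℝ) =
      (Fintype.card (PairIdx n) : ℝ) ^ ℓ * Fintype.card ((Fin ℓ → ZMod 2) × QState n) := by
    rw [Fintype.card_prod, Fintype.card_fun, Fintype.card_fin]
    push_cast
    ring
  rw [Fintype.sum_prod_type, hcard]
  simp only [Finset.sum_const, Finset.card_univ, nsmul_eq_mul]
  rw [← Finset.mul_sum]
  calc _ = (Fintype.card ((Fin ℓ → ZMod 2) × QState n) : ℝ) *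
        ((Fintype.card (PairIdx n) : ℝ) ^ ℓ * (1 - 2 / n) ^ ℓ * n) := by ring
    _ ≤ _ := by gcongr

theorem rpow_mean_le_mean_rpow {ι : Type*} [Fintype ι] [Nonempty ι] (X : ι → ℕ) {m : ℝ}
    (hm : m * Fintype.card ι ≤ ∑ i, (X i : ℝ)) :
    (2 : ℝ) ^ m ≤ (∑ i, (2 : ℝ) ^ X i) / Fintype.card ι := by
  have hN : (0 : ℝ) < Fintype.card ι := by exact_mod_cast Fintype.card_pos
  have tangent (i : ι) : (2 : ℝ) ^ m * (1 + Real.log 2 * (X i - m)) ≤ 2 ^ X i := by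
    have h := Real.add_one_le_exp (Real.log 2 * (X i - m))
    rw [← Real.rpow_def_of_pos two_pos, Real.rpow_sub two_pos, Real.rpow_natCast,
      le_div_iff₀ (by positivity)] at h
    linarith
  rw [le_div_iff₀ hN]
  refine le_trans ?_ (Finset.sum_le_sum fun i _ => tangent i)
  rw [← Finset.mul_sum, Finset.sum_add_distrib, ← Finset.mul_sum, Finset.sum_sub_distrib]
  simp only [Finset.sum_const, Finset.card_univ, nsmul_eq_mul, mul_one]
  gcongr
  nlinarith [mul_nonneg (Real.log_pos one_lt_two).le (sub_nonneg.2 hm)]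

theorem rpow_sub_one_le_xeb {n : ℕ} (hn : 2 ≤ n) (ℓ : ℕ) :
    (2 : ℝ) ^ (n * (1 - 2 / (n : ℝ)) ^ ℓ) - 1 ≤ xeb n ℓ := by
  have : Nonempty (PairIdx n) := ⟨⟨(⟨0, by omega⟩, ⟨1, by omega⟩), by simp⟩⟩
  rw [xeb_eq]
  gcongr
  refine (rpow_mean_le_mean_rpow (fun θ : SparseParam n ℓ => (isolated θ.1).card)
    (le_sum_card_isolated hn ℓ)).trans ?_
  gcongr with θ
  exact two_pow_card_isolated_le θ

theorem exp_neg_two_mul_le_one_sub {x : ℝ} (h0 : 0 ≤ x) (h1 : x ≤ 1 / 2) :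
    Real.exp (-(2 * x)) ≤ 1 - x := by
  rw [Real.exp_neg, inv_le_iff_one_le_mul₀ (Real.exp_pos _)]
  nlinarith [Real.add_one_le_exp (2 * x)]

theorem exp_le_one_sub_two_div_pow {C : ℝ} {n ℓ : ℕ} (hn : 4 ≤ n) (hℓ : (ℓ : ℝ) ≤ C * n) :
    Real.exp (-(4 * C)) ≤ (1 - 2 / (n : ℝ)) ^ ℓ := by
  have hn4 : (4 : ℝ) ≤ n := by exact_mod_cast hn
  have hn0 : (0 : ℝ) < n := by linarith
  have hbase : Real.exp (-(2 * (2 / (n : ℝ)))) ≤ 1 - 2 / n :=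
    exp_neg_two_mul_le_one_sub (by positivity) (by rw [div_le_iff₀ hn0]; linarith)
  refine le_trans ?_ (pow_le_pow_left₀ (Real.exp_pos _).le hbase ℓ)
  rw [← Real.exp_nat_mul, Real.exp_le_exp]
  have : (ℓ : ℝ) / n ≤ C := by rwa [div_le_iff₀ hn0]
  calc -(4 * C) ≤ -(4 * (ℓ / n)) := by linarith
    _ = _ := by ring

/-- (No anticoncentration at linearly many gates.) For every constant
`C > 0` there exist `c > 0` and `n₀` such that for all `n ≥ n₀` and every
`0 ≤ ℓ ≤ C·n`, the ideal XEB score satisfies `χ̄(ℓ) ≥ 2^{c·n}`. -/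
theorem sparse_iqp_no_anticoncentration_linear :
    ∀ C : ℝ, 0 < C → ∃ c : ℝ, 0 < c ∧ ∃ n₀ : ℕ, ∀ n : ℕ, n₀ ≤ n → ∀ ℓ : ℕ,
      (ℓ : ℝ) ≤ C * n → (2 : ℝ) ^ (c * n) ≤ xeb n ℓ := by
  intro C _
  set δ : ℝ := Real.exp (-(4 * C))
  have hδ : 0 < δ := Real.exp_pos _
  refine ⟨δ / 2, by positivity, max 4 ⌈2 / δ⌉₊, fun n hn ℓ hℓ => ?_⟩
  have hn4 : 4 ≤ n := (le_max_left _ _).trans hn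
  have hn1 : 2 / δ ≤ n := Nat.ceil_le.1 ((le_max_right _ _).trans hn)
  have hcn : 1 ≤ δ / 2 * n := by
    rw [div_le_iff₀ hδ] at hn1
    linarith
  have htwo : (2 : ℝ) ≤ 2 ^ (δ / 2 * n) := by
    simpa using Real.rpow_le_rpow_of_exponent_le one_le_two hcn
  have hsq : (2 : ℝ) ^ (δ * n) = 2 ^ (δ / 2 * n) * 2 ^ (δ / 2 * n) := by
    rw [← Real.rpow_add two_pos]
    ring_nf
  have hmono : (2 : ℝ) ^ (δ * n) ≤ 2 ^ (n * (1 - 2 / (n : ℝ)) ^ ℓ) := by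
    refine Real.rpow_le_rpow_of_exponent_le one_le_two ?_
    rw [mul_comm]
    gcongr
    exact exp_le_one_sub_two_div_pow hn4 hℓ
  nlinarith [rpow_sub_one_le_xeb (by omega : 2 ≤ n) ℓ]

end Stmt5
end

section
/- (CNOT update rule.) Define the map ε : 𝒮 × 𝒮 → 𝒮 by: ε_𝖷 is the identity on 𝒮; ε_𝖨 swaps 𝖷↔𝖨 and 𝖲↔𝖯; ε_𝖲 swaps 𝖷↔𝖲 and 𝖨↔𝖯; ε_𝖯 swaps 𝖷↔𝖯 and 𝖨↔𝖲 (so that, with 𝖷 as the identity element, ε is the multiplication of the Klein four-group on 𝒮). Then for all A, B ∈ 𝒮: (CNOT ⊗ CNOT) (A ⊠ B) (CNOT ⊗ CNOT)† = A ⊠ ε_A(B), where the first CNOT acts on the copy-1 qubit pair and the second on the copy-2 qubit pair. -/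
open scoped BigOperators
open Matrix

namespace Stmt6

/-- One bit. -/
abbrev B2 := ZMod 2

/-- Basis labels `(u, v)` for the two copies of one site: `u` = copy 1, `v` = copy 2. -/
abbrev Site := B2 × B2

abbrev Mat4 := Matrix Site Site ℂ

/-- Basis labels `(u₁, u₂, v₁, v₂)` for two sites and two copies, in the order
(site 1 copy 1, site 2 copy 1, site 1 copy 2, site 2 copy 2). -/
abbrev Q4 := B2 × B2 × B2 × B2

/-- `𝖷 = |00⟩⟨00| + |11⟩⟨11|`. -/
def SX : Mat4 := Matrix.of fun p q => if p.1 = p.2 ∧ q.1 = q.2 ∧ p.1 = q.1 then 1 else 0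

/-- `𝖨 = |01⟩⟨01| + |10⟩⟨10|`. -/
def SI : Mat4 := Matrix.of fun p q => if p.1 ≠ p.2 ∧ p = q then 1 else 0

/-- `𝖲 = |01⟩⟨10| + |10⟩⟨01|`. -/
def SS : Mat4 := Matrix.of fun p q => if p.1 ≠ p.2 ∧ q.1 = p.2 ∧ q.2 = p.1 then 1 else 0

/-- `𝖯 = |00⟩⟨11| + |11⟩⟨00|`. -/
def SP : Mat4 := Matrix.of fun p q => if p.1 = p.2 ∧ q.1 = q.2 ∧ p.1 ≠ q.1 then 1 else 0

/-- The four states `𝒮 = {𝖷, 𝖨, 𝖲, 𝖯}`, labelled by the Klein four-group `𝔽₂ × 𝔽₂`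
with `𝖷` the identity element; with this labelling the map `ε` of the statement is
exactly the group multiplication: `ε_a(b) = a + b`. -/
def klein : B2 × B2 → Mat4 := fun a =>
  if a = ((0 : B2), (0 : B2)) then SX
  else if a = ((1 : B2), (0 : B2)) then SI
  else if a = ((0 : B2), (1 : B2)) then SS
  else SP

/-- `A ⊠ B`: `A` acting on the two copies of site 1 and `B` on the two copies of site 2. -/
def btimes (A B : Mat4) : Matrix Q4 Q4 ℂ :=
  Matrix.of fun p q =>
    A (p.1, p.2.2.1) (q.1, q.2.2.1) * B (p.2.1, p.2.2.2) (q.2.1, q.2.2.2)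

/-- `CNOT ⊗ CNOT`: the CNOT `|c,t⟩ ↦ |c, t⊕c⟩` applied to the copy-1 qubit pair and to
the copy-2 qubit pair. -/
def CC : Matrix Q4 Q4 ℂ :=
  Matrix.of fun p q => if p = (q.1, q.2.1 + q.1, q.2.2.1, q.2.2.2 + q.2.2.1) then 1 else 0

set_option synthInstance.maxSize 1024 in
/-- The Klein label of an element of `𝒮` records the parity of its basis states and the
bit flip between row and column. -/
lemma klein_apply (a p q : B2 × B2) :
    klein a p q =
      if p.1 + p.2 = a.1 + a.2 ∧ q.1 + q.2 = a.1 + a.2 ∧ p.1 + q.1 = a.2 then 1 else 0 := by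
  unfold klein
  split_ifs <;>
    simp only [SX, SI, SS, SP, Matrix.of_apply, ite_eq_left_iff, ite_eq_right_iff,
      one_ne_zero, zero_ne_one, imp_false, not_not] <;>
    revert a p q <;> decide

/-- The action of `CNOT ⊗ CNOT` on basis labels. -/
def cnotLabel (p : Q4) : Q4 := (p.1, p.2.1 + p.1, p.2.2.1, p.2.2.2 + p.2.2.1)

lemma eq_cnotLabel_comm (p q : Q4) : p = cnotLabel q ↔ q = cnotLabel p := by
  revert p q
  decide

lemma CC_apply (p q : Q4) : CC p q = if q = cnotLabel p then 1 else 0 := by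
  simp only [← eq_cnotLabel_comm p q]
  rfl

lemma CC_conj_apply (M : Matrix Q4 Q4 ℂ) (p q : Q4) :
    (CC * M * CCᴴ) p q = M (cnotLabel p) (cnotLabel q) := by
  simp [Matrix.mul_apply, CC_apply, apply_ite (starRingEnd ℂ)]

/-- (CNOT update rule.) For all `A, B ∈ 𝒮`,
`(CNOT ⊗ CNOT)(A ⊠ B)(CNOT ⊗ CNOT)† = A ⊠ ε_A(B)`, where `ε` is the Klein four-group
multiplication on `𝒮` with identity element `𝖷`. -/
theorem cnot_update (a b : B2 × B2) :
    CC * btimes (klein a) (klein b) * CCᴴ = btimes (klein a) (klein (a + b)) := by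
  ext p q
  rw [CC_conj_apply]
  simp only [btimes, Matrix.of_apply, klein_apply, ite_zero_mul_ite_zero, mul_one,
    cnotLabel, Prod.fst_add, Prod.snd_add]
  congr 1
  grind

end Stmt6
end

section
/- (Projection under a random two-qubit degree-2 IQP circuit.) Let D = (Z^u ⊗ Z^v)·CZ^w be the random two-qubit diagonal unitary with u, v, w independent uniform bits, where Z = diag(1,−1) and CZ = diag(1,1,1,−1). Then for all A, B ∈ 𝒮, the average E_{u,v,w}[ (D ⊗ D) (A ⊠ B) (D ⊗ D)† ] (with the first D acting on the copy-1 qubit pair and the second on the copy-2 qubit pair) equals A ⊠ B if A = 𝖷 or B = 𝖷 or A = B, and equals 0 if A ≠ B and A, B ∈ {𝖨, 𝖲, 𝖯}. -/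
open scoped BigOperators
open Matrix

namespace Stmt7

/-- One bit. -/
abbrev B2 := ZMod 2

/-- Basis labels `(u, v)` for the two copies of one site: `u` = copy 1, `v` = copy 2. -/
abbrev Site := B2 × B2

abbrev Mat4 := Matrix Site Site ℂ

/-- Basis labels `(u₁, u₂, v₁, v₂)` for two sites and two copies, in the order
(site 1 copy 1, site 2 copy 1, site 1 copy 2, site 2 copy 2). -/
abbrev Q4 := B2 × B2 × B2 × B2

/-- `(-1)^a` as a complex number. -/
def sgn (a : B2) : ℂ := (-1 : ℂ) ^ a.val

/-- `𝖷 = |00⟩⟨00| + |11⟩⟨11|`. -/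
def SX : Mat4 := Matrix.of fun p q => if p.1 = p.2 ∧ q.1 = q.2 ∧ p.1 = q.1 then 1 else 0

/-- `𝖨 = |01⟩⟨01| + |10⟩⟨10|`. -/
def SI : Mat4 := Matrix.of fun p q => if p.1 ≠ p.2 ∧ p = q then 1 else 0

/-- `𝖲 = |01⟩⟨10| + |10⟩⟨01|`. -/
def SS : Mat4 := Matrix.of fun p q => if p.1 ≠ p.2 ∧ q.1 = p.2 ∧ q.2 = p.1 then 1 else 0

/-- `𝖯 = |00⟩⟨11| + |11⟩⟨00|`. -/
def SP : Mat4 := Matrix.of fun p q => if p.1 = p.2 ∧ q.1 = q.2 ∧ p.1 ≠ q.1 then 1 else 0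

/-- The four states `𝒮 = {𝖷, 𝖨, 𝖲, 𝖯}`, labelled by `𝔽₂ × 𝔽₂` with `𝖷 ↦ (0,0)`. -/
def lab : B2 × B2 → Mat4 := fun a =>
  if a = ((0 : B2), (0 : B2)) then SX
  else if a = ((1 : B2), (0 : B2)) then SI
  else if a = ((0 : B2), (1 : B2)) then SS
  else SP

/-- `A ⊠ B`: `A` acting on the two copies of site 1 and `B` on the two copies of site 2. -/
def btimes (A B : Mat4) : Matrix Q4 Q4 ℂ :=
  Matrix.of fun p q =>
    A (p.1, p.2.2.1) (q.1, q.2.2.1) * B (p.2.1, p.2.2.2) (q.2.1, q.2.2.2)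

/-- Phase of the random two-qubit diagonal circuit `D = (Z^u ⊗ Z^v)·CZ^w` on a pair of
bits `(z₁, z₂)`. -/
def φ (u v w z₁ z₂ : B2) : B2 := u * z₁ + v * z₂ + w * z₁ * z₂

/-- `D ⊗ D` with `D = (Z^u ⊗ Z^v)·CZ^w`: the first `D` acts on the copy-1 qubit pair,
the second on the copy-2 qubit pair. -/
noncomputable def DD (u v w : B2) : Matrix Q4 Q4 ℂ :=
  Matrix.diagonal fun p => sgn (φ u v w p.1 p.2.1) * sgn (φ u v w p.2.2.1 p.2.2.2)

/-- The phase function `sgn` is a character of `𝔽₂`. -/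
theorem sgn_add (a b : B2) : sgn (a + b) = sgn a * sgn b := by
  simp only [sgn, ZMod.val_add, ← pow_add]
  exact (neg_one_pow_eq_pow_mod_two _).symm

theorem star_sgn (a : B2) : star (sgn a) = sgn a := by
  simp [sgn]

theorem sum_sgn_mul (c : B2) : ∑ w : B2, sgn (w * c) = if c = 0 then 2 else 0 := by
  have hu : (Finset.univ : Finset B2) = {0, 1} := by decide
  have h0 : sgn 0 = 1 := by simp [sgn]
  have h1 : sgn 1 = -1 := by simp [sgn, ZMod.val_one]
  rw [hu, Finset.sum_pair (by decide)]
  obtain rfl | rfl : c = 0 ∨ c = 1 := by revert c; decide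
  · norm_num [h0]
  · norm_num [h0, h1]

set_option synthInstance.maxSize 1000 in
/-- Each state is the indicator of fixed parity `p.1 + p.2` and a fixed common shift from
`p` to `q`. -/
theorem lab_apply (a : B2 × B2) (p q : Site) :
    lab a p q =
      if p.2 = p.1 + (a.1 + a.2) ∧ q.1 = p.1 + a.2 ∧ q.2 = p.1 + (a.1 + a.2) + a.2 then 1
      else 0 := by
  unfold lab
  split_ifs <;>
    simp only [SX, SI, SS, SP, Matrix.of_apply] <;>
    first
      | refine if_pos ?_
      | refine if_neg ?_
  all_goals
    revert a p q
    decide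

/-- The symplectic form on `𝔽₂²` vanishes exactly on linearly dependent pairs. -/
theorem symplectic_eq_zero_iff (a b : B2 × B2) :
    a.1 * b.2 + a.2 * b.1 = 0 ↔ a = (0, 0) ∨ b = (0, 0) ∨ a = b := by
  revert a b
  decide

/-- On the support of `lab a ⊠ lab b`, the single-site phases cancel and the `CZ` phase
is the symplectic form of the labels. -/
theorem phase_eq (a b : B2 × B2) (u v w x y : B2) :
    φ u v w x y + φ u v w (x + (a.1 + a.2)) (y + (b.1 + b.2)) +
        (φ u v w (x + a.2) (y + b.2) +
          φ u v w (x + (a.1 + a.2) + a.2) (y + (b.1 + b.2) + b.2)) =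
      w * (a.1 * b.2 + a.2 * b.1) := by
  have h : (2 : B2) = 0 := by decide
  unfold φ
  linear_combination (2 * u * x + u * a.1 + 2 * u * a.2 + 2 * v * y + 2 * x * y * w +
    x * w * b.1 + 2 * x * w * b.2 + v * b.1 + 2 * v * b.2 + y * w * a.1 + 2 * y * w * a.2 +
    w * a.1 * b.1 + w * a.1 * b.2 + w * a.2 * b.1 + 3 * w * a.2 * b.2) * h

theorem DD_conj_apply (u v w : B2) (M : Matrix Q4 Q4 ℂ) (p q : Q4) :
    (DD u v w * M * (DD u v w)ᴴ) p q =
      sgn (φ u v w p.1 p.2.1 + φ u v w p.2.2.1 p.2.2.2 +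
        (φ u v w q.1 q.2.1 + φ u v w q.2.2.1 q.2.2.2)) * M p q := by
  simp only [DD, Matrix.diagonal_conjTranspose, Matrix.mul_diagonal, Matrix.diagonal_mul,
    Pi.star_apply, star_mul', star_sgn, sgn_add]
  ring

theorem DD_conj_btimes (u v w : B2) (a b : B2 × B2) :
    DD u v w * btimes (lab a) (lab b) * (DD u v w)ᴴ =
      sgn (w * (a.1 * b.2 + a.2 * b.1)) • btimes (lab a) (lab b) := by
  ext ⟨x, y, x', y'⟩ ⟨z, t, z', t'⟩
  rw [DD_conj_apply, Matrix.smul_apply, smul_eq_mul]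
  simp only [btimes, Matrix.of_apply, lab_apply]
  split_ifs with ha hb
  · obtain ⟨rfl, rfl, rfl⟩ := ha
    obtain ⟨rfl, rfl, rfl⟩ := hb
    rw [phase_eq]
  all_goals simp

/-- (Projection under a random two-qubit degree-2 IQP circuit.) For all
`A, B ∈ 𝒮`, the average `E_{u,v,w}[(D ⊗ D)(A ⊠ B)(D ⊗ D)†]` equals `A ⊠ B` if `A = 𝖷`
or `B = 𝖷` or `A = B`, and equals `0` otherwise (i.e. if `A ≠ B` and `A, B ∈ {𝖨,𝖲,𝖯}`). -/
theorem random_iqp_projection (a b : B2 × B2) :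
    ((8 : ℂ))⁻¹ • ∑ u : B2, ∑ v : B2, ∑ w : B2, DD u v w * btimes (lab a) (lab b) * (DD u v w)ᴴ =
      if a = ((0 : B2), (0 : B2)) ∨ b = ((0 : B2), (0 : B2)) ∨ a = b then
        btimes (lab a) (lab b)
      else 0 := by
  simp only [DD_conj_btimes, ← Finset.sum_smul, sum_sgn_mul, Finset.sum_const,
    symplectic_eq_zero_iff, Finset.card_univ, ZMod.card]
  split_ifs
  · rw [smul_smul]
    norm_num
  · simp

end Stmt7
end

section
/- (Asymptotic XEB of block-random IQP circuits with randomized parallel CNOTs.) For every connected graph G on b blocks and every ordered partition of its edge set into matchings, the ideal XEB score of the hyperdepth-L block-random degree-2 IQP ensemble with randomized parallel transversal CNOT gates converges as L → ∞ to 2 − 2^(1−m·b) + (2^m − 1)·(4^b − 3·2^b + 2)/2^(m·b). -/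
open scoped BigOperators
open Matrix

namespace Stmt8

/-- One bit. -/
abbrev B2 := ZMod 2

/-- Computational basis labels: one bit per (block, qubit-in-block). -/
abbrev St (b m : ℕ) := Fin b × Fin m → B2

/-- `(-1)^a` as a complex number. -/
def sgn (a : B2) : ℂ := (-1 : ℂ) ^ a.val

/-- Parameters of a uniformly random degree-2 IQP circuit on a single block of `m`
qubits: linear coefficients and quadratic coefficients on pairs `i < j`. -/
abbrev BlockIQP (m : ℕ) := (Fin m → B2) × ({p : Fin m × Fin m // p.1 < p.2} → B2)

/-- Phase polynomial of a layer of independent in-block degree-2 IQP circuits. -/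
def blockPhase (b m : ℕ) (θ : Fin b → BlockIQP m) (x : St b m) : B2 :=
  ∑ k : Fin b,
    ((∑ p : {p : Fin m × Fin m // p.1 < p.2}, (θ k).2 p * x (k, p.1.1) * x (k, p.1.2)) +
      ∑ i : Fin m, (θ k).1 i * x (k, i))

/-- The diagonal unitary of a layer of in-block degree-2 IQP circuits. -/
noncomputable def iqpMat (b m : ℕ) (θ : Fin b → BlockIQP m) : Matrix (St b m) (St b m) ℂ :=
  Matrix.diagonal fun x => sgn (blockPhase b m θ x)

/-- Permutation matrix `V|x⟩ = |σ x⟩`. -/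
noncomputable def permMat (b m : ℕ) (σ : St b m → St b m) : Matrix (St b m) (St b m) ℂ :=
  Matrix.of fun p q => if p = σ q then 1 else 0

/-- Action on basis states of the parallel transversal CNOTs along the matching encoded
by the involution `c` (blocks `u` and `c u ≠ u` are paired; fixed points carry no edge),
with direction bit `d` read at the smaller endpoint of each edge: bit `0` means the
smaller endpoint is the control.  The transversal CNOT from block `u` to block `v`
applies `|c,t⟩ ↦ |c, t⊕c⟩` from qubit `s` of `u` to qubit `s` of `v` for every `s`. -/
def cnotPerm (b m : ℕ) (c : Fin b → Fin b) (d : Fin b → B2) (x : St b m) : St b m := fun q =>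
  if c q.1 = q.1 then x q
  else
    let ctl := if d (min q.1 (c q.1)) = 0 then min q.1 (c q.1) else max q.1 (c q.1)
    if q.1 = ctl then x q else x q + x (c q.1, q.2)

/-- Random data of one step of a hyperlayer: in-block IQP parameters for every block and
a direction bit for every edge of the matching. -/
abbrev StepP (b m : ℕ) := (Fin b → BlockIQP m) × (Fin b → B2)

/-- One step: in-block random degree-2 IQP circuits followed by randomized parallel
transversal CNOTs along the matching `c`. -/
noncomputable def stepMat (b m : ℕ) (c : Fin b → Fin b) (p : StepP b m) :
    Matrix (St b m) (St b m) ℂ :=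
  permMat b m (cnotPerm b m c p.2) * iqpMat b m p.1

/-- Time-ordered product: `f 0` is applied first. -/
noncomputable def seqProd {M : Type*} [Monoid M] {k : ℕ} (f : Fin k → M) : M :=
  ((List.finRange k).map f).reverse.prod

/-- Random data of a hyperdepth-`L` circuit: `L` hyperlayers of `r` steps each, plus a
final layer of in-block IQP circuits. -/
abbrev ParamT (b m r L : ℕ) := (Fin L → Fin r → StepP b m) × (Fin b → BlockIQP m)

/-- The hyperdepth-`L` block-random circuit. -/
noncomputable def circuitMat (b m r L : ℕ) (c : Fin r → Fin b → Fin b) (θ : ParamT b m r L) :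
    Matrix (St b m) (St b m) ℂ :=
  iqpMat b m θ.2 *
    seqProd fun l : Fin L => seqProd fun t : Fin r => stepMat b m (c t) (θ.1 l t)

/-- The uniform superposition `|+^N⟩`, `N = m·b`. -/
noncomputable def plusV (b m : ℕ) : St b m → ℂ := fun _ => (((Real.sqrt 2)⁻¹ : ℝ) ^ (m * b) : ℝ)

/-- The `N`-fold Hadamard, `N = m·b`. -/
noncomputable def Hmat (b m : ℕ) : Matrix (St b m) (St b m) ℂ :=
  Matrix.of fun x y => (((Real.sqrt 2)⁻¹ : ℝ) ^ (m * b) : ℝ) * sgn (∑ i, x i * y i)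

set_option synthInstance.maxSize 1024

/-- The ideal XEB score `χ̄(L) = 2^N Σ_x E[p_C(x)²] − 1` of the hyperdepth-`L`
block-random degree-2 IQP ensemble, where `p_C(x) = |⟨x|H^{⊗N} C|+^N⟩|²`. -/
noncomputable def xeb (b m r : ℕ) (c : Fin r → Fin b → Fin b) (L : ℕ) : ℝ :=
  (2 : ℝ) ^ (m * b) *
    ((∑ θ : ParamT b m r L, ∑ x : St b m,
        (Complex.normSq (((Hmat b m * circuitMat b m r L c θ).mulVec (plusV b m)) x)) ^ 2) /
      (Fintype.card (ParamT b m r L))) - 1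

section Characters

lemma b2_cases (a : B2) : a = 0 ∨ a = 1 := by revert a; decide

lemma sgn_add (a b : B2) : sgn (a + b) = sgn a * sgn b := by
  rcases b2_cases a with rfl | rfl <;> rcases b2_cases b with rfl | rfl <;>
    simp [sgn, CharTwo.add_self_eq_zero, ZMod.val_one]

lemma sgn_zero : sgn 0 = 1 := by simp [sgn]

lemma conj_sgn (a : B2) : (starRingEnd ℂ) (sgn a) = sgn a := by simp [sgn]

lemma sgn_of_ne_zero {a : B2} (h : a ≠ 0) : sgn a = -1 := by
  rw [(b2_cases a).resolve_left h, sgn, ZMod.val_one, pow_one]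

lemma sum_sgn_hom {A : Type*} [AddCommGroup A] [Fintype A] (ℓ : A → B2)
    (hℓ : ∀ x y, ℓ (x + y) = ℓ x + ℓ y) [Decidable (∀ a, ℓ a = 0)] :
    ∑ a, sgn (ℓ a) = if ∀ a, ℓ a = 0 then (Fintype.card A : ℂ) else 0 := by
  split_ifs with h
  · simp [h, sgn_zero]
  · push Not at h
    obtain ⟨a₀, ha₀⟩ := h
    have key : ∑ a, sgn (ℓ a) = -∑ a, sgn (ℓ a) := by
      conv_lhs => rw [← Equiv.sum_comp (Equiv.addLeft a₀)]
      rw [← Finset.sum_neg_distrib]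
      refine Finset.sum_congr rfl fun a _ => ?_
      rw [Equiv.coe_addLeft, hℓ, sgn_add, sgn_of_ne_zero ha₀, neg_one_mul]
    exact self_eq_neg.mp key

end Characters

section LinearDependence

/-- Linear dependence of two vectors over `𝔽₂`. -/
def Dep {A : Type*} [Zero A] (p q : A) : Prop := p = 0 ∨ q = 0 ∨ p = q

/-- Pairs of basis labels. -/
abbrev Pairs (b m : ℕ) := St b m × St b m

/-- Both labels of a pair are linearly dependent inside each block. -/
def BlockDep {b m : ℕ} (w : Pairs b m) : Prop :=
  ∀ k, Dep (fun i => w.1 (k, i)) (fun i => w.2 (k, i))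

lemma dep_iff_minors {m : ℕ} (p q : Fin m → B2) :
    Dep p q ↔ ∀ i j, i < j → p i * q j + p j * q i = 0 := by
  constructor
  · rintro (rfl | rfl | rfl) i j -
    · simp
    · simp
    · rw [mul_comm (p j), CharTwo.add_self_eq_zero]
  · intro h
    by_cases hp : p = 0
    · exact Or.inl hp
    obtain ⟨i, hi⟩ := Function.ne_iff.mp hp
    have hi1 : p i = 1 := (b2_cases _).resolve_left hi
    have hq : ∀ j, q j = p j * q i := by
      intro j
      rcases lt_trichotomy i j with hij | rfl | hij
      · have := h i j hij
        rw [hi1, one_mul] at this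
        exact CharTwo.add_eq_zero.mp this
      · rw [hi1, one_mul]
      · have := h j i hij
        rw [hi1, one_mul] at this
        exact (CharTwo.add_eq_zero.mp this).symm
    rcases b2_cases (q i) with h0 | h1
    · exact Or.inr (Or.inl (funext fun j => by rw [hq, h0, mul_zero]; rfl))
    · exact Or.inr (Or.inr (funext fun j => by rw [hq, h1, mul_one]))

end LinearDependence

section Gowers

variable {b m : ℕ}

/-- The Gowers-type four-point correlation of a state along a pair of directions. -/
noncomputable def gowers (ψ : St b m → ℂ) (w : Pairs b m) : ℂ :=
  ∑ z, ψ z * (starRingEnd ℂ) (ψ (z + w.1)) * (starRingEnd ℂ) (ψ (z + w.2)) *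
    ψ (z + w.1 + w.2)

/-- The four-point correlations of a state, summed against a weight. -/
noncomputable def pairing (F : Pairs b m → ℝ) (ψ : St b m → ℂ) : ℂ :=
  ∑ w, (F w : ℂ) * gowers ψ w

/-- The bilinear form obtained by differencing the phase polynomial twice. -/
def polar (θ : Fin b → BlockIQP m) (w : Pairs b m) : B2 :=
  ∑ k : Fin b, ∑ p : {p : Fin m × Fin m // p.1 < p.2},
    (θ k).2 p * (w.1 (k, p.1.1) * w.2 (k, p.1.2) + w.1 (k, p.1.2) * w.2 (k, p.1.1))

lemma blockPhase_polar (θ : Fin b → BlockIQP m) (z : St b m) (w : Pairs b m) :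
    blockPhase b m θ z + blockPhase b m θ (z + w.1) + blockPhase b m θ (z + w.2) +
      blockPhase b m θ (z + w.1 + w.2) = polar θ w := by
  simp only [blockPhase, polar, ← Finset.sum_add_distrib]
  refine Finset.sum_congr rfl fun k _ => ?_
  have quad : ∀ t x x' u u' v v' : B2, t * x * x' + t * (x + u) * (x' + u') +
      t * (x + v) * (x' + v') + t * (x + u + v) * (x' + u' + v') = t * (u * v' + u' * v) := by
    decide
  have lin : ∀ t x u v : B2, t * x + t * (x + u) + t * (x + v) + t * (x + u + v) = 0 := by
    decide
  have h1 : ∀ A B C D A' B' C' D' : B2, (A + A') + (B + B') + (C + C') + (D + D') =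
      (A + B + C + D) + (A' + B' + C' + D') := by intros; ring
  rw [h1]
  simp only [← Finset.sum_add_distrib, Pi.add_apply, quad, lin, Finset.sum_const_zero, add_zero]

lemma polar_add (θ θ' : Fin b → BlockIQP m) (w : Pairs b m) :
    polar (θ + θ') w = polar θ w + polar θ' w := by
  simp only [polar, ← Finset.sum_add_distrib, Pi.add_apply, Prod.snd_add, add_mul]

lemma polar_eq_zero_iff (w : Pairs b m) :
    (∀ θ : Fin b → BlockIQP m, polar θ w = 0) ↔ BlockDep w := by
  constructor
  · intro h k
    rw [dep_iff_minors]
    intro i j hij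
    have := h (Pi.single k (0, Pi.single ⟨(i, j), hij⟩ 1))
    rw [polar, Finset.sum_eq_single k, Finset.sum_eq_single ⟨(i, j), hij⟩] at this
    · simpa using this
    · intro p _ hp
      simp [hp]
    · simp
    · intro k' _ hk
      simp [hk]
    · simp
  · intro h θ
    refine Finset.sum_eq_zero fun k _ => Finset.sum_eq_zero fun p _ => ?_
    rw [(dep_iff_minors _ _).mp (h k) _ _ p.2, mul_zero]

lemma iqpMat_mulVec (θ : Fin b → BlockIQP m) (ψ : St b m → ℂ) (z : St b m) :
    (iqpMat b m θ *ᵥ ψ) z = sgn (blockPhase b m θ z) * ψ z := by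
  rw [iqpMat, Matrix.mulVec_diagonal]

lemma gowers_iqpMat (θ : Fin b → BlockIQP m) (ψ : St b m → ℂ) (w : Pairs b m) :
    gowers (iqpMat b m θ *ᵥ ψ) w = sgn (polar θ w) * gowers ψ w := by
  rw [gowers, gowers, Finset.mul_sum]
  refine Finset.sum_congr rfl fun z _ => ?_
  simp only [iqpMat_mulVec, ← blockPhase_polar θ z w, sgn_add, map_mul, conj_sgn]
  ring

lemma permMat_mulVec (σ : St b m → St b m) (hσ : Function.Injective σ) (ψ : St b m → ℂ)
    (z : St b m) : (permMat b m σ *ᵥ ψ) (σ z) = ψ z := by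
  simp only [permMat, Matrix.mulVec, dotProduct, Matrix.of_apply]
  rw [Finset.sum_eq_single z]
  · simp
  · intro y _ hy
    rw [if_neg fun h => hy (hσ h).symm, zero_mul]
  · simp

lemma gowers_permMat (σ : St b m → St b m) (hσ : Function.Bijective σ)
    (hadd : ∀ x y, σ (x + y) = σ x + σ y) (ψ : St b m → ℂ) (w : Pairs b m) :
    gowers (permMat b m σ *ᵥ ψ) (σ w.1, σ w.2) = gowers ψ w := by
  rw [gowers, gowers, ← hσ.sum_comp]
  simp only [← hadd, permMat_mulVec σ hσ.1]

open Classical in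
/-- Indicator of blockwise dependence. -/
noncomputable def chi (w : Pairs b m) : ℝ := if BlockDep w then 1 else 0

lemma sum_sgn_polar (w : Pairs b m) :
    ∑ θ : Fin b → BlockIQP m, sgn (polar θ w) =
      Fintype.card (Fin b → BlockIQP m) * (chi w : ℂ) := by
  classical
  rw [sum_sgn_hom (fun θ => polar θ w) fun x y => polar_add x y w, chi]
  simp only [polar_eq_zero_iff]
  split_ifs <;> simp

lemma sum_pairing_iqpMat (F : Pairs b m → ℝ) (ψ : St b m → ℂ) :
    ∑ θ : Fin b → BlockIQP m, pairing F (iqpMat b m θ *ᵥ ψ) =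
      Fintype.card (Fin b → BlockIQP m) * pairing (fun w => chi w * F w) ψ := by
  simp only [pairing]
  rw [Finset.sum_comm, Finset.mul_sum]
  refine Finset.sum_congr rfl fun w _ => ?_
  simp only [gowers_iqpMat]
  rw [← Finset.mul_sum, ← Finset.sum_mul, sum_sgn_polar]
  push_cast
  ring

end Gowers
section CNOT

variable {b m : ℕ} {c : Fin b → Fin b}

lemma cnotPerm_add (c : Fin b → Fin b) (d : Fin b → B2) (x y : St b m) :
    cnotPerm b m c d (x + y) = cnotPerm b m c d x + cnotPerm b m c d y := by
  funext q
  simp only [cnotPerm, Pi.add_apply]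
  split_ifs <;> first | rfl | ring

lemma cnotPerm_fixed (d : Fin b → B2) (x : St b m) {k : Fin b} (h : c k = k) (s : Fin m) :
    cnotPerm b m c d x (k, s) = x (k, s) := by
  simp [cnotPerm, h]

lemma cnotPerm_low (d : Fin b → B2) (x : St b m) {k : Fin b} (h : k < c k) (s : Fin m) :
    cnotPerm b m c d x (k, s) = if d k = 0 then x (k, s) else x (k, s) + x (c k, s) := by
  simp only [cnotPerm, h.ne', min_eq_left h.le, max_eq_right h.le, if_false]
  by_cases hd : d k = 0 <;> simp [hd, h.ne]

lemma cnotPerm_high (d : Fin b → B2) (x : St b m) {k : Fin b} (h : c k < k) (s : Fin m) :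
    cnotPerm b m c d x (k, s) = if d (c k) = 0 then x (k, s) + x (c k, s) else x (k, s) := by
  simp only [cnotPerm, h.ne, min_eq_right h.le, max_eq_left h.le, if_false]
  by_cases hd : d (c k) = 0 <;> simp [hd, h.ne']

/-- The action of a CNOT layer on the two blocks of one edge. -/
lemma cnotPerm_edge (hc : Function.Involutive c) (d : Fin b → B2) (x : St b m) {u : Fin b}
    (hu : u < c u) (s : Fin m) :
    cnotPerm b m c d x (u, s) = (if d u = 0 then x (u, s) else x (u, s) + x (c u, s)) ∧
      cnotPerm b m c d x (c u, s) =
        if d u = 0 then x (c u, s) + x (u, s) else x (c u, s) := by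
  refine ⟨cnotPerm_low d x hu s, ?_⟩
  have := cnotPerm_high (c := c) d x (k := c u) (by rwa [hc u]) s
  rwa [hc u] at this

lemma edge_cases (hc : Function.Involutive c) (k : Fin b) :
    c k = k ∨ ∃ u, u < c u ∧ (k = u ∨ k = c u) := by
  rcases lt_trichotomy k (c k) with h | h | h
  · exact Or.inr ⟨k, h, Or.inl rfl⟩
  · exact Or.inl h.symm
  · exact Or.inr ⟨c k, by rwa [hc k], Or.inr (hc k).symm⟩

lemma cnotPerm_involutive (hc : Function.Involutive c) (d : Fin b → B2) :
    Function.Involutive (cnotPerm b m c d) := by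
  intro x
  funext ⟨k, s⟩
  have h1 : ∀ x y : B2, x + y + y = x := by decide
  rcases edge_cases hc k with h | ⟨u, hu, rfl | rfl⟩
  · simp only [cnotPerm_fixed d _ h]
  all_goals
    simp only [cnotPerm_edge hc d _ hu]
    split_ifs <;> simp only [h1]

lemma cnotPerm_swap (hc : Function.Involutive c) (x : St b m) (k : Fin b) (s : Fin m) :
    cnotPerm b m c 0 (cnotPerm b m c 1 (cnotPerm b m c 0 x)) (k, s) = x (c k, s) := by
  have h1 : ∀ x y : B2, x + (y + x) = y := by decide
  have h3 : ∀ x y : B2, x + y + x = y := by decide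
  rcases edge_cases hc k with h | ⟨u, hu, rfl | rfl⟩
  · simp only [cnotPerm_fixed _ _ h, h]
  · simp [cnotPerm_edge hc _ _ hu, h1]
  · simp [cnotPerm_edge hc _ _ hu, h1, h3, hc u]

variable {u : Fin b}

lemma cnotPerm_cancel (hc : Function.Involutive c) (d d' : Fin b → B2) (hd : ∀ k ≠ u, d k = d' k)
    (x : St b m) {k : Fin b} (hk : k ≠ u) (hk' : k ≠ c u) (s : Fin m) :
    cnotPerm b m c d (cnotPerm b m c d' x) (k, s) = x (k, s) := by
  have h1 : ∀ x y : B2, x + y + y = x := by decide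
  rcases edge_cases hc k with h | ⟨v, hv, rfl | rfl⟩
  · simp only [cnotPerm_fixed _ _ h]
  · simp only [cnotPerm_edge hc _ _ hv, hd _ hk]
    split_ifs <;> simp only [h1]
  · simp only [cnotPerm_edge hc _ _ hv, hd v (fun h => hk' (h ▸ rfl))]
    split_ifs <;> simp only [h1]

/-- Two CNOT layers with opposite directions on the edge of `u` only rotate that edge. -/
lemma cnotPerm_rotate (hc : Function.Involutive c) (hu : u < c u) (x : St b m)
    (k : Fin b) (s : Fin m) :
    cnotPerm b m c 0 (cnotPerm b m c (Pi.single u 1) x) (k, s) =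
      if k = u then x (u, s) + x (c u, s) else if k = c u then x (u, s) else x (k, s) := by
  have h1 : ∀ x y : B2, y + (x + y) = x := by decide
  split_ifs with h h'
  · subst h
    simp [cnotPerm_edge hc _ _ hu]
  · subst h'
    simp [cnotPerm_edge hc _ _ hu, h1]
  · exact cnotPerm_cancel hc _ _ (fun k hk => by simp [hk]) x h h' s

lemma cnotPerm_rotate_inv (hc : Function.Involutive c) (hu : u < c u) (x : St b m)
    (k : Fin b) (s : Fin m) :
    cnotPerm b m c (Pi.single u 1) (cnotPerm b m c 0 x) (k, s) =
      if k = u then x (c u, s) else if k = c u then x (u, s) + x (c u, s) else x (k, s) := by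
  have h1 : ∀ x y : B2, x + (y + x) = y := by decide
  split_ifs with h h'
  · subst h
    simp [cnotPerm_edge hc _ _ hu, h1]
  · subst h'
    simp [cnotPerm_edge hc _ _ hu, add_comm]
  · exact cnotPerm_cancel hc _ _ (fun k hk => by simp [hk]) x h h' s

end CNOT
section Transfer

variable {b m : ℕ}

/-- Action of a CNOT layer on a pair of labels. -/
def cnotPair (c : Fin b → Fin b) (d : Fin b → B2) (w : Pairs b m) : Pairs b m :=
  (cnotPerm b m c d w.1, cnotPerm b m c d w.2)

lemma cnotPair_involutive {c : Fin b → Fin b} (hc : Function.Involutive c) (d : Fin b → B2) :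
    Function.Involutive (cnotPair (m := m) c d) := fun w =>
  Prod.ext (cnotPerm_involutive hc d w.1) (cnotPerm_involutive hc d w.2)

/-- Average of a weight over the random directions of a CNOT layer. -/
noncomputable def cnotAvg (c : Fin b → Fin b) (F : Pairs b m → ℝ) (w : Pairs b m) : ℝ :=
  (∑ d : Fin b → B2, F (cnotPair c d w)) / Fintype.card (Fin b → B2)

/-- Transfer operator of one step. -/
noncomputable def stepOp (c : Fin b → Fin b) (F : Pairs b m → ℝ) : Pairs b m → ℝ :=
  fun w => chi w * cnotAvg c F w

/-- Composition of a list of operators, the head being outermost. -/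
def compList {X : Type*} (l : List (X → X)) (F : X) : X := l.foldr (fun T G => T G) F

/-- `T` is the transfer operator of the random matrix `M`. -/
def Realizes {A : Type*} [Fintype A] (M : A → Matrix (St b m) (St b m) ℂ)
    (T : (Pairs b m → ℝ) → Pairs b m → ℝ) : Prop :=
  ∀ F ψ, ∑ a, pairing F (M a *ᵥ ψ) = Fintype.card A * pairing (T F) ψ

lemma pairing_permMat {c : Fin b → Fin b} (hc : Function.Involutive c) (d : Fin b → B2)
    (F : Pairs b m → ℝ) (ψ : St b m → ℂ) :
    pairing F (permMat b m (cnotPerm b m c d) *ᵥ ψ) = pairing (fun w => F (cnotPair c d w)) ψ := by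
  rw [pairing, pairing, ← (cnotPair_involutive hc d).bijective.sum_comp]
  refine Finset.sum_congr rfl fun w _ => ?_
  rw [cnotPair, gowers_permMat _ (cnotPerm_involutive hc d).bijective (cnotPerm_add c d)]

lemma realizes_stepMat {c : Fin b → Fin b} (hc : Function.Involutive c) :
    Realizes (stepMat b m c) (stepOp c) := by
  intro F ψ
  have hcard : (Fintype.card (Fin b → B2) : ℂ) ≠ 0 := Nat.cast_ne_zero.mpr Fintype.card_ne_zero
  rw [Fintype.sum_prod_type_right]
  simp only [stepMat, ← Matrix.mulVec_mulVec, pairing_permMat hc, sum_pairing_iqpMat]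
  rw [← Finset.mul_sum, Fintype.card_prod, Nat.cast_mul, mul_assoc]
  congr 1
  simp only [pairing]
  rw [Finset.sum_comm, Finset.mul_sum]
  refine Finset.sum_congr rfl fun w _ => ?_
  rw [← Finset.sum_mul, ← mul_assoc]
  congr 1
  simp only [stepOp, cnotAvg]
  push_cast
  rw [← Finset.mul_sum]
  field_simp

lemma seqProd_succ {M : Type*} [Monoid M] {k : ℕ} (f : Fin (k + 1) → M) :
    seqProd f = seqProd (fun i => f i.succ) * f 0 := by
  simp [seqProd, List.finRange_succ, Function.comp_def]

lemma realizes_seqProd {A : Type*} [Fintype A] {k : ℕ}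
    (M : Fin k → A → Matrix (St b m) (St b m) ℂ)
    (T : Fin k → (Pairs b m → ℝ) → Pairs b m → ℝ) (h : ∀ i, Realizes (M i) (T i)) :
    Realizes (fun a : Fin k → A => seqProd fun i => M i (a i)) (compList (List.ofFn T)) := by
  induction k with
  | zero =>
    intro F ψ
    simp [seqProd, compList]
  | succ k ih =>
    intro F ψ
    have ih' := ih (fun i => M i.succ) (fun i => T i.succ) fun i => h i.succ
    rw [← (Fin.consEquiv fun _ => A).sum_comp, Fintype.sum_prod_type]
    have key : ∀ a : A, ∑ a' : Fin k → A, pairing F ((seqProd fun i : Fin (k + 1) =>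
        M i ((Fin.consEquiv fun _ => A) (a, a') i)) *ᵥ ψ) =
        Fintype.card (Fin k → A) *
          pairing (compList (List.ofFn fun i => T i.succ) F) (M 0 a *ᵥ ψ) := by
      intro a
      rw [← ih']
      refine Finset.sum_congr rfl fun a' _ => ?_
      rw [seqProd_succ, Matrix.mulVec_mulVec]
      simp
    simp only [key]
    rw [← Finset.mul_sum, h 0, ← mul_assoc]
    congr 1
    · simp [pow_succ]
    · simp [compList, List.ofFn_succ]

end Transfer

section Score

variable {b m : ℕ}

lemma sum_character (y : St b m) :
    ∑ x : St b m, sgn (∑ i, x i * y i) = if y = 0 then (2 : ℂ) ^ (m * b) else 0 := by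
  classical
  have := sum_sgn_hom (fun x : St b m => ∑ i, x i * y i) fun x x' => by
    simp only [Pi.add_apply, add_mul, Finset.sum_add_distrib]
  rw [this]
  have hiff : (∀ x : St b m, ∑ i, x i * y i = 0) ↔ y = 0 := by
    constructor
    · intro h
      funext i
      simpa [Pi.single_apply] using h (Pi.single i 1)
    · rintro rfl x
      simp
  simp only [hiff]
  congr 1
  simp [ZMod.card, mul_comm]

lemma sqrt_half_pow : ((((Real.sqrt 2)⁻¹ : ℝ) ^ (m * b) : ℝ) : ℂ) ^ 2 = ((2 : ℂ) ^ (m * b))⁻¹ := by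
  rw [← Complex.ofReal_pow, ← pow_mul, mul_comm, pow_mul, inv_pow, Real.sq_sqrt (by norm_num)]
  push_cast
  rw [inv_pow]

lemma Hmat_mulVec (ψ : St b m → ℂ) (x : St b m) :
    (Hmat b m *ᵥ ψ) x =
      ((((Real.sqrt 2)⁻¹ : ℝ) ^ (m * b) : ℝ) : ℂ) * ∑ y, sgn (∑ i, x i * y i) * ψ y := by
  simp [Hmat, Matrix.mulVec, dotProduct, Finset.mul_sum, mul_assoc]

lemma character_sum_pow_four (ψ : St b m → ℂ) (x : St b m) :
    (Complex.normSq (∑ y, sgn (∑ i, x i * y i) * ψ y) : ℂ) ^ 2 =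
      ∑ z, ∑ u, ∑ v, ∑ t, sgn (∑ i, x i * t i) *
        (ψ z * (starRingEnd ℂ) (ψ (z + u)) * (starRingEnd ℂ) (ψ (z + v)) *
          ψ (z + u + v + t)) := by
  have hsq : ∀ a : ℂ, (Complex.normSq a : ℂ) ^ 2 =
      a * ((starRingEnd ℂ) a * ((starRingEnd ℂ) a * a)) := by
    intro a
    rw [← Complex.mul_conj]
    ring
  have hadd : ∀ y y' : St b m, sgn (∑ i, x i * (y + y') i) =
      sgn (∑ i, x i * y i) * sgn (∑ i, x i * y' i) := by
    intro y y'
    rw [← sgn_add, ← Finset.sum_add_distrib]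
    simp only [Pi.add_apply, mul_add]
  have hone : ∀ a : B2, sgn a * sgn a = 1 := by
    intro a
    rw [← sgn_add, CharTwo.add_self_eq_zero, sgn_zero]
  rw [hsq, Finset.sum_mul]
  refine Finset.sum_congr rfl fun z _ => ?_
  rw [map_sum, ← Equiv.sum_comp (Equiv.addLeft z), Finset.sum_mul, Finset.mul_sum]
  refine Finset.sum_congr rfl fun u _ => ?_
  rw [Finset.sum_mul, Finset.mul_sum, Finset.mul_sum]
  refine Finset.sum_congr rfl fun v _ => ?_
  rw [← Equiv.sum_comp (Equiv.addLeft (z + u + v)), Finset.mul_sum, Finset.mul_sum, Finset.mul_sum]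
  refine Finset.sum_congr rfl fun t _ => ?_
  simp only [Equiv.coe_addLeft, hadd, map_mul, conj_sgn]
  linear_combination (sgn (∑ i, x i * t i) * ψ z * (starRingEnd ℂ) (ψ (z + u)) *
    (starRingEnd ℂ) (ψ (z + v)) * ψ (z + u + v + t)) *
    ((hone (∑ i, x i * z i)) * (1 + sgn (∑ i, x i * z i) * sgn (∑ i, x i * z i)) +
     (sgn (∑ i, x i * z i) * sgn (∑ i, x i * z i)) ^ 2 * hone (∑ i, x i * u i) +
     (sgn (∑ i, x i * z i) * sgn (∑ i, x i * z i)) ^ 2 *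
     (sgn (∑ i, x i * u i) * sgn (∑ i, x i * u i)) * hone (∑ i, x i * v i))

lemma fourth_moment (ψ : St b m → ℂ) :
    ∑ x, ((Complex.normSq ((Hmat b m *ᵥ ψ) x)) ^ 2 : ℂ) =
      ((2 : ℂ) ^ (m * b))⁻¹ * pairing (fun _ => 1) ψ := by
  have hs : ∀ a : ℂ, (Complex.normSq (((((Real.sqrt 2)⁻¹ : ℝ) ^ (m * b) : ℝ) : ℂ) * a) : ℂ) ^ 2 =
      ((2 : ℂ) ^ (m * b))⁻¹ * ((2 : ℂ) ^ (m * b))⁻¹ * (Complex.normSq a : ℂ) ^ 2 := by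
    intro a
    rw [map_mul, Complex.normSq_ofReal]
    push_cast [← sqrt_half_pow]
    ring
  have hcollapse : ∀ z u v : St b m, ∑ x : St b m, ∑ t, sgn (∑ i, x i * t i) *
        (ψ z * (starRingEnd ℂ) (ψ (z + u)) * (starRingEnd ℂ) (ψ (z + v)) *
          ψ (z + u + v + t)) = (2 : ℂ) ^ (m * b) *
        (ψ z * (starRingEnd ℂ) (ψ (z + u)) * (starRingEnd ℂ) (ψ (z + v)) * ψ (z + u + v)) := by
    intro z u v
    rw [Finset.sum_comm]
    simp only [← Finset.sum_mul, sum_character, ite_mul, zero_mul]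
    simp
  simp only [Hmat_mulVec, hs, character_sum_pow_four]
  rw [← Finset.mul_sum, mul_assoc]
  congr 1
  rw [inv_mul_eq_iff_eq_mul₀ (pow_ne_zero _ two_ne_zero)]
  simp only [pairing, gowers, Complex.ofReal_one, one_mul]
  rw [Finset.sum_comm, Finset.sum_comm (s := (Finset.univ : Finset (Pairs b m))), Finset.mul_sum]
  refine Finset.sum_congr rfl fun z _ => ?_
  rw [Finset.sum_comm, Fintype.sum_prod_type, Finset.mul_sum]
  refine Finset.sum_congr rfl fun u _ => ?_
  rw [Finset.sum_comm, Finset.mul_sum]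
  exact Finset.sum_congr rfl fun v _ => hcollapse z u v

lemma gowers_plusV (w : Pairs b m) : gowers (plusV b m) w = ((2 : ℂ) ^ (m * b))⁻¹ := by
  have h : (2 : ℂ) ^ (m * b) ≠ 0 := pow_ne_zero _ two_ne_zero
  simp only [gowers, plusV, Complex.conj_ofReal, Finset.sum_const, Finset.card_univ]
  have : ∀ a : ℂ, a * a * a * a = (a ^ 2) ^ 2 := by intro a; ring
  rw [this, sqrt_half_pow]
  simp [ZMod.card]
  rw [mul_comm b m]
  field_simp

/-- The survival weights: transfer operators of the whole circuit applied to `chi`. -/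
noncomputable def survival (r : ℕ) (c : Fin r → Fin b → Fin b) (L : ℕ) : Pairs b m → ℝ :=
  (compList (List.ofFn fun t => stepOp (c t)))^[L] chi

lemma compList_replicate {X : Type*} (T : X → X) (L : ℕ) (F : X) :
    compList (List.replicate L T) F = T^[L] F := by
  induction L with
  | zero => rfl
  | succ L ih =>
    rw [Function.iterate_succ_apply', ← ih]
    rfl

lemma xeb_eq_survival (r : ℕ) (c : Fin r → Fin b → Fin b)
    (hinv : ∀ t, Function.Involutive (c t)) (L : ℕ) :
    xeb b m r c L = (∑ w : Pairs b m, survival r c L w) / 2 ^ (m * b) - 1 := by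
  have hlayer := realizes_seqProd (fun t => stepMat b m (c t)) (fun t => stepOp (c t))
    fun t => realizes_stepMat (hinv t)
  have hcirc := realizes_seqProd (k := L) (fun _ (a : Fin r → StepP b m) =>
    seqProd fun t => stepMat b m (c t) (a t)) _ fun _ => hlayer
  have htotal : ∑ θ : ParamT b m r L, pairing (fun _ => 1) (circuitMat b m r L c θ *ᵥ plusV b m) =
      Fintype.card (ParamT b m r L) * pairing (survival r c L) (plusV b m) := by
    rw [Fintype.sum_prod_type]
    simp only [circuitMat, ← Matrix.mulVec_mulVec, sum_pairing_iqpMat, mul_one]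
    rw [← Finset.mul_sum, hcirc, List.ofFn_const, compList_replicate, Fintype.card_prod]
    push_cast
    rw [survival]
    ring
  have h2 : (2 : ℂ) ^ (m * b) ≠ 0 := pow_ne_zero _ two_ne_zero
  have hcard : (Fintype.card (ParamT b m r L) : ℂ) ≠ 0 :=
    Nat.cast_ne_zero.mpr Fintype.card_ne_zero
  rw [xeb]
  congr 1
  apply Complex.ofReal_injective
  push_cast
  simp only [← Matrix.mulVec_mulVec, fourth_moment]
  rw [← Finset.mul_sum, htotal]
  simp only [pairing, gowers_plusV]
  rw [← Finset.sum_mul]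
  simp only [Fintype.card_prod, Nat.cast_mul] at hcard ⊢
  field_simp

end Score
section Dynamics

variable {b m : ℕ}

lemma chi_nonneg (w : Pairs b m) : 0 ≤ chi w := by
  rw [chi]; split_ifs <;> norm_num

lemma chi_le_one (w : Pairs b m) : chi w ≤ 1 := by
  rw [chi]; split_ifs <;> norm_num

lemma card_directions_pos : (0 : ℝ) < Fintype.card (Fin b → B2) :=
  Nat.cast_pos.mpr Fintype.card_pos

lemma stepOp_mono (c : Fin b → Fin b) : Monotone (stepOp (m := m) c) := fun _ _ h w =>
  mul_le_mul_of_nonneg_left (div_le_div_of_nonneg_right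
    (Finset.sum_le_sum fun _ _ => h _) card_directions_pos.le) (chi_nonneg w)

lemma stepOp_nonneg (c : Fin b → Fin b) {F : Pairs b m → ℝ} (h : 0 ≤ F) : 0 ≤ stepOp c F :=
  fun w => mul_nonneg (chi_nonneg w)
    (div_nonneg (Finset.sum_nonneg fun _ _ => h _) card_directions_pos.le)

lemma stepOp_le_chi (c : Fin b → Fin b) {F : Pairs b m → ℝ} (h : F ≤ chi) :
    stepOp c F ≤ chi := by
  intro w
  refine mul_le_of_le_one_right (chi_nonneg w) ((div_le_one card_directions_pos).mpr ?_)
  calc ∑ d : Fin b → B2, F (cnotPair c d w) ≤ ∑ d : Fin b → B2, (1 : ℝ) :=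
        Finset.sum_le_sum fun d _ => (h _).trans (chi_le_one _)
    _ = _ := by simp

lemma stepOp_continuous (c : Fin b → Fin b) : Continuous (stepOp (m := m) c) := by
  unfold stepOp cnotAvg
  fun_prop

lemma compList_induction {X : Type*} {P : X → Prop} {l : List (X → X)}
    (hl : ∀ T ∈ l, ∀ F, P F → P (T F)) {F : X} (hF : P F) : P (compList l F) := by
  induction l with
  | nil => exact hF
  | cons T l ih =>
    exact hl T List.mem_cons_self _ (ih fun T hT => hl T (List.mem_cons_of_mem _ hT))

lemma compList_mono {X : Type*} [Preorder X] {l : List (X → X)} (hl : ∀ T ∈ l, Monotone T) :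
    Monotone (compList l) := by
  induction l with
  | nil => exact monotone_id
  | cons T l ih =>
    exact (hl T List.mem_cons_self).comp (ih fun T hT => hl T (List.mem_cons_of_mem _ hT))

lemma compList_continuous {X : Type*} [TopologicalSpace X] {l : List (X → X)}
    (hl : ∀ T ∈ l, Continuous T) : Continuous (compList l) := by
  induction l with
  | nil => exact continuous_id
  | cons T l ih =>
    exact (hl T List.mem_cons_self).comp (ih fun T hT => hl T (List.mem_cons_of_mem _ hT))

/-- Transfer operator of a hyperlayer. -/
noncomputable def layerOp (r : ℕ) (c : Fin r → Fin b → Fin b) :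
    (Pairs b m → ℝ) → Pairs b m → ℝ :=
  compList (List.ofFn fun t => stepOp (c t))

lemma exists_survival_limit (r : ℕ) (c : Fin r → Fin b → Fin b) :
    ∃ f : Pairs b m → ℝ, Filter.Tendsto (survival r c) Filter.atTop (nhds f) ∧
      layerOp r c f = f ∧ 0 ≤ f ∧ f ≤ chi := by
  have hmono : Monotone (layerOp (m := m) r c) := compList_mono fun T hT => by
    obtain ⟨t, rfl⟩ := List.mem_ofFn.mp hT
    exact stepOp_mono _
  have hcont : Continuous (layerOp (m := m) r c) := compList_continuous fun T hT => by
    obtain ⟨t, rfl⟩ := List.mem_ofFn.mp hT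
    exact stepOp_continuous _
  have hle : layerOp (m := m) r c chi ≤ chi :=
    compList_induction (P := fun F => F ≤ chi) (fun T hT F hF => by
      obtain ⟨t, rfl⟩ := List.mem_ofFn.mp hT
      exact stepOp_le_chi _ hF) le_rfl
  have hnonneg : ∀ F : Pairs b m → ℝ, 0 ≤ F → 0 ≤ layerOp r c F := fun F hF =>
    compList_induction (P := fun F => 0 ≤ F) (fun T hT F hF => by
      obtain ⟨t, rfl⟩ := List.mem_ofFn.mp hT
      exact stepOp_nonneg _ hF) hF
  have hanti : Antitone (survival (m := m) r c) := hmono.antitone_iterate_of_map_le hle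
  have hpos : ∀ L, 0 ≤ survival (m := m) r c L := by
    intro L
    induction L with
    | zero => exact chi_nonneg
    | succ L ih =>
      rw [survival, Function.iterate_succ_apply']
      exact hnonneg _ ih
  have hlim : Filter.Tendsto (survival (m := m) r c) Filter.atTop
      (nhds fun w => ⨅ L, survival r c L w) :=
    tendsto_pi_nhds.mpr fun w => tendsto_atTop_ciInf (fun _ _ h => hanti h w)
      ⟨0, by rintro _ ⟨L, rfl⟩; exact hpos L w⟩
  refine ⟨_, hlim, ?_, ge_of_tendsto' hlim hpos, le_of_tendsto' hlim fun L => hanti (Nat.zero_le L)⟩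
  refine tendsto_nhds_unique ((hcont.tendsto _).comp hlim)
    ((hlim.comp (Filter.tendsto_add_atTop_nat 1)).congr fun L => ?_)
  exact Function.iterate_succ_apply' _ _ _

/-- Squared norm of a weight. -/
noncomputable def energy (F : Pairs b m → ℝ) : ℝ := ∑ w, F w ^ 2

lemma energy_defect {c : Fin b → Fin b} (hc : Function.Involutive c) (F : Pairs b m → ℝ) :
    ∑ d : Fin b → B2, ∑ w, (F (cnotPair c d w) - stepOp c F w) ^ 2 =
      Fintype.card (Fin b → B2) * (energy F - energy (stepOp c F)) := by
  have hinv : ∀ d, ∑ w, F (cnotPair c d w) ^ 2 = energy F := fun d =>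
    (cnotPair_involutive hc d).bijective.sum_comp fun w => F w ^ 2
  have hcross : ∀ w, (∑ d : Fin b → B2, F (cnotPair c d w)) * stepOp c F w =
      Fintype.card (Fin b → B2) * stepOp c F w ^ 2 := by
    intro w
    have hchi : chi w * chi w = chi w := by rw [chi]; split_ifs <;> norm_num
    have hsum : ∑ d : Fin b → B2, F (cnotPair c d w) =
        Fintype.card (Fin b → B2) * cnotAvg c F w := by
      rw [cnotAvg, mul_div_cancel₀ _ card_directions_pos.ne']
    rw [hsum, stepOp]
    linear_combination (-Fintype.card (Fin b → B2) * cnotAvg c F w ^ 2) * hchi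
  have hexp : ∑ d : Fin b → B2, ∑ w, (F (cnotPair c d w) - stepOp c F w) ^ 2 =
      ∑ d : Fin b → B2, ∑ w, F (cnotPair c d w) ^ 2 -
        2 * ∑ w, (∑ d : Fin b → B2, F (cnotPair c d w)) * stepOp c F w +
        ∑ d : Fin b → B2, energy (stepOp c F) := by
    simp only [Finset.sum_mul, energy]
    rw [Finset.sum_comm (s := (Finset.univ : Finset (Pairs b m))), Finset.mul_sum,
      ← Finset.sum_sub_distrib, ← Finset.sum_add_distrib]
    refine Finset.sum_congr rfl fun d _ => ?_
    rw [Finset.mul_sum, ← Finset.sum_sub_distrib, ← Finset.sum_add_distrib]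
    exact Finset.sum_congr rfl fun w _ => by ring
  rw [hexp]
  simp only [hinv, hcross, ← Finset.mul_sum, Finset.sum_const, Finset.card_univ, nsmul_eq_mul]
  rw [energy, energy]
  ring

lemma energy_stepOp_le {c : Fin b → Fin b} (hc : Function.Involutive c) (F : Pairs b m → ℝ) :
    energy (stepOp c F) ≤ energy F := by
  have h : 0 ≤ ∑ d : Fin b → B2, ∑ w, (F (cnotPair c d w) - stepOp c F w) ^ 2 :=
    Finset.sum_nonneg fun d _ => Finset.sum_nonneg fun w _ => sq_nonneg _
  rw [energy_defect hc] at h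
  exact sub_nonneg.mp (nonneg_of_mul_nonneg_right h card_directions_pos)

lemma eq_of_energy_eq {c : Fin b → Fin b} (hc : Function.Involutive c) {F : Pairs b m → ℝ}
    (h : energy (stepOp c F) = energy F) (d : Fin b → B2) (w : Pairs b m) :
    F (cnotPair c d w) = stepOp c F w := by
  have h0 := energy_defect hc F
  rw [h, sub_self, mul_zero, Finset.sum_eq_zero_iff_of_nonneg
    fun d _ => Finset.sum_nonneg fun w _ => sq_nonneg _] at h0
  have h1 := h0 d (Finset.mem_univ _)
  rw [Finset.sum_eq_zero_iff_of_nonneg fun w _ => sq_nonneg _] at h1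
  exact sub_eq_zero.mp (pow_eq_zero_iff two_ne_zero |>.mp (h1 w (Finset.mem_univ _)))

/-- A weight fixed by a hyperlayer is transported exactly by every choice of directions. -/
lemma exists_transport {r : ℕ} {c : Fin r → Fin b → Fin b}
    (hinv : ∀ t, Function.Involutive (c t)) {f : Pairs b m → ℝ} (hf : layerOp r c f = f) :
    ∃ G : ℕ → Pairs b m → ℝ, G 0 = f ∧ G r = f ∧
      ∀ (t : Fin r) (d : Fin b → B2) (w : Pairs b m),
        G (t + 1) (cnotPair (c t) d w) = G t w := by
  set l := List.ofFn fun t => stepOp (m := m) (c t) with hl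
  have hlen : l.length = r := List.length_ofFn
  let G : ℕ → Pairs b m → ℝ := fun t => compList (l.drop t) f
  have h0 : G 0 = f := hf
  have hr : ∀ t, r ≤ t → G t = f := by
    intro t ht
    simp only [G]
    rw [List.drop_eq_nil_of_le (by omega)]
    rfl
  have hstep : ∀ t : Fin r, G t = stepOp (c t) (G (t + 1)) := by
    intro t
    have ht : (t : ℕ) < l.length := by omega
    simp only [G]
    rw [List.drop_eq_getElem_cons ht]
    simp [compList, hl]
  have hmono : Monotone fun t => energy (G t) := by
    refine monotone_nat_of_le_succ fun t => ?_
    by_cases ht : t < r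
    · rw [hstep ⟨t, ht⟩]
      exact energy_stepOp_le (hinv _) _
    · rw [hr t (by omega), hr (t + 1) (by omega)]
  refine ⟨G, h0, hr r le_rfl, fun t d w => ?_⟩
  have heq : energy (stepOp (c t) (G (t + 1))) = energy (G (t + 1)) := by
    rw [← hstep]
    refine le_antisymm (hmono (Nat.le_succ _)) ?_
    calc energy (G (t + 1)) ≤ energy (G r) := hmono (by omega)
      _ = energy (G 0) := by rw [h0, hr r le_rfl]
      _ ≤ energy (G t) := hmono (Nat.zero_le _)
  rw [eq_of_energy_eq (hinv t) heq, ← hstep]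

end Dynamics
section BlockSums

variable {b m : ℕ}

/-- Sum of the blocks in `S`. -/
def blockSum (S : Finset (Fin b)) (x : St b m) : Fin m → B2 := fun s => ∑ k ∈ S, x (k, s)

lemma blockSum_singleton (k : Fin b) (x : St b m) : blockSum {k} x = fun s => x (k, s) :=
  funext fun _ => Finset.sum_singleton _ _

lemma blockSum_pair {k l : Fin b} (h : k ≠ l) (x : St b m) :
    blockSum {k, l} x = (fun s => x (k, s)) + fun s => x (l, s) :=
  funext fun _ => Finset.sum_pair h

/-- Every pair of labels in the support of `G` has dependent block sums over `S`. -/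
def DepOn (G : Pairs b m → ℝ) (S : Finset (Fin b)) : Prop :=
  ∀ w, G w ≠ 0 → Dep (blockSum S w.1) (blockSum S w.2)

lemma depOn_congr {G G' : Pairs b m → ℝ} {S S' : Finset (Fin b)} {φ : Pairs b m → Pairs b m}
    (hφ : Function.Surjective φ) (hG : ∀ w, G' (φ w) = G w)
    (hS : ∀ w, blockSum S (φ w).1 = blockSum S' w.1 ∧ blockSum S (φ w).2 = blockSum S' w.2) :
    DepOn G' S ↔ DepOn G S' := by
  rw [DepOn, hφ.forall]
  simp only [hG, hS]
  rfl

section Step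

variable {G G' : Pairs b m → ℝ} {c : Fin b → Fin b}

lemma depOn_step_of_closed (hc : Function.Involutive c)
    (h : ∀ d w, G' (cnotPair c d w) = G w) {S : Finset (Fin b)} (hS : ∀ k ∈ S, c k ∈ S) :
    DepOn G' S ↔ DepOn G S := by
  have hsurj := fun d => (cnotPair_involutive (m := m) hc d).surjective
  have hsum : ∀ x : St b m, blockSum S
      (cnotPerm b m c 0 (cnotPerm b m c 1 (cnotPerm b m c 0 x))) = blockSum S x := by
    intro x
    funext s
    simp only [blockSum, cnotPerm_swap hc]
    refine Finset.sum_equiv hc.toPerm (fun k => ⟨hS k, fun hk => ?_⟩) fun _ _ => rfl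
    have := hS _ hk
    rwa [Function.Involutive.coe_toPerm, hc k] at this
  refine depOn_congr (φ := fun w => cnotPair c 0 (cnotPair c 1 (cnotPair c 0 w)))
    ((hsurj 0).comp ((hsurj 1).comp (hsurj 0))) (fun w => ?_) fun w => ⟨hsum w.1, hsum w.2⟩
  rw [h, ← h 1, cnotPair_involutive hc, h]

lemma depOn_insert (hc : Function.Involutive c) (h : ∀ d w, G' (cnotPair c d w) = G w)
    {S : Finset (Fin b)} {u : Fin b} (hu : u ∈ S) (hu' : c u ∉ S) :
    DepOn G S ↔ DepOn G (insert (c u) S) := by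
  have hsurj := fun d => (cnotPair_involutive (m := m) hc d).surjective
  have hG : ∀ d d' w, G (cnotPair c d (cnotPair c d' w)) = G w := by
    intro d d' w
    rw [← h d, cnotPair_involutive hc, h]
  have hne : u ≠ c u := fun he => hu' (he ▸ hu)
  have key : ∀ (x y : St b m) (s : Fin m), y (u, s) = x (u, s) + x (c u, s) →
      (∀ k, k ≠ u → k ≠ c u → y (k, s) = x (k, s)) →
      ∑ k ∈ S, y (k, s) = ∑ k ∈ insert (c u) S, x (k, s) := by
    intro x y s h1 h2
    rw [Finset.sum_insert hu', ← Finset.add_sum_erase S _ hu, ← Finset.add_sum_erase S _ hu, h1,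
      Finset.sum_congr rfl fun k hk => h2 k (Finset.ne_of_mem_erase hk)
        fun he => hu' (he ▸ Finset.mem_of_mem_erase hk)]
    ring
  rcases lt_or_gt_of_ne hne with hlt | hlt
  · have hsum : ∀ x : St b m, blockSum S (cnotPerm b m c 0 (cnotPerm b m c (Pi.single u 1) x)) =
        blockSum (insert (c u) S) x := fun x => funext fun s => key x _ s
      (by simp [cnotPerm_rotate hc hlt]) fun k hk hk' => by simp [cnotPerm_rotate hc hlt, hk, hk']
    exact depOn_congr ((hsurj 0).comp (hsurj (Pi.single u 1))) (hG _ _)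
      fun w => ⟨hsum w.1, hsum w.2⟩
  · have hlt' : c u < c (c u) := by rwa [hc u]
    have hsum : ∀ x : St b m,
        blockSum S (cnotPerm b m c (Pi.single (c u) 1) (cnotPerm b m c 0 x)) =
        blockSum (insert (c u) S) x := fun x => funext fun s => key x _ s
      (by simp [cnotPerm_rotate_inv hc hlt', hc u, hne, add_comm])
      fun k hk hk' => by simp [cnotPerm_rotate_inv hc hlt', hc u, hk, hk']
    exact depOn_congr ((hsurj (Pi.single (c u) 1)).comp (hsurj 0)) (hG _ _)
      fun w => ⟨hsum w.1, hsum w.2⟩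

end Step

lemma exists_leaving_edge {r : ℕ} {c : Fin r → Fin b → Fin b}
    (hinv : ∀ t, Function.Involutive (c t))
    (hconn : (SimpleGraph.fromRel fun u v : Fin b => ∃ t, c t u = v).Connected)
    {S : Finset (Fin b)} (hS : S.Nonempty) (hS' : S ≠ Finset.univ) :
    ∃ t, ∃ u ∈ S, c t u ∉ S := by
  by_contra! hcl
  obtain ⟨u, hu⟩ := hS
  refine hS' (Finset.eq_univ_iff_forall.mpr fun v => ?_)
  obtain ⟨p⟩ := hconn.preconnected u v
  induction p with
  | nil => exact hu
  | cons hadj _ ih =>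
    refine ih ?_
    rw [SimpleGraph.fromRel_adj] at hadj
    obtain ⟨-, ⟨t, rfl⟩ | ⟨t, ht⟩⟩ := hadj
    · exact hcl t _ hu
    · rw [← ht] at hu
      have := hcl t _ hu
      rwa [hinv t] at this

lemma depOn_iff_univ {r : ℕ} {c : Fin r → Fin b → Fin b}
    (hinv : ∀ t, Function.Involutive (c t))
    (hconn : (SimpleGraph.fromRel fun u v : Fin b => ∃ t, c t u = v).Connected)
    {G : ℕ → Pairs b m → ℝ} (hG0 : G r = G 0)
    (hG : ∀ (t : Fin r) (d : Fin b → B2) (w : Pairs b m),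
      G (t + 1) (cnotPair (c t) d w) = G t w)
    {S : Finset (Fin b)} (hS : S.Nonempty) {t : ℕ} (ht : t ≤ r) :
    DepOn (G t) S ↔ DepOn (G 0) Finset.univ := by
  induction hn : Sᶜ.card using Nat.strong_induction_on generalizing S t with
  | _ n ih =>
  by_cases hU : S = Finset.univ
  · subst hU
    induction t with
    | zero => rfl
    | succ t iht =>
      rw [depOn_step_of_closed (hinv ⟨t, ht⟩) (hG ⟨t, ht⟩) fun k _ => Finset.mem_univ _]
      exact iht (by omega)
  have hleave : ∀ s : Fin r, (∃ u ∈ S, c s u ∉ S) →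
      (DepOn (G s) S ↔ DepOn (G 0) Finset.univ) := by
    rintro s ⟨u, hu, hu'⟩
    rw [depOn_insert (hinv s) (hG s) hu hu']
    refine ih _ ?_ (Finset.insert_nonempty _ _) s.2.le rfl
    rw [← hn]
    refine Finset.card_lt_card (Finset.compl_ssubset_compl.mpr (Finset.ssubset_insert hu'))
  have hback : ∀ s s' : ℕ, s ≤ s' → s' ≤ r → (DepOn (G s') S ↔ DepOn (G 0) Finset.univ) →
      (DepOn (G s) S ↔ DepOn (G 0) Finset.univ) := by
    intro s s' hle
    induction s', hle using Nat.le_induction with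
    | base => exact fun _ h => h
    | succ s' _ ih' =>
      intro hr h
      refine ih' (by omega) ?_
      by_cases hcl : ∃ u ∈ S, c ⟨s', hr⟩ u ∉ S
      · exact hleave ⟨s', hr⟩ hcl
      · push Not at hcl
        rwa [← depOn_step_of_closed (hinv ⟨s', hr⟩) (hG ⟨s', hr⟩) hcl]
  obtain ⟨s, hs⟩ := exists_leaving_edge hinv hconn hS hU
  have h0 := hback 0 s (Nat.zero_le _) s.2.le (hleave s hs)
  exact hback t r ht le_rfl (hG0 ▸ h0)

end BlockSums

section Classification

variable {b m : ℕ}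

/-- The label `α ⊗ p`. -/
def tensor (α : Fin b → B2) (p : Fin m → B2) : St b m := fun q => α q.1 * p q.2

/-- Pairs of labels that survive every circuit. -/
def Good (w : Pairs b m) : Prop :=
  Dep w.1 w.2 ∨ ∃ p α β, w = (tensor α p, tensor β p)

lemma eq_of_dep_of_ne {A : Type*} [AddCommGroup A] [Module B2 A] {p p' : A} (hp : p ≠ 0)
    (hp' : p' ≠ 0) {α β α' β' : B2} (h : (α, β) ≠ 0) (h' : (α', β') ≠ 0)
    (hne : (α, β) ≠ (α', β')) (hd : Dep (α • p + α' • p') (β • p + β' • p')) : p = p' := by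
  have hneg : ∀ x y : A, x + y = 0 → x = y := by
    intro x y hxy
    have hyy : y + y = 0 := by rw [← two_smul B2 y, show (2 : B2) = 0 from rfl, zero_smul]
    rw [eq_neg_of_add_eq_zero_left hxy, neg_eq_of_add_eq_zero_left hyy]
  rcases b2_cases α with rfl | rfl <;> rcases b2_cases β with rfl | rfl <;>
    rcases b2_cases α' with rfl | rfl <;> rcases b2_cases β' with rfl | rfl <;>
    simp [Dep, hp, hp'] at h h' hne hd <;>
    first
    | exact hd
    | exact hd.symm
    | exact hneg _ _ hd

lemma dep_row {A : Type*} [AddCommGroup A] [Module B2 A] {x y : A} (h : Dep x y) :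
    ∃ (p : A) (α β : B2), x = α • p ∧ y = β • p ∧ ((α, β) ≠ 0 → p ≠ 0) := by
  by_cases hx : x = 0
  · by_cases hy : y = 0
    · exact ⟨0, 0, 0, by simp [hx], by simp [hy], by simp⟩
    · exact ⟨y, 0, 1, by simp [hx], by simp, fun _ => hy⟩
  · rcases h with h | h | h
    · exact absurd h hx
    · exact ⟨x, 1, 0, by simp, by simp [h], fun _ => hx⟩
    · exact ⟨x, 1, 1, by simp, by simp [h], fun _ => hx⟩

lemma good_of_dep_blockSum {w : Pairs b m}
    (h : ∀ S : Finset (Fin b), S.Nonempty → Dep (blockSum S w.1) (blockSum S w.2)) : Good w := by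
  by_cases hdep : Dep w.1 w.2
  · exact Or.inl hdep
  have hrow : ∀ k, Dep (fun s => w.1 (k, s)) (fun s => w.2 (k, s)) := by
    intro k
    have := h {k} (Finset.singleton_nonempty k)
    rwa [blockSum_singleton, blockSum_singleton] at this
  choose p α β h1 h2 hp using fun k => dep_row (hrow k)
  have hw1 : ∀ k s, w.1 (k, s) = α k * p k s := fun k s => congrFun (h1 k) s
  have hw2 : ∀ k s, w.2 (k, s) = β k * p k s := fun k s => congrFun (h2 k) s
  have hpair : ∀ k l, (α k, β k) ≠ 0 → (α l, β l) ≠ 0 → (α k, β k) ≠ (α l, β l) →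
      p k = p l := by
    intro k l hk hl hkl
    have hne : k ≠ l := by rintro rfl; exact hkl rfl
    refine eq_of_dep_of_ne (hp k hk) (hp l hl) hk hl hkl ?_
    rw [← h1, ← h1, ← h2, ← h2]
    have := h {k, l} (Finset.insert_nonempty _ _)
    rwa [blockSum_pair hne, blockSum_pair hne] at this
  obtain ⟨k, l, hk, hl, hkl⟩ : ∃ k l, (α k, β k) ≠ 0 ∧ (α l, β l) ≠ 0 ∧
      (α k, β k) ≠ (α l, β l) := by
    simp only [Dep, not_or] at hdep
    obtain ⟨hx, hy, hxy⟩ := hdep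
    have e1 : ∃ k, α k ≠ 0 := by
      by_contra! h0
      exact hx (funext fun q => by simp [hw1 q.1 q.2, h0])
    have e2 : ∃ k, β k ≠ 0 := by
      by_contra! h0
      exact hy (funext fun q => by simp [hw2 q.1 q.2, h0])
    have e3 : ∃ k, α k ≠ β k := by
      by_contra! h0
      exact hxy (funext fun q => by rw [hw1 q.1 q.2, hw2 q.1 q.2, h0])
    obtain ⟨k1, hk1⟩ := e1
    obtain ⟨k2, hk2⟩ := e2
    obtain ⟨k3, hk3⟩ := e3
    by_cases hβ : β k1 = 0
    · refine ⟨k1, k2, by simp [hk1], by simp [hk2], ?_⟩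
      intro he
      exact hk2 ((Prod.mk.inj he).2 ▸ hβ)
    · refine ⟨k1, k3, by simp [hk1], ?_, ?_⟩
      · intro he
        obtain ⟨ha, hb⟩ := Prod.mk.inj he
        exact hk3 (ha.trans hb.symm)
      · intro he
        obtain ⟨ha, hb⟩ := Prod.mk.inj he
        rw [← ha, ← hb, (b2_cases _).resolve_left hk1, (b2_cases _).resolve_left hβ] at hk3
        exact hk3 rfl
  have hall : ∀ j, (α j, β j) = 0 ∨ p j = p k := by
    intro j
    by_cases hj : (α j, β j) = 0
    · exact Or.inl hj
    by_cases hjk : (α j, β j) = (α k, β k)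
    · rw [hpair k l hk hl hkl]
      exact Or.inr (hpair j l hj hl (hjk ▸ hkl))
    · exact Or.inr (hpair j k hj hk hjk)
  refine Or.inr ⟨p k, α, β, Prod.ext (funext fun q => ?_) (funext fun q => ?_)⟩
  · rcases hall q.1 with h0 | h0
    · simp [tensor, hw1 q.1 q.2, (Prod.mk.inj h0).1]
    · simp [tensor, hw1 q.1 q.2, h0]
  · rcases hall q.1 with h0 | h0
    · simp [tensor, hw2 q.1 q.2, (Prod.mk.inj h0).2]
    · simp [tensor, hw2 q.1 q.2, h0]

lemma cnotPerm_zero (c : Fin b → Fin b) (d : Fin b → B2) : cnotPerm b m c d 0 = 0 := by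
  have := cnotPerm_add (m := m) c d 0 0
  rwa [add_zero, left_eq_add] at this

lemma cnotPerm_tensor (c : Fin b → Fin b) (d : Fin b → B2) (α : Fin b → B2) (p : Fin m → B2) :
    ∃ α', cnotPerm b m c d (tensor α p) = tensor α' p := by
  refine ⟨fun k => cnotPerm b 1 c d (fun q => α q.1) (k, 0), funext fun q => ?_⟩
  simp only [cnotPerm, tensor]
  split_ifs <;> first | rfl | ring

lemma Good.cnotPair {w : Pairs b m} (h : Good w) (c : Fin b → Fin b) (d : Fin b → B2) :
    Good (cnotPair c d w) := by
  rcases h with h | ⟨p, α, β, rfl⟩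
  · left
    rcases h with h | h | h
    · exact Or.inl (by rw [Stmt8.cnotPair, h, cnotPerm_zero])
    · exact Or.inr (Or.inl (by rw [Stmt8.cnotPair, h, cnotPerm_zero]))
    · exact Or.inr (Or.inr (by rw [Stmt8.cnotPair, h]))
  · obtain ⟨α', hα⟩ := cnotPerm_tensor c d α p
    obtain ⟨β', hβ⟩ := cnotPerm_tensor c d β p
    exact Or.inr ⟨p, α', β', Prod.ext hα hβ⟩

lemma Good.blockDep {w : Pairs b m} (h : Good w) : BlockDep w := by
  intro k
  rcases h with h | ⟨p, α, β, rfl⟩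
  · rcases h with h | h | h
    · exact Or.inl (by rw [h]; rfl)
    · exact Or.inr (Or.inl (by rw [h]; rfl))
    · exact Or.inr (Or.inr (by rw [h]))
  · simp only [tensor]
    rcases b2_cases (α k) with ha | ha
    · exact Or.inl (by simp only [ha, zero_mul]; rfl)
    rcases b2_cases (β k) with hb | hb
    · exact Or.inr (Or.inl (by simp only [hb, zero_mul]; rfl))
    · exact Or.inr (Or.inr (by rw [ha, hb]))

lemma chi_eq_one {w : Pairs b m} (h : Good w) : chi w = 1 := if_pos h.blockDep

lemma survival_eq_one (r : ℕ) (c : Fin r → Fin b → Fin b) (L : ℕ) {w : Pairs b m} (hw : Good w) :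
    survival r c L w = 1 := by
  suffices H : ∀ w, Good w → survival r c L w = 1 from H w hw
  induction L with
  | zero => exact fun w hw => chi_eq_one hw
  | succ L ih =>
    rw [survival, Function.iterate_succ_apply']
    refine compList_induction (P := fun F : Pairs b m → ℝ => ∀ w, Good w → F w = 1) (fun T hT F hF w hw => ?_) ih
    obtain ⟨t, rfl⟩ := List.mem_ofFn.mp hT
    simp only [stepOp, cnotAvg, chi_eq_one hw, hF _ (hw.cnotPair _ _)]
    simp

open Classical in
lemma survival_tendsto (r : ℕ) (c : Fin r → Fin b → Fin b)
    (hinv : ∀ t, Function.Involutive (c t))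
    (hconn : (SimpleGraph.fromRel fun u v : Fin b => ∃ t, c t u = v).Connected)
    (w : Pairs b m) :
    Filter.Tendsto (fun L => survival r c L w) Filter.atTop (nhds (if Good w then 1 else 0)) := by
  obtain ⟨f, hlim, hfix, h0, hchi⟩ := exists_survival_limit (m := m) r c
  obtain ⟨G, hG0, hGr, hG⟩ := exists_transport hinv hfix
  have hDep : ∀ S : Finset (Fin b), S.Nonempty → DepOn f S := by
    have hiff := fun {S : Finset (Fin b)} (hS : S.Nonempty) =>
      depOn_iff_univ hinv hconn (hGr.trans hG0.symm) hG hS (Nat.zero_le r)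
    rw [hG0] at hiff
    obtain ⟨k⟩ := hconn.nonempty
    intro S hS
    rw [hiff hS, ← hiff (Finset.singleton_nonempty k)]
    intro w hw
    have hb : BlockDep w := by
      by_contra hb
      have h1 := hchi w
      rw [chi, if_neg hb] at h1
      exact hw (le_antisymm h1 (h0 w))
    rw [blockSum_singleton, blockSum_singleton]
    exact hb k
  have hw := tendsto_pi_nhds.mp hlim w
  split_ifs with hg
  · exact tendsto_const_nhds.congr fun L => (survival_eq_one r c L hg).symm
  · have : f w = 0 := by
      by_contra hf
      exact hg (good_of_dep_blockSum fun S hS => hDep S hS w hf)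
    rwa [this] at hw

end Classification

section Counting

variable {b m : ℕ}

open Classical in
lemma card_not_dep (A : Type*) [Zero A] [Fintype A] :
    ((Finset.univ.filter fun x : A × A => ¬ Dep x.1 x.2).card : ℝ) =
      ((Fintype.card A : ℝ) - 1) * ((Fintype.card A : ℝ) - 2) := by
  have h : (Finset.univ.filter fun x : A × A => ¬ Dep x.1 x.2) =
      (Finset.univ.erase (0 : A)).offDiag := by
    ext x
    simp [Dep, not_or]
  have hc : 1 ≤ Fintype.card A := Fintype.card_pos
  rw [h, Finset.offDiag_card, Finset.card_erase_of_mem (Finset.mem_univ _), Finset.card_univ,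
    Nat.cast_sub (Nat.le_mul_self _)]
  push_cast [hc]
  ring

lemma tensor_eq_zero_iff {α : Fin b → B2} {p : Fin m → B2} :
    tensor α p = 0 ↔ α = 0 ∨ p = 0 := by
  constructor
  · intro h
    by_contra! hne
    obtain ⟨k, hk⟩ := Function.ne_iff.mp hne.1
    obtain ⟨s, hs⟩ := Function.ne_iff.mp hne.2
    exact mul_ne_zero hk hs (congrFun h (k, s))
  · rintro (rfl | rfl) <;> funext q <;> simp [tensor]

lemma tensor_left_injective {p : Fin m → B2} (hp : p ≠ 0) :
    Function.Injective fun α : Fin b → B2 => tensor α p := by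
  intro α β h
  obtain ⟨s, hs⟩ := Function.ne_iff.mp hp
  funext k
  exact mul_right_cancel₀ hs (congrFun h (k, s))

lemma tensor_right_eq {α β : Fin b → B2} {p q : Fin m → B2} (hα : α ≠ 0) (hp : p ≠ 0)
    (h : tensor α p = tensor β q) : p = q := by
  obtain ⟨k, hk⟩ := Function.ne_iff.mp hα
  have hp' : ∀ s, p s = β k * q s := fun s => by
    have := congrFun h (k, s)
    rwa [tensor, tensor, (b2_cases (α k)).resolve_left hk, one_mul] at this
  rcases b2_cases (β k) with h0 | h1
  · exact absurd (funext fun s => by rw [hp', h0, zero_mul]; rfl) hp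
  · exact funext fun s => by rw [hp', h1, one_mul]

lemma dep_tensor_iff {α β : Fin b → B2} {p : Fin m → B2} :
    Dep (tensor α p) (tensor β p) ↔ p = 0 ∨ Dep α β := by
  by_cases hp : p = 0
  · simp [hp, Dep, tensor_eq_zero_iff]
  · simp [hp, Dep, tensor_eq_zero_iff, (tensor_left_injective hp).eq_iff]

open Classical in
lemma card_good_not_dep :
    ((Finset.univ.filter fun w : Pairs b m => Good w ∧ ¬ Dep w.1 w.2).card : ℝ) =
      ((2 : ℝ) ^ m - 1) * ((2 ^ b - 1) * (2 ^ b - 2)) := by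
  have h : (Finset.univ.filter fun w : Pairs b m => Good w ∧ ¬ Dep w.1 w.2) =
      ((Finset.univ.erase (0 : Fin m → B2)) ×ˢ
        (Finset.univ.filter fun x : (Fin b → B2) × (Fin b → B2) => ¬ Dep x.1 x.2)).image
        fun y => (tensor y.2.1 y.1, tensor y.2.2 y.1) := by
    ext w
    simp only [Finset.mem_filter, Finset.mem_univ, true_and, Finset.mem_image, Finset.mem_product,
      Finset.mem_erase, and_true, Prod.exists]
    constructor
    · rintro ⟨h1 | ⟨p, α, β, rfl⟩, h2⟩
      · exact absurd h1 h2
      · rw [dep_tensor_iff, not_or] at h2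
        exact ⟨p, α, β, h2, rfl⟩
    · rintro ⟨p, α, β, h2, rfl⟩
      refine ⟨Or.inr ⟨p, α, β, rfl⟩, ?_⟩
      rwa [dep_tensor_iff, not_or]
  rw [h, Finset.card_image_of_injOn, Finset.card_product, Nat.cast_mul, card_not_dep,
    Finset.card_erase_of_mem (Finset.mem_univ _), Finset.card_univ, Nat.cast_sub Fintype.card_pos]
  · simp [ZMod.card]
  · rintro ⟨p, α, β⟩ h1 ⟨q, α', β'⟩ - he
    simp only [Finset.coe_product, Set.mem_prod, Finset.mem_coe, Finset.mem_erase,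
      Finset.mem_filter, Finset.mem_univ, true_and, and_true] at h1
    obtain ⟨e1, e2⟩ := Prod.mk.inj he
    have hpq : p = q := tensor_right_eq (fun h0 => h1.2 (Or.inl h0)) h1.1 e1
    subst hpq
    exact Prod.ext rfl (Prod.ext (tensor_left_injective h1.1 e1) (tensor_left_injective h1.1 e2))

open Classical in
lemma card_good :
    ((Finset.univ.filter fun w : Pairs b m => Good w).card : ℝ) =
      3 * 2 ^ (m * b) - 2 + ((2 : ℝ) ^ m - 1) * ((2 ^ b - 1) * (2 ^ b - 2)) := by
  have h1 := Finset.card_filter_add_card_filter_not (s := (Finset.univ : Finset (Pairs b m)))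
    (fun w => Dep w.1 w.2)
  have h2 := Finset.card_filter_add_card_filter_not
    (s := Finset.univ.filter fun w : Pairs b m => Good w) (fun w => Dep w.1 w.2)
  rw [Finset.filter_filter, Finset.filter_filter] at h2
  have h3 : (Finset.univ.filter fun w : Pairs b m => Good w ∧ Dep w.1 w.2) =
      Finset.univ.filter fun w : Pairs b m => Dep w.1 w.2 :=
    Finset.filter_congr fun w _ => and_iff_right_of_imp Or.inl
  rw [h3] at h2
  have h4 := card_not_dep (St b m)
  have hcard : (Fintype.card (St b m) : ℝ) = 2 ^ (m * b) := by
    simp [ZMod.card, mul_comm]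
  rw [hcard] at h4
  have h5 : ((Finset.univ : Finset (Pairs b m)).card : ℝ) = 2 ^ (m * b) * 2 ^ (m * b) := by
    rw [Finset.card_univ, Fintype.card_prod, Nat.cast_mul, hcard]
  rw [← card_good_not_dep, ← h2]
  rw [← h1] at h5
  push_cast at h5 ⊢
  linear_combination h5 - h4

end Counting
/-- (Asymptotic XEB of block-random IQP circuits with randomized
parallel CNOTs.)  For every connected graph `G` on `b` blocks, presented by an ordered
partition of its edge set into matchings `c t` (each an involution of the blocks, with
each edge appearing in exactly one matching), the ideal XEB score of the hyperdepth-`L`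
block-random degree-2 IQP ensemble with randomized parallel transversal CNOT gates
converges, as `L → ∞`, to `2 − 2^{1−m·b} + (2^m − 1)(4^b − 3·2^b + 2)/2^{m·b}`. -/
theorem xeb_blockRandom_tendsto (b m r : ℕ) (hb : 1 ≤ b) (hm : 1 ≤ m)
    (c : Fin r → Fin b → Fin b)
    (hinv : ∀ t, Function.Involutive (c t))
    (hpart : ∀ t t' : Fin r, t ≠ t' → ∀ u, c t u ≠ u → c t' u ≠ c t u)
    (hconn : (SimpleGraph.fromRel fun u v : Fin b => ∃ t, c t u = v).Connected) :
    Filter.Tendsto (fun L => xeb b m r c L) Filter.atTop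
      (nhds (2 - 2 * ((2 : ℝ) ^ (m * b))⁻¹ +
        ((2 : ℝ) ^ m - 1) * ((4 : ℝ) ^ b - 3 * 2 ^ b + 2) / (2 : ℝ) ^ (m * b))) := by
  classical
  have hsum := tendsto_finsetSum (Finset.univ : Finset (Pairs b m))
    fun w _ => survival_tendsto r c hinv hconn w
  rw [Finset.sum_boole, card_good] at hsum
  have h2 : (2 : ℝ) ^ (m * b) ≠ 0 := by positivity
  have h4 : (4 : ℝ) ^ b = 2 ^ b * 2 ^ b := by rw [← mul_pow]; norm_num
  simp only [xeb_eq_survival r c hinv]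
  convert (hsum.div_const ((2 : ℝ) ^ (m * b))).sub_const 1 using 2
  rw [h4]
  field_simp
  ring

end Stmt8
end
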